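/- (Pointwise regularity of the Lyapunov exponent, Tall–Viana.) (1) If A ∈ SL₂(ℝ)^κ satisfies L(A) > 0, then there exist a neighborhood U of A in SL₂(ℝ)^κ and constants C, θ > 0 such that |L(A) − L(B)| ≤ C‖A − B‖^θ for every B ∈ U. (2) For every A ∈ SL₂(ℝ)^κ there exist a neighborhood U of A in SL₂(ℝ)^κ and constants C, θ > 0 such that |L(A) − L(B)| ≤ C (log(1/‖A − B‖))^{−θ} for every B ∈ U with B ≠ A. -/

import Mathlib

open MeasureTheory

noncomputable section

abbrev Mat2 : Type := Matrix (Fin 2) (Fin 2) ℝ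
abbrev SL2 : Type := Matrix.SpecialLinearGroup (Fin 2) ℝ
abbrev E2 : Type := EuclideanSpace ℝ (Fin 2)
abbrev Pone : Type := Projectivization ℝ E2

instance : TopologicalSpace SL2 :=
  inferInstanceAs (TopologicalSpace { A : Mat2 // A.det = 1 })

/-- The operator norm of a 2×2 real matrix, acting on Euclidean ℝ². -/
def opNorm (M : Mat2) : ℝ := ‖Matrix.toEuclideanCLM (𝕜 := ℝ) M‖

/-- The continuous linear map on Euclidean ℝ² induced by a matrix in SL₂(ℝ). -/
def toEuc (g : SL2) : E2 →L[ℝ] E2 := Matrix.toEuclideanCLM (𝕜 := ℝ) (g : Mat2)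

lemma toEuc_injective (g : SL2) : Function.Injective (toEuc g) := by
  intro x y hxy
  have key : ∀ z, toEuc g⁻¹ (toEuc g z) = z := by
    intro z
    have h1 : ((g⁻¹ : SL2) : Mat2) * (g : Mat2) = 1 := by
      rw [← Matrix.SpecialLinearGroup.coe_mul, inv_mul_cancel,
        Matrix.SpecialLinearGroup.coe_one]
    calc toEuc g⁻¹ (toEuc g z)
        = (Matrix.toEuclideanCLM (𝕜 := ℝ) (((g⁻¹ : SL2) : Mat2) * (g : Mat2))) z := by
          rw [map_mul]; rfl
      _ = z := by rw [h1, map_one]; rfl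
  have := congrArg (toEuc g⁻¹) hxy
  rwa [key, key] at this

/-- The projective action of SL₂(ℝ) on the real projective line ℙ¹. -/
def pact (g : SL2) : Pone → Pone :=
  Projectivization.map (toEuc g).toLinearMap (toEuc_injective g)

instance : MeasurableSpace Pone :=
  inferInstanceAs (MeasurableSpace (Quotient (projectivizationSetoid ℝ E2)))

instance : TopologicalSpace Pone :=
  inferInstanceAs (TopologicalSpace (Quotient (projectivizationSetoid ℝ E2)))

/-- The ordered product `A_{w_{n-1}} ⋯ A_{w_1} A_{w_0}` of the matrices along a word `w`. -/
def wordProd {κ : ℕ} (A : Fin κ → SL2) {n : ℕ} (w : Fin n → Fin κ) : SL2 :=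
  (List.ofFn fun i => A (w i)).reverse.prod

/-- The Lyapunov exponent of the random product of the matrices `A_1, …, A_κ` with
probabilities `p_1, …, p_κ`:
`L(p,A) = inf_{n ≥ 1} (1/n) ∫_Σ log‖A^n(x)‖ dμ_p(x) = inf_{n ≥ 1} (1/n) Σ_w p(w) log‖A_w‖`,
the integral over the Bernoulli measure `μ_p = p^ℤ` being a finite sum over words of
length `n` since the cocycle is locally constant. -/
def lyapLC {κ : ℕ} (p : Fin κ → ℝ) (A : Fin κ → SL2) : ℝ :=
  ⨅ n : {m : ℕ // 0 < m},
    (((n : ℕ) : ℝ))⁻¹ * ∑ w : Fin (n : ℕ) → Fin κ,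
      (∏ i, p (w i)) * Real.log (opNorm ((wordProd A w : SL2) : Mat2))

/-- The distance `‖B₁ − B₂‖` on tuples of matrices (sup of the operator norms of the
differences of the components). -/
def tdist {κ : ℕ} (B₁ B₂ : Fin κ → SL2) : ℝ :=
  ⨆ i, opNorm ((B₁ i : Mat2) - (B₂ i : Mat2))

namespace TV
open Finset

/-! ### Expectations along words -/

section ex
variable {ι : Type*} [Fintype ι] {G : Type*} [Monoid G] {H : Type*} [Monoid H]

/-- Expectation of `φ (A_{i_n} ⋯ A_{i_1})`. -/
def ex (p : ι → ℝ) (A : ι → G) : ℕ → (G → ℝ) → ℝ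
  | 0, φ => φ 1
  | n+1, φ => ∑ i, p i * ex p A n (fun g => φ (g * A i))

/-- The words of length `n`. -/
inductive W (A : ι → G) : ℕ → G → Prop
  | one : W A 0 1
  | mul {n : ℕ} {g : G} (i : ι) : W A n g → W A (n+1) (g * A i)

/-- Positive probability vector. -/
structure Pr (p : ι → ℝ) : Prop where
  pos : ∀ i, 0 < p i
  sum : ∑ i, p i = 1

variable {p : ι → ℝ} {A : ι → G}

@[simp] lemma ex_zero (φ : G → ℝ) : ex p A 0 φ = φ 1 := rfl
lemma ex_succ (n : ℕ) (φ : G → ℝ) :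
    ex p A (n+1) φ = ∑ i, p i * ex p A n (fun g => φ (g * A i)) := rfl

lemma ex_mono_W (hp : Pr p) {n : ℕ} {φ ψ : G → ℝ} (h : ∀ g, W A n g → φ g ≤ ψ g) :
    ex p A n φ ≤ ex p A n ψ := by
  induction n generalizing φ ψ with
  | zero => exact h 1 W.one
  | succ n ih =>
    refine sum_le_sum fun i _ => mul_le_mul_of_nonneg_left ?_ (hp.pos i).le
    exact ih fun g hg => h _ (W.mul i hg)

lemma ex_mono (hp : Pr p) {n : ℕ} {φ ψ : G → ℝ} (h : ∀ g, φ g ≤ ψ g) :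
    ex p A n φ ≤ ex p A n ψ := ex_mono_W hp fun g _ => h g

lemma ex_congr_W (n : ℕ) {φ ψ : G → ℝ} (h : ∀ g, W A n g → φ g = ψ g) :
    ex p A n φ = ex p A n ψ := by
  induction n generalizing φ ψ with
  | zero => exact h 1 W.one
  | succ n ih =>
    refine sum_congr rfl fun i _ => ?_
    rw [ih fun g hg => h _ (W.mul i hg)]

lemma ex_congr (n : ℕ) {φ ψ : G → ℝ} (h : ∀ g, φ g = ψ g) :
    ex p A n φ = ex p A n ψ := ex_congr_W n fun g _ => h g

lemma ex_add' (n : ℕ) (φ ψ : G → ℝ) :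
    ex p A n (fun g => φ g + ψ g) = ex p A n φ + ex p A n ψ := by
  induction n generalizing φ ψ with
  | zero => rfl
  | succ n ih =>
    simp only [ex_succ, ← sum_add_distrib, ← mul_add]
    refine sum_congr rfl fun i _ => ?_
    rw [ih]

lemma ex_smul (n : ℕ) (c : ℝ) (φ : G → ℝ) :
    ex p A n (fun g => c * φ g) = c * ex p A n φ := by
  induction n generalizing φ with
  | zero => rfl
  | succ n ih =>
    simp only [ex_succ, mul_sum]
    refine sum_congr rfl fun i _ => ?_
    rw [ih]; ring

lemma ex_neg (n : ℕ) (φ : G → ℝ) :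
    ex p A n (fun g => - φ g) = - ex p A n φ := by
  have := ex_smul (p := p) (A := A) n (-1) φ
  simpa using this

lemma ex_sub (n : ℕ) (φ ψ : G → ℝ) :
    ex p A n (fun g => φ g - ψ g) = ex p A n φ - ex p A n ψ := by
  simp only [sub_eq_add_neg, ex_add', ex_neg]

lemma ex_const (hp : Pr p) (n : ℕ) (c : ℝ) : ex p A n (fun _ => c) = c := by
  induction n with
  | zero => rfl
  | succ n ih => simp only [ex_succ, ih, ← sum_mul, hp.sum, one_mul]

lemma ex_sum {κ : Type*} (s : Finset κ) (n : ℕ) (φ : κ → G → ℝ) :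
    ex p A n (fun g => ∑ k ∈ s, φ k g) = ∑ k ∈ s, ex p A n (φ k) := by
  classical
  induction s using Finset.induction_on with
  | empty =>
    simp only [sum_empty]
    have := ex_smul (p := p) (A := A) n 0 (fun _ => 0)
    simpa using this
  | insert a s ha ih => simp only [sum_insert ha, ex_add', ih]

lemma ex_add (m n : ℕ) (φ : G → ℝ) :
    ex p A (m+n) φ = ex p A m (fun g => ex p A n (fun h => φ (h * g))) := by
  induction m generalizing φ with
  | zero => simp
  | succ m ih =>
    rw [show m + 1 + n = (m+n)+1 by ring, ex_succ, ex_succ]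
    refine sum_congr rfl fun i _ => ?_
    rw [ih]; simp only [mul_assoc]

lemma ex_succ_last (n : ℕ) (φ : G → ℝ) :
    ex p A (n+1) φ = ex p A n (fun g => ∑ i, p i * φ (A i * g)) := by
  rw [ex_add]; simp [ex_succ]

lemma ex_comm {κ : Type*} [Fintype κ] {q : κ → ℝ} {B : κ → H} (m n : ℕ) (φ : G → H → ℝ) :
    ex p A m (fun g => ex q B n (fun h => φ g h)) =
      ex q B n (fun h => ex p A m (fun g => φ g h)) := by
  induction m generalizing φ with
  | zero => rfl
  | succ m ih =>
    simp only [ex_succ]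
    rw [ex_sum]
    refine sum_congr rfl fun i _ => ?_
    rw [ih, ex_smul]

lemma ex_map (f : G →* H) (n : ℕ) (φ : H → ℝ) :
    ex p (fun i => f (A i)) n φ = ex p A n (fun g => φ (f g)) := by
  induction n generalizing φ with
  | zero => simp
  | succ n ih => simp only [ex_succ, ih, map_mul]

lemma ex_nonneg (hp : Pr p) {n : ℕ} {φ : G → ℝ} (h : ∀ g, W A n g → 0 ≤ φ g) :
    0 ≤ ex p A n φ := by
  rw [← ex_const (A := A) hp n 0]; exact ex_mono_W hp h

lemma abs_ex_le (hp : Pr p) {n : ℕ} (φ : G → ℝ) : |ex p A n φ| ≤ ex p A n (fun g => |φ g|) := by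
  rw [abs_le, ← ex_neg]
  exact ⟨ex_mono hp fun g => neg_abs_le _, ex_mono hp fun g => le_abs_self _⟩

lemma ex_pos (hp : Pr p) {n : ℕ} {φ : G → ℝ} (h : ∀ g, W A n g → 0 < φ g) :
    0 < ex p A n φ := by
  induction n generalizing φ with
  | zero => exact h 1 W.one
  | succ n ih =>
    refine sum_pos (fun i _ => mul_pos (hp.pos i) (ih fun g hg => h _ (W.mul i hg))) ?_
    by_contra hne
    have := hp.sum
    rw [not_nonempty_iff_eq_empty] at hne
    rw [hne] at this; simp at this

lemma ex_log_le (hp : Pr p) {n : ℕ} {φ : G → ℝ} (h : ∀ g, W A n g → 0 < φ g) :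
    ex p A n (fun g => Real.log (φ g)) ≤ Real.log (ex p A n φ) := by
  have hc := ex_pos hp h
  set c := ex p A n φ with hcdef
  have h1 : ex p A n (fun g => Real.log (φ g)) ≤
      ex p A n (fun g => c⁻¹ * φ g + (Real.log c - 1)) := by
    refine ex_mono_W hp fun g hg => ?_
    have hg' := h g hg
    have := Real.log_le_sub_one_of_pos (mul_pos (inv_pos.2 hc) hg')
    rw [Real.log_mul (inv_pos.2 hc).ne' hg'.ne', Real.log_inv] at this
    linarith
  rw [ex_add', ex_smul, ex_const hp, ← hcdef, inv_mul_cancel₀ hc.ne'] at h1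
  linarith

lemma W.mul_mem {m n : ℕ} {g h : G} (hg : W A m g) (hh : W A n h) : W A (n+m) (g * h) := by
  induction hh with
  | one => simpa using hg
  | @mul k h i _ ih => rw [← mul_assoc, add_right_comm]; exact W.mul i ih

lemma W.single (i : ι) : W A 1 (A i) := by
  have := W.mul (A := A) i W.one
  simpa using this

lemma W.cons {n : ℕ} {g : G} (i : ι) (hg : W A n g) : W A (n+1) (A i * g) :=
  W.mul_mem (W.single i) hg

lemma Pr.nonempty (hp : Pr p) : Nonempty ι := by
  by_contra h
  rw [not_nonempty_iff] at h
  have := hp.sum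
  simp at this

end ex

/-! ### Vectors and matrices -/

/-- The plane. -/
abbrev V : Type := Fin 2 → ℝ

/-- ℓ¹ norm. -/
def en (v : V) : ℝ := |v 0| + |v 1|

/-- Wedge. -/
def wd (u v : V) : ℝ := u 0 * v 1 - u 1 * v 0

/-- Sum of absolute values of the entries. -/
def nm (g : Mat2) : ℝ := |g 0 0| + |g 0 1| + |g 1 0| + |g 1 1|

/-- Action on vectors. -/
def ac (g : SL2) (v : V) : V := (g : Mat2).mulVec v

lemma ac0 (g : SL2) (v : V) : ac g v 0 = g 0 0 * v 0 + g 0 1 * v 1 := by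
  simp [ac, Matrix.mulVec, dotProduct, Fin.sum_univ_two]
lemma ac1 (g : SL2) (v : V) : ac g v 1 = g 1 0 * v 0 + g 1 1 * v 1 := by
  simp [ac, Matrix.mulVec, dotProduct, Fin.sum_univ_two]

@[simp] lemma ac_one (v : V) : ac 1 v = v := by simp [ac]
lemma ac_mul (g h : SL2) (v : V) : ac (g * h) v = ac g (ac h v) := by
  simp only [ac, Matrix.SpecialLinearGroup.coe_mul, Matrix.mulVec_mulVec]
lemma ac_inv (g : SL2) (v : V) : ac g⁻¹ (ac g v) = v := by rw [← ac_mul]; simp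
lemma ac_inv' (g : SL2) (v : V) : ac g (ac g⁻¹ v) = v := by rw [← ac_mul]; simp

lemma det2 (g : SL2) : g 0 0 * g 1 1 - g 0 1 * g 1 0 = 1 := by
  have := g.2
  rwa [Matrix.det_fin_two] at this

lemma sl_mul (g h : SL2) (i j : Fin 2) : (g * h) i j = g i 0 * h 0 j + g i 1 * h 1 j := by
  simp [Matrix.SpecialLinearGroup.coe_mul, Matrix.mul_apply, Fin.sum_univ_two]
lemma inv00 (g : SL2) : g⁻¹ 0 0 = g 1 1 := by simp [Matrix.SpecialLinearGroup.SL2_inv_expl]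
lemma inv01 (g : SL2) : g⁻¹ 0 1 = - g 0 1 := by simp [Matrix.SpecialLinearGroup.SL2_inv_expl]
lemma inv10 (g : SL2) : g⁻¹ 1 0 = - g 1 0 := by simp [Matrix.SpecialLinearGroup.SL2_inv_expl]
lemma inv11 (g : SL2) : g⁻¹ 1 1 = g 0 0 := by simp [Matrix.SpecialLinearGroup.SL2_inv_expl]

lemma wd_ac (g : SL2) (u v : V) : wd (ac g u) (ac g v) = wd u v := by
  simp only [wd, ac0, ac1]
  linear_combination (u 0 * v 1 - u 1 * v 0) * det2 g

lemma wd_ac_left (g : SL2) (u v : V) : wd (ac g u) v = wd u (ac g⁻¹ v) := by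
  rw [← wd_ac g u, ac_inv']

lemma wd_le (u v : V) : |wd u v| ≤ en u * en v := by
  unfold wd en
  calc |u 0 * v 1 - u 1 * v 0| ≤ |u 0 * v 1| + |u 1 * v 0| := abs_sub _ _
    _ = |u 0| * |v 1| + |u 1| * |v 0| := by rw [abs_mul, abs_mul]
    _ ≤ _ := by nlinarith [abs_nonneg (u 0), abs_nonneg (u 1), abs_nonneg (v 0), abs_nonneg (v 1),
        mul_nonneg (abs_nonneg (u 0)) (abs_nonneg (v 0)),
        mul_nonneg (abs_nonneg (u 1)) (abs_nonneg (v 1))]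

lemma en_nonneg (v : V) : 0 ≤ en v := by unfold en; positivity
lemma en_eq_zero {v : V} : en v = 0 ↔ v = 0 := by
  unfold en
  constructor
  · intro h
    have h0 : |v 0| = 0 := by linarith [abs_nonneg (v 0), abs_nonneg (v 1)]
    have h1 : |v 1| = 0 := by linarith [abs_nonneg (v 0), abs_nonneg (v 1)]
    ext i; fin_cases i
    · simpa using h0
    · simpa using h1
  · rintro rfl; simp
lemma en_pos {v : V} (h : v ≠ 0) : 0 < en v :=
  lt_of_le_of_ne (en_nonneg v) fun h' => h (en_eq_zero.1 h'.symm)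
lemma en_smul (c : ℝ) (v : V) : en (c • v) = |c| * en v := by
  simp [en, abs_mul, mul_add]
lemma en_add (u v : V) : en (u + v) ≤ en u + en v := by
  simp only [en, Pi.add_apply]
  linarith [abs_add_le (u 0) (v 0), abs_add_le (u 1) (v 1)]
lemma en_neg (u : V) : en (-u) = en u := by simp [en]
lemma en_sub (u v : V) : en (u - v) ≤ en u + en v := by
  rw [sub_eq_add_neg, ← en_neg v]; exact en_add _ _

lemma ac_zero (g : SL2) : ac g 0 = 0 := by simp [ac]
lemma ac_add (g : SL2) (u v : V) : ac g (u + v) = ac g u + ac g v := by simp [ac, Matrix.mulVec_add]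
lemma ac_sub (g : SL2) (u v : V) : ac g (u - v) = ac g u - ac g v := by simp [ac, Matrix.mulVec_sub]
lemma ac_smul (g : SL2) (c : ℝ) (v : V) : ac g (c • v) = c • ac g v := by
  simp [ac, Matrix.mulVec_smul]
lemma ac_ne (g : SL2) {v : V} (h : v ≠ 0) : ac g v ≠ 0 := by
  intro h'
  apply h
  rw [← ac_inv g v, h', ac_zero]

lemma en_mulVec (M : Mat2) (v : V) : en (M.mulVec v) ≤ nm M * en v := by
  have e0 : M.mulVec v 0 = M 0 0 * v 0 + M 0 1 * v 1 := by
    simp [Matrix.mulVec, dotProduct, Fin.sum_univ_two]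
  have e1 : M.mulVec v 1 = M 1 0 * v 0 + M 1 1 * v 1 := by
    simp [Matrix.mulVec, dotProduct, Fin.sum_univ_two]
  unfold en nm
  rw [e0, e1]
  have h0 := abs_add_le (M 0 0 * v 0) (M 0 1 * v 1)
  have h1 := abs_add_le (M 1 0 * v 0) (M 1 1 * v 1)
  simp only [abs_mul] at h0 h1
  have a := abs_nonneg (v 0)
  have b := abs_nonneg (v 1)
  nlinarith [mul_nonneg (abs_nonneg (M 0 0)) b, mul_nonneg (abs_nonneg (M 0 1)) a,
    mul_nonneg (abs_nonneg (M 1 0)) b, mul_nonneg (abs_nonneg (M 1 1)) a]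

lemma en_ac_le (g : SL2) (v : V) : en (ac g v) ≤ nm g * en v := en_mulVec _ _

lemma nm_nonneg (g : Mat2) : 0 ≤ nm g := by unfold nm; positivity

lemma nm_mul (g h : Mat2) : nm (g * h) ≤ nm g * nm h := by
  simp only [nm, Matrix.mul_apply, Fin.sum_univ_two]
  have h1 := abs_add_le (g 0 0 * h 0 0) (g 0 1 * h 1 0)
  have h2 := abs_add_le (g 0 0 * h 0 1) (g 0 1 * h 1 1)
  have h3 := abs_add_le (g 1 0 * h 0 0) (g 1 1 * h 1 0)
  have h4 := abs_add_le (g 1 0 * h 0 1) (g 1 1 * h 1 1)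
  simp only [abs_mul] at h1 h2 h3 h4
  have a := abs_nonneg (g 0 0)
  have b := abs_nonneg (g 0 1)
  have c := abs_nonneg (g 1 0)
  have d := abs_nonneg (g 1 1)
  have a' := abs_nonneg (h 0 0)
  have b' := abs_nonneg (h 0 1)
  have c' := abs_nonneg (h 1 0)
  have d' := abs_nonneg (h 1 1)
  nlinarith [mul_nonneg a c', mul_nonneg a d', mul_nonneg b a', mul_nonneg b b', mul_nonneg c c',
    mul_nonneg c d', mul_nonneg d a', mul_nonneg d b']

lemma nm_mul' (g h : SL2) : nm (g * h : SL2) ≤ nm g * nm h := by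
  rw [Matrix.SpecialLinearGroup.coe_mul]; exact nm_mul _ _

lemma nm_add (g h : Mat2) : nm (g + h) ≤ nm g + nm h := by
  simp only [nm, Matrix.add_apply]
  linarith [abs_add_le (g 0 0) (h 0 0), abs_add_le (g 0 1) (h 0 1), abs_add_le (g 1 0) (h 1 0),
    abs_add_le (g 1 1) (h 1 1)]

lemma nm_neg (g : Mat2) : nm (-g) = nm g := by simp [nm]
lemma nm_sub_comm (g h : Mat2) : nm (g - h) = nm (h - g) := by rw [← nm_neg, neg_sub]

lemma nm_ge_one (g : SL2) : 1 ≤ nm g := by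
  have h := det2 g
  have h1 : |g 0 0 * g 1 1 - g 0 1 * g 1 0| = 1 := by rw [h]; simp
  have h2 := abs_sub (g 0 0 * g 1 1) (g 0 1 * g 1 0)
  rw [h1, abs_mul, abs_mul] at h2
  have a := abs_nonneg (g 0 0)
  have b := abs_nonneg (g 0 1)
  have c := abs_nonneg (g 1 0)
  have d := abs_nonneg (g 1 1)
  unfold nm
  by_contra hlt
  push Not at hlt
  nlinarith [mul_nonneg a b, mul_nonneg a c, mul_nonneg b d, mul_nonneg c d]

lemma nm_pos (g : SL2) : 0 < nm g := lt_of_lt_of_le one_pos (nm_ge_one g)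

lemma nm_inv (g : SL2) : nm (g⁻¹ : SL2) = nm g := by
  unfold nm
  have h00 := inv00 g
  have h01 := inv01 g
  have h10 := inv10 g
  have h11 := inv11 g
  rw [h00, h01, h10, h11, abs_neg, abs_neg]; ring

lemma nm_one : nm 1 = 2 := by simp [nm]; norm_num

lemma en_le_ac (g : SL2) (v : V) : en v ≤ nm g * en (ac g v) := by
  have := en_ac_le g⁻¹ (ac g v)
  rwa [ac_inv, nm_inv] at this

lemma log_nm_nonneg (g : SL2) : 0 ≤ Real.log (nm g) := Real.log_nonneg (nm_ge_one g)

/-- basis vectors -/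
def e0 : V := ![1, 0]
/-- basis vectors -/
def e1 : V := ![0, 1]

lemma nm_eq (g : SL2) : nm g = en (ac g e0) + en (ac g e1) := by
  simp only [nm, en, ac0, ac1, e0, e1]; simp; ring

lemma en_e0 : en e0 = 1 := by simp [en, e0]
lemma en_e1 : en e1 = 1 := by simp [en, e1]

lemma exists_col (g : SL2) : ∃ v : V, en v = 1 ∧ nm g ≤ 2 * en (ac g v) := by
  have := nm_eq g
  by_cases h : en (ac g e1) ≤ en (ac g e0)
  · exact ⟨e0, en_e0, by linarith⟩
  · exact ⟨e1, en_e1, by linarith⟩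

/-- contracted vector -/
lemma exists_contr (g : SL2) : ∃ z : V, en (ac g z) = 1 ∧ nm g ≤ 2 * en z := by
  obtain ⟨v, hv, h⟩ := exists_col g⁻¹
  refine ⟨ac g⁻¹ v, by rwa [ac_inv'], by rwa [nm_inv] at h⟩

/-- dist-like inequality for single vector via contracted vector. -/
lemma wd_le_ac (g : SL2) (u z : V) (hz : en (ac g z) = 1) : |wd u z| ≤ en (ac g u) := by
  rw [← wd_ac g]
  have := wd_le (ac g u) (ac g z)
  rwa [hz, mul_one] at this

end TV

namespace TV
open Finset

lemma arch_le {x y C : ℝ} (h : ∀ n : ℕ, n * x ≤ n * y + C) : x ≤ y := by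
  by_contra hlt
  push Not at hlt
  obtain ⟨n, hn⟩ := exists_nat_gt (C / (x - y))
  have hpos : 0 < x - y := by linarith
  rw [div_lt_iff₀ hpos] at hn
  have := h n
  nlinarith

section ly
variable {ι : Type*} [Fintype ι] {p : ι → ℝ} {A B : ι → SL2}

/-- Expected log norm. -/
def aa (p : ι → ℝ) (A : ι → SL2) (n : ℕ) : ℝ := ex p A n (fun g => Real.log (nm g))

/-- Lyapunov exponent. -/
def Ly (p : ι → ℝ) (A : ι → SL2) : ℝ := sInf ((fun n : ℕ => aa p A n / n) '' Set.Ici 1)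

lemma aa_nonneg (hp : Pr p) (n : ℕ) : 0 ≤ aa p A n := ex_nonneg hp fun g _ => log_nm_nonneg g

lemma aa_sub (hp : Pr p) (A : ι → SL2) : Subadditive (aa p A) := by
  intro m n
  unfold aa
  rw [ex_add]
  calc _ ≤ ex p A m (fun g => Real.log (nm g) + aa p A n) := by
        refine ex_mono hp fun g => ?_
        unfold aa
        rw [add_comm, ← ex_const (A := A) hp n (Real.log (nm g)), ← ex_add']
        refine ex_mono hp fun h => ?_
        rw [← Real.log_mul (nm_pos _).ne' (nm_pos _).ne']
        exact Real.log_le_log (nm_pos _) (nm_mul' _ _)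
    _ = _ := by rw [ex_add', ex_const hp]; rfl

lemma aa_bdd (hp : Pr p) (A : ι → SL2) : BddBelow (Set.range fun n => aa p A n / n) := by
  refine ⟨0, ?_⟩
  rintro _ ⟨n, rfl⟩
  exact div_nonneg (aa_nonneg hp n) (Nat.cast_nonneg n)

lemma lim_eq (hp : Pr p) (A : ι → SL2) : (aa_sub hp A).lim = Ly p A := by
  rw [Subadditive.lim]; rfl

lemma ly_mul_le (hp : Pr p) (n : ℕ) : n * Ly p A ≤ aa p A n := by
  rcases Nat.eq_zero_or_pos n with rfl | hn
  · simpa using aa_nonneg (A := A) hp 0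
  · have h := (aa_sub hp A).lim_le_div (aa_bdd hp A) hn.ne'
    have hn' : (0:ℝ) < n := by exact_mod_cast hn
    rw [le_div_iff₀ hn', lim_eq hp] at h
    rw [mul_comm]; exact h

lemma ly_up (hp : Pr p) (A : ι → SL2) {ε : ℝ} (hε : 0 < ε) :
    ∃ C, ∀ n : ℕ, aa p A n ≤ n * (Ly p A + ε) + C := by
  have h := (aa_sub hp A).tendsto_lim (aa_bdd hp A)
  have h2 := h.eventually (gt_mem_nhds (show (aa_sub hp A).lim < Ly p A + ε by
    rw [lim_eq hp]; linarith))
  rw [Filter.eventually_atTop] at h2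
  obtain ⟨N, hN⟩ := h2
  refine ⟨∑ n ∈ range (N+1), |aa p A n - n * (Ly p A + ε)|, fun n => ?_⟩
  by_cases hn : n < N + 1
  · have := single_le_sum (f := fun n : ℕ => |aa p A n - n * (Ly p A + ε)|)
      (fun i _ => abs_nonneg _) (mem_range.2 hn)
    have h3 := le_abs_self (aa p A n - n * (Ly p A + ε))
    beta_reduce at this
    linarith
  · have h3 := hN n (by omega)
    have hn' : (0:ℝ) < n := by exact_mod_cast (by omega : 0 < n)
    rw [div_lt_iff₀ hn'] at h3
    have : 0 ≤ ∑ n ∈ range (N+1), |aa p A n - n * (Ly p A + ε)| :=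
      sum_nonneg fun i _ => abs_nonneg _
    linarith

lemma ly_le_of (hp : Pr p) {lam C : ℝ} (h : ∀ n : ℕ, aa p A n ≤ n * lam + C) : Ly p A ≤ lam :=
  arch_le (C := C) fun n => (ly_mul_le hp n).trans (h n)

lemma le_ly_of (hp : Pr p) {lam C : ℝ} (h : ∀ n : ℕ, n * lam - C ≤ aa p A n) : lam ≤ Ly p A := by
  refine le_of_forall_pos_le_add fun ε hε => ?_
  obtain ⟨C', hC'⟩ := ly_up hp A hε
  exact arch_le (C := C + C') fun n => by linarith [h n, hC' n]

lemma ly_nonneg (hp : Pr p) (A : ι → SL2) : 0 ≤ Ly p A :=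
  le_ly_of hp (C := 0) fun n => by simpa using aa_nonneg hp n

lemma ly_eq_zero_of_bdd (hp : Pr p) {R : ℝ} (h : ∀ n g, W A n g → nm g ≤ R) : Ly p A = 0 := by
  refine le_antisymm (ly_le_of hp (C := Real.log R) fun n => ?_) (ly_nonneg hp A)
  rw [mul_zero, zero_add, ← ex_const (A := A) hp n (Real.log R)]
  exact ex_mono_W hp fun g hg => Real.log_le_log (nm_pos g) (h n g hg)

/-- `Λ_n(v)`. -/
def La (p : ι → ℝ) (A : ι → SL2) (n : ℕ) (v : V) : ℝ :=
  ex p A n (fun g => Real.log (en (ac g v) / en v))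

lemma La_le (hp : Pr p) {v : V} (hv : v ≠ 0) (n : ℕ) : La p A n v ≤ aa p A n := by
  refine ex_mono hp fun g => ?_
  have h1 := en_pos hv
  have h2 := en_pos (ac_ne g hv)
  refine Real.log_le_log (div_pos h2 h1) ?_
  rw [div_le_iff₀ h1]; exact en_ac_le g v

lemma La_zero {v : V} (hv : v ≠ 0) : La p A 0 v = 0 := by
  simp [La, (en_pos hv).ne']

lemma La_succ (hp : Pr p) {v : V} (hv : v ≠ 0) (n : ℕ) : La p A (n+1) v =
    ∑ i, p i * (Real.log (en (ac (A i) v) / en v) + La p A n (ac (A i) v)) := by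
  unfold La
  rw [ex_succ]
  refine sum_congr rfl fun i _ => ?_
  rw [← ex_const (A := A) hp n (Real.log (en (ac (A i) v) / en v)), ← ex_add']
  congr 1
  refine ex_congr n fun g => ?_
  rw [ac_mul, ← Real.log_mul]
  · congr 1
    field_simp [(en_pos hv).ne', (en_pos (ac_ne (A i) hv)).ne']
  · exact (div_pos (en_pos (ac_ne _ hv)) (en_pos hv)).ne'
  · exact (div_pos (en_pos (ac_ne _ (ac_ne _ hv))) (en_pos (ac_ne _ hv))).ne'

lemma vl_low (hp : Pr p) {lam C : ℝ} {v : V} (hv : v ≠ 0) (h : ∀ n : ℕ, n * lam - C ≤ La p A n v) :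
    lam ≤ Ly p A :=
  le_ly_of hp fun n => (h n).trans (La_le hp hv n)

/-- test vectors -/
def vk (j : ℕ) : V := ![1, j]

lemma vk_ne (j : ℕ) : vk j ≠ 0 := fun h => by
  have := congrFun h 0
  simp [vk] at this

lemma nm_le_vk (g : SL2) {i j K : ℕ} (hi : i < K) (hij : i ≠ j) :
    nm g ≤ (K + 2) * (en (ac g (vk i)) + en (ac g (vk j))) := by
  have hne : ((i:ℝ) - j) ≠ 0 := by
    rw [sub_ne_zero]; exact_mod_cast hij
  have habs : 1 ≤ |(i:ℝ) - j| := by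
    have : (1:ℤ) ≤ |(i:ℤ) - j| := Int.one_le_abs (by omega)
    exact_mod_cast this
  have h1 : ((i:ℝ) - j) • ac g e1 = ac g (vk i) - ac g (vk j) := by
    rw [← ac_smul, ← ac_sub]; congr 1
    ext k; fin_cases k <;> simp [vk, e1]
  have h2 : ac g e0 = ac g (vk i) - (i:ℝ) • ac g e1 := by
    rw [← ac_smul, ← ac_sub]; congr 1
    ext k; fin_cases k <;> simp [vk, e1, e0]
  have h3 : en (ac g e1) ≤ en (ac g (vk i)) + en (ac g (vk j)) := by
    have := en_sub (ac g (vk i)) (ac g (vk j))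
    rw [← h1, en_smul] at this
    nlinarith [en_nonneg (ac g e1)]
  have h4 : en (ac g e0) ≤ en (ac g (vk i)) + K * en (ac g e1) := by
    rw [h2]
    refine (en_sub _ _).trans ?_
    rw [en_smul, abs_of_nonneg (Nat.cast_nonneg i)]
    have : (i:ℝ) ≤ K := by exact_mod_cast hi.le
    nlinarith [en_nonneg (ac g e1)]
  rw [nm_eq]
  have hK : (0:ℝ) ≤ K := Nat.cast_nonneg K
  nlinarith [en_nonneg (ac g (vk j)), en_nonneg (ac g (vk i))]

lemma vk_sum (g : SL2) {K : ℕ} (hK : 0 < K) :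
    ((K:ℝ) - 2) * Real.log (nm g) - K * Real.log (2 * (K + 2)) ≤
      ∑ j ∈ range K, Real.log (en (ac g (vk j))) := by
  have hKr : (0:ℝ) ≤ K := Nat.cast_nonneg K
  set c := Real.log (2 * (K + 2)) with hc
  have hcpos : 0 ≤ c := Real.log_nonneg (by linarith)
  have hposv : ∀ j, 0 < en (ac g (vk j)) := fun j => en_pos (ac_ne g (vk_ne j))
  have hlow : ∀ j, - Real.log (nm g) ≤ Real.log (en (ac g (vk j))) := by
    intro j
    rw [← Real.log_inv]
    refine Real.log_le_log (inv_pos.2 (nm_pos g)) ?_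
    rw [inv_le_iff_one_le_mul₀ (nm_pos g), mul_comm]
    refine le_trans ?_ (en_le_ac g (vk j))
    simp [en, vk]
  have hex : ∃ j0 ∈ range K, ∀ j ∈ (range K).erase j0,
      Real.log (nm g) - c ≤ Real.log (en (ac g (vk j))) := by
    have hgood : ∀ j, nm g ≤ 2 * (K + 2) * en (ac g (vk j)) →
        Real.log (nm g) - c ≤ Real.log (en (ac g (vk j))) := by
      intro j hj
      have := Real.log_le_log (nm_pos g) hj
      rw [Real.log_mul (by positivity) (hposv j).ne'] at this
      linarith
    by_cases hb : ∃ j0 ∈ range K, 2 * (K + 2) * en (ac g (vk j0)) < nm g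
    · obtain ⟨j0, hj0, hlt⟩ := hb
      refine ⟨j0, hj0, fun j hj => hgood j ?_⟩
      rw [mem_erase, mem_range] at hj
      have := nm_le_vk g hj.2 hj.1
      nlinarith
    · push Not at hb
      exact ⟨0, mem_range.2 hK, fun j hj => hgood j (hb j (mem_of_mem_erase hj))⟩
  obtain ⟨j0, hj0, hg⟩ := hex
  rw [← add_sum_erase _ _ hj0]
  have h1 := sum_le_sum hg
  rw [sum_const, card_erase_of_mem hj0, card_range, nsmul_eq_mul, Nat.cast_sub hK] at h1
  have h2 := hlow j0
  push_cast at h1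
  nlinarith

lemma vl_up' (hp : Pr p) {lam : ℝ} {C : ℕ → ℝ} (h : ∀ j n : ℕ, La p A n (vk j) ≤ n * lam + C j) :
    Ly p A ≤ lam := by
  have key : ∀ K : ℕ, 2 ≤ K → ((K:ℝ) - 2) * Ly p A ≤ K * lam := by
    intro K hK
    have hKr : (2:ℝ) ≤ K := by exact_mod_cast hK
    refine arch_le (C := K * Real.log (2 * (K + 2)) + ∑ j ∈ range K, (C j + Real.log (en (vk j))))
      fun n => ?_
    have h1 : ex p A n (fun g => ((K:ℝ) - 2) * Real.log (nm g) - K * Real.log (2 * (K + 2))) ≤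
        ex p A n (fun g => ∑ j ∈ range K, Real.log (en (ac g (vk j)))) :=
      ex_mono hp fun g => vk_sum g (by omega)
    rw [ex_sub, ex_smul, ex_const hp, ex_sum] at h1
    have h2 : ∀ j, ex p A n (fun g => Real.log (en (ac g (vk j)))) ≤
        n * lam + (C j + Real.log (en (vk j))) := by
      intro j
      have := h j n
      unfold La at this
      have h3 : ex p A n (fun g => Real.log (en (ac g (vk j)) / en (vk j))) =
          ex p A n (fun g => Real.log (en (ac g (vk j)))) - Real.log (en (vk j)) := by
        rw [← ex_const (A := A) hp n (Real.log (en (vk j))), ← ex_sub]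
        refine ex_congr n fun g => ?_
        rw [Real.log_div (en_pos (ac_ne g (vk_ne j))).ne' (en_pos (vk_ne j)).ne']
      linarith
    have h4 := h1.trans (sum_le_sum fun j _ => h2 j)
    rw [sum_add_distrib, sum_const, card_range, nsmul_eq_mul] at h4
    have h5 := ly_mul_le (A := A) hp n
    change _ * aa p A n - _ ≤ _ at h4
    nlinarith
  refine arch_le (C := 2 * Ly p A + 2 * |lam|) fun n => ?_
  rcases lt_or_ge n 2 with hn | hn
  · have := ly_nonneg hp A
    have h0 := neg_abs_le lam
    have h1 := abs_nonneg lam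
    interval_cases n <;> push_cast <;> nlinarith
  · have := key n hn
    have h1 := abs_nonneg lam
    linarith

lemma vl_up (hp : Pr p) {lam C : ℝ} (h : ∀ v : V, v ≠ 0 → ∀ n : ℕ, La p A n v ≤ n * lam + C) :
    Ly p A ≤ lam :=
  vl_up' hp (C := fun _ => C) fun j n => h (vk j) (vk_ne j) n

/-- Upper bounds transfer through bounded multiplicative change of the norm. -/
lemma aa_conj (hp : Pr p) (S : SL2) (A : ι → SL2) (n : ℕ) :
    aa p (fun i => S * A i * S⁻¹) n ≤ aa p A n + 2 * Real.log (nm S) := by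
  unfold aa
  have := ex_map (p := p) (A := A) (MulAut.conj S).toMonoidHom n (fun g => Real.log (nm g))
  simp only [MulEquiv.toMonoidHom_eq_coe, MonoidHom.coe_coe, MulAut.conj_apply] at this
  rw [this, ← ex_const (A := A) hp n (2 * Real.log (nm S)), ← ex_add']
  refine ex_mono hp fun g => ?_
  have h1 := nm_mul' (S * g) S⁻¹
  have h2 := nm_mul' S g
  rw [nm_inv] at h1
  have h3 : nm (S * g * S⁻¹ : SL2) ≤ nm S * nm g * nm S :=
    h1.trans (mul_le_mul_of_nonneg_right h2 (nm_nonneg _))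
  have h4 := Real.log_le_log (nm_pos _) h3
  rw [Real.log_mul (mul_pos (nm_pos _) (nm_pos _)).ne' (nm_pos _).ne',
    Real.log_mul (nm_pos _).ne' (nm_pos _).ne'] at h4
  linarith

lemma ly_conj_le (hp : Pr p) (S : SL2) (A : ι → SL2) :
    Ly p (fun i => S * A i * S⁻¹) ≤ Ly p A := by
  refine le_of_forall_pos_le_add fun ε hε => ?_
  obtain ⟨C, hC⟩ := ly_up hp A hε
  exact ly_le_of hp (C := C + 2 * Real.log (nm S)) fun n => by
    linarith [hC n, aa_conj hp S A n]

lemma conj_conj (S : SL2) (A : ι → SL2) :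
    (fun i => S⁻¹ * (S * A i * S⁻¹) * S⁻¹⁻¹) = A := by
  ext1 i; group

lemma ly_conj (hp : Pr p) (S : SL2) (A : ι → SL2) :
    Ly p (fun i => S * A i * S⁻¹) = Ly p A := by
  refine le_antisymm (ly_conj_le hp S A) ?_
  have := ly_conj_le hp S⁻¹ (fun i => S * A i * S⁻¹)
  rwa [conj_conj] at this

/-- closeness of tuples -/
def Cl (A B : ι → SL2) (d : ℝ) : Prop := ∀ i, nm ((A i : Mat2) - (B i : Mat2)) ≤ d

lemma Cl.symm {d : ℝ} (h : Cl A B d) : Cl B A d := fun i => by rw [nm_sub_comm]; exact h i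

lemma Cl.conj {d : ℝ} (h : Cl A B d) (S : SL2) :
    Cl (fun i => S * A i * S⁻¹) (fun i => S * B i * S⁻¹) (nm S ^ 2 * d) := by
  intro i
  simp only [Matrix.SpecialLinearGroup.coe_mul]
  rw [← sub_mul, ← mul_sub]
  refine (nm_mul _ _).trans ?_
  rw [nm_inv]
  have h1 := nm_mul (S : Mat2) ((A i : Mat2) - (B i : Mat2))
  have h2 := h i
  have h3 := nm_pos S
  have h4 : nm (S : Mat2) * nm ((A i : Mat2) - (B i : Mat2)) ≤ nm S * d := by gcongr
  calc _ ≤ nm S * d * nm S := by gcongr; exact h1.trans h4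
    _ = _ := by ring

/-- uniform bound of entries -/
lemma exists_nm_bound (A : ι → SL2) : ∃ M : ℝ, 2 ≤ M ∧ ∀ i, nm (A i) ≤ M := by
  refine ⟨2 + ∑ i, nm (A i), ?_, fun i => ?_⟩
  · have := sum_nonneg (s := univ) fun i _ => nm_nonneg (A i : Mat2)
    linarith
  · have := single_le_sum (s := univ) (f := fun i => nm (A i : Mat2))
      (fun i _ => nm_nonneg _) (mem_univ i)
    beta_reduce at this
    linarith

lemma Cl.bound {d M : ℝ} (h : Cl A B d) (hM : ∀ i, nm (A i) ≤ M) (hd : d ≤ 1) (i : ι) :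
    nm (B i) ≤ M + 1 := by
  have := nm_add (A i : Mat2) ((B i : Mat2) - (A i : Mat2))
  rw [add_sub_cancel] at this
  linarith [hM i, h.symm i]

lemma W_bound {M : ℝ} (hM : 2 ≤ M) (hA : ∀ i, nm (A i) ≤ M) {n : ℕ} {g : SL2} (hg : W A n g) :
    nm g ≤ 2 * M ^ n := by
  induction hg with
  | one => simp [nm_one]
  | @mul n g i _ ih =>
    refine (nm_mul' _ _).trans ?_
    rw [pow_succ, ← mul_assoc]
    exact mul_le_mul ih (hA i) (nm_nonneg _) (by positivity)

lemma W_pair {M d : ℝ} (hM : 2 ≤ M) (hd : 0 ≤ d) (hA : ∀ i, nm (A i) ≤ M) (hB : ∀ i, nm (B i) ≤ M)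
    (h : Cl A B d) {n : ℕ} {g : SL2 × SL2} (hg : W (fun i => (A i, B i)) n g) :
    nm g.1 ≤ 2 * M ^ n ∧ nm g.2 ≤ 2 * M ^ n ∧
      nm ((g.2 : Mat2) - (g.1 : Mat2)) ≤ 2 * n * M ^ n * d := by
  induction hg with
  | one => simp [nm]; norm_num
  | @mul n g i _ ih =>
    obtain ⟨h1, h2, h3⟩ := ih
    refine ⟨?_, ?_, ?_⟩
    · refine (nm_mul' _ _).trans ?_
      rw [pow_succ, ← mul_assoc]
      exact mul_le_mul h1 (hA i) (nm_nonneg _) (by positivity)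
    · refine (nm_mul' _ _).trans ?_
      rw [pow_succ, ← mul_assoc]
      exact mul_le_mul h2 (hB i) (nm_nonneg _) (by positivity)
    · have e : ((g * (A i, B i)).2 : Mat2) - ((g * (A i, B i)).1 : Mat2) =
          ((g.2 : Mat2) - g.1) * (B i : Mat2) + (g.1 : Mat2) * ((B i : Mat2) - (A i : Mat2)) := by
        simp only [Prod.snd_mul, Prod.fst_mul, Matrix.SpecialLinearGroup.coe_mul]
        rw [sub_mul, mul_sub]; abel
      rw [e]
      refine (nm_add _ _).trans ?_
      have k1 : nm (((g.2 : Mat2) - g.1) * (B i : Mat2)) ≤ (2 * n * M ^ n * d) * M :=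
        (nm_mul _ _).trans (mul_le_mul h3 (hB i) (nm_nonneg _) (by positivity))
      have k2 : nm ((g.1 : Mat2) * ((B i : Mat2) - (A i : Mat2))) ≤ (2 * M ^ n) * d :=
        (nm_mul _ _).trans (mul_le_mul h1 (h.symm i) (nm_nonneg _) (by positivity))
      push_cast
      rw [pow_succ]
      have : 0 ≤ M ^ n * d := by positivity
      nlinarith

/-- coupling -/
lemma ex_fst (n : ℕ) (φ : SL2 → ℝ) :
    ex p (fun i => (A i, B i)) n (fun g => φ g.1) = ex p A n φ :=
  (ex_map (p := p) (A := fun i => (A i, B i)) (MonoidHom.fst SL2 SL2) n φ).symm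
lemma ex_snd (n : ℕ) (φ : SL2 → ℝ) :
    ex p (fun i => (A i, B i)) n (fun g => φ g.2) = ex p B n φ :=
  (ex_map (p := p) (A := fun i => (A i, B i)) (MonoidHom.snd SL2 SL2) n φ).symm

end ly
end TV

namespace TV
open Finset

section hol
variable {ι : Type*} [Fintype ι] {p : ι → ℝ} {A B : ι → SL2}

/-- Hölder at `A`. -/
def Hol (p : ι → ℝ) (A : ι → SL2) : Prop := ∃ ε C θ : ℝ, 0 < ε ∧ 0 < C ∧ 0 < θ ∧
  ∀ (B : ι → SL2) (d : ℝ), 0 < d → d < ε → Cl A B d → |Ly p A - Ly p B| ≤ C * d ^ θ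

/-- log-Hölder at `A` (when the exponent is zero). -/
def LHol (p : ι → ℝ) (A : ι → SL2) : Prop := ∃ ε C : ℝ, 0 < ε ∧ 0 < C ∧
  ∀ (B : ι → SL2) (d : ℝ), 0 < d → d < ε → Cl A B d → Ly p B ≤ C / √(Real.log (1 / d))

lemma arch_sqrt {x C : ℝ} (h : ∀ n : ℕ, 1 ≤ n → n * x ≤ C * √n) : x ≤ 0 := by
  by_contra hx
  push Not at hx
  obtain ⟨k, hk⟩ := exists_nat_gt (|C| / x)
  rw [div_lt_iff₀ hx] at hk
  have hkpos : 0 < k := by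
    rcases Nat.eq_zero_or_pos k with rfl | h
    · simp at hk; linarith [abs_nonneg C]
    · exact h
  have := h (k ^ 2) (Nat.one_le_pow _ _ hkpos)
  push_cast at this
  rw [Real.sqrt_sq (Nat.cast_nonneg k)] at this
  have hk' : (0:ℝ) < k := by exact_mod_cast hkpos
  have h2 := le_abs_self C
  nlinarith

lemma two_mul_le_two_pow (n : ℕ) : 2 * n ≤ 2 ^ n := by
  induction n with
  | zero => simp
  | succ k ih =>
    rcases k with _ | k
    · simp
    · rw [pow_succ]; omega

lemma lemU (hp : Pr p) {C : ℝ} (h : ∀ n : ℕ, 1 ≤ n → aa p A n ≤ C * √n) :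
    Ly p A = 0 ∧ LHol p A := by
  refine ⟨le_antisymm (arch_sqrt fun n hn => (ly_mul_le hp n).trans (h n hn)) (ly_nonneg hp A), ?_⟩
  obtain ⟨M0, hM0, hA0⟩ := exists_nm_bound A
  set M := M0 + 1 with hM
  have hMpos : 0 < 2 * M := by linarith
  set c := Real.log (2 * M) with hc
  have hcpos : 0 < c := Real.log_pos (by linarith)
  have hC : 0 ≤ C := by
    have := (aa_nonneg (A := A) hp 1).trans (h 1 le_rfl)
    simpa using this
  refine ⟨1 / (2 * M), (C + 1) * √(2 * c), by positivity, by positivity, ?_⟩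
  intro B d hd hdε hcl
  set T := Real.log (1 / d) with hT
  have hTc : c ≤ T := by
    rw [hc, hT]
    refine Real.log_le_log hMpos ?_
    rw [le_div_iff₀ hd]
    rw [lt_div_iff₀ hMpos] at hdε
    linarith
  have hd1 : d ≤ 1 := by
    refine hdε.le.trans ?_
    rw [div_le_one hMpos]; linarith
  set n := ⌊T / c⌋₊ with hn
  have h1 : (1:ℝ) ≤ T / c := by rw [le_div_iff₀ hcpos]; linarith
  have hn1 : 1 ≤ n := Nat.le_floor (by simpa using h1)
  have hnT : (n:ℝ) * c ≤ T := by
    have := Nat.floor_le (a := T / c) (by linarith)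
    rwa [le_div_iff₀ hcpos] at this
  have hnT2 : T / (2 * c) ≤ n := by
    have h2 := Nat.lt_floor_add_one (T / c)
    rw [← hn] at h2
    have h3 : (1:ℝ) ≤ n := by exact_mod_cast hn1
    rw [div_lt_iff₀ hcpos] at h2
    rw [div_le_iff₀ (by positivity)]
    nlinarith
  have hA : ∀ i, nm (A i) ≤ M := fun i => (hA0 i).trans (by linarith)
  have hB : ∀ i, nm (B i) ≤ M := fun i => hcl.bound hA0 hd1 i
  have hsmall : 2 * n * M ^ n * d ≤ 1 := by
    have e1 : (2 * n : ℝ) ≤ 2 ^ n := by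
      exact_mod_cast two_mul_le_two_pow n
    have e2 : (2 * M) ^ n ≤ 1 / d := by
      rw [← Real.log_le_log_iff (by positivity) (by positivity), Real.log_pow]
      exact hnT
    rw [le_div_iff₀ hd, mul_pow] at e2
    have : 0 ≤ M ^ n * d := by positivity
    nlinarith
  have hab : aa p B n ≤ aa p A n + Real.log 2 := by
    unfold aa
    rw [← ex_const (A := A) hp n (Real.log 2), ← ex_add',
      ← ex_fst (A := A) (B := B) n (fun g => Real.log (nm g) + Real.log 2),
      ← ex_snd (A := A) (B := B)]
    refine ex_mono_W hp fun g hg => ?_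
    have := (W_pair (by linarith) hd.le hA hB hcl hg).2.2
    have h2 := nm_add (g.1 : Mat2) ((g.2 : Mat2) - (g.1 : Mat2))
    rw [add_sub_cancel] at h2
    have h3 := nm_ge_one g.1
    rw [add_comm, ← Real.log_mul (by norm_num) (nm_pos _).ne']
    exact Real.log_le_log (nm_pos _) (by linarith)
  have hn' : (1:ℝ) ≤ n := by exact_mod_cast hn1
  have hs : 1 ≤ √n := Real.one_le_sqrt.2 hn'
  have h5 := (ly_mul_le (A := B) hp n).trans hab
  have h6 := h n hn1
  have hl2 : Real.log 2 ≤ 1 := by linarith [Real.log_two_lt_d9]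
  have h7 : (n:ℝ) * Ly p B ≤ (C + 1) * √n := by nlinarith
  have h8 : √n * Ly p B ≤ C + 1 := by
    have e : (n:ℝ) = √n * √n := (Real.mul_self_sqrt (Nat.cast_nonneg n)).symm
    have : √(n:ℝ) * (√n * Ly p B) ≤ √n * (C + 1) := by
      rw [← mul_assoc, ← e]; linarith
    exact le_of_mul_le_mul_left this (by linarith)
  have hTpos : 0 < √T := Real.sqrt_pos.2 (by linarith)
  rw [le_div_iff₀ hTpos]
  have h9 : √T ≤ √(2 * c) * √n := by
    rw [← Real.sqrt_mul (by positivity)]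
    apply Real.sqrt_le_sqrt
    rw [div_le_iff₀ (by positivity)] at hnT2
    linarith
  have h10 := ly_nonneg hp B
  calc Ly p B * √T ≤ Ly p B * (√(2 * c) * √n) := by gcongr
    _ = √(2 * c) * (√n * Ly p B) := by ring
    _ ≤ √(2 * c) * (C + 1) := by gcongr
    _ = _ := by ring

/-- lazy probability -/
def lp (p : ι → ℝ) : Option ι → ℝ := fun o => o.elim (1/2) (fun i => p i / 2)
/-- lazy matrices -/
def lA (A : ι → SL2) : Option ι → SL2 := fun o => o.elim 1 A

lemma lp_pr (hp : Pr p) : Pr (lp p) := by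
  constructor
  · rintro (_ | i)
    · simp [lp]
    · simpa [lp] using hp.pos i
  · rw [Fintype.sum_option]
    simp only [lp, Option.elim, ← sum_div, hp.sum]; norm_num

lemma ex_lazy_succ (n : ℕ) (φ : SL2 → ℝ) : ex (lp p) (lA A) (n+1) φ =
    1/2 * ex (lp p) (lA A) n φ + 1/2 * ∑ i, p i * ex (lp p) (lA A) n (fun g => φ (g * A i)) := by
  rw [ex_succ, Fintype.sum_option]
  simp only [lp, lA, Option.elim, mul_one, mul_sum]
  congr 1
  refine sum_congr rfl fun i _ => ?_
  ring

lemma lazy_aux (n k : ℕ) :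
    ex p A k (fun g => ex (lp p) (lA A) (n+1) (fun h => Real.log (nm (h * g : SL2)))) =
    1/2 * ex p A k (fun g => ex (lp p) (lA A) n (fun h => Real.log (nm (h * g : SL2)))) +
    1/2 * ex p A (k+1) (fun g => ex (lp p) (lA A) n (fun h => Real.log (nm (h * g : SL2)))) := by
  rw [ex_succ_last, ← ex_smul, ← ex_smul, ← ex_add']
  refine ex_congr k fun g => ?_
  rw [ex_lazy_succ]
  simp only [mul_assoc]

lemma ly_lazy (hp : Pr p) (A : ι → SL2) : Ly (lp p) (lA A) = Ly p A / 2 := by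
  apply le_antisymm
  · refine le_of_forall_pos_le_add fun ε hε => ?_
    obtain ⟨C, hC⟩ := ly_up hp A (ε := 2 * ε) (by positivity)
    have key : ∀ n k : ℕ,
        ex p A k (fun g => ex (lp p) (lA A) n (fun h => Real.log (nm (h * g : SL2)))) ≤
          (n / 2 + k) * (Ly p A + 2 * ε) + C := by
      intro n
      induction n with
      | zero => intro k; simpa [aa] using hC k
      | succ n ih =>
        intro k
        rw [lazy_aux]
        have h1 := ih k
        have h2 := ih (k+1)
        push_cast at h2 ⊢
        nlinarith
    refine ly_le_of (lp_pr hp) (C := C) fun n => ?_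
    have := key n 0
    simp only [ex_zero, mul_one] at this
    unfold aa
    push_cast at this
    nlinarith
  · have key : ∀ n k : ℕ, (n / 2 + k) * Ly p A ≤
        ex p A k (fun g => ex (lp p) (lA A) n (fun h => Real.log (nm (h * g : SL2)))) := by
      intro n
      induction n with
      | zero => intro k; simpa [aa] using ly_mul_le (A := A) hp k
      | succ n ih =>
        intro k
        rw [lazy_aux]
        have h1 := ih k
        have h2 := ih (k+1)
        push_cast at h2 ⊢
        nlinarith
    refine le_ly_of (lp_pr hp) (C := 0) fun n => ?_
    have := key n 0
    simp only [ex_zero, mul_one] at this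
    unfold aa
    push_cast at this
    linarith

lemma Cl.lazy {d : ℝ} (hd : 0 ≤ d) (h : Cl A B d) : Cl (lA A) (lA B) d := by
  rintro (_ | i)
  · simpa [lA, nm] using hd
  · exact h i

lemma Hol.of_lazy (hp : Pr p) (h : Hol (lp p) (lA A)) : Hol p A := by
  obtain ⟨ε, C, θ, h1, h2, h3, h4⟩ := h
  refine ⟨ε, 2 * C, θ, h1, by positivity, h3, fun B d hd hdε hcl => ?_⟩
  have := h4 (lA B) d hd hdε (hcl.lazy hd.le)
  rw [ly_lazy hp, ly_lazy hp, ← sub_div, abs_div, abs_two] at this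
  linarith

lemma LHol.of_lazy (hp : Pr p) (h : LHol (lp p) (lA A)) : LHol p A := by
  obtain ⟨ε, C, h1, h2, h4⟩ := h
  refine ⟨ε, 2 * C, h1, by positivity, fun B d hd hdε hcl => ?_⟩
  have := h4 (lA B) d hd hdε (hcl.lazy hd.le)
  rw [ly_lazy hp] at this
  rw [mul_div_assoc]; linarith

end hol

/-! ### Link with the frozen definitions -/

lemma opNorm_le_nm : ∃ C : ℝ, 0 < C ∧ ∀ g : Mat2, opNorm g ≤ C * nm g := by
  set E : Fin 2 → Fin 2 → Mat2 := fun i j => Matrix.single i j 1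
  refine ⟨1 + ∑ i, ∑ j, opNorm (E i j), ?_, ?_⟩
  · have : 0 ≤ ∑ i, ∑ j, opNorm (E i j) :=
      sum_nonneg fun i _ => sum_nonneg fun j _ => norm_nonneg _
    linarith
  intro g
  have hg : Matrix.toEuclideanCLM (𝕜 := ℝ) g =
      ∑ i, ∑ j, g i j • Matrix.toEuclideanCLM (𝕜 := ℝ) (E i j) := by
    conv_lhs => rw [Matrix.matrix_eq_sum_single g]
    rw [map_sum]
    refine sum_congr rfl fun i _ => ?_
    rw [map_sum]
    refine sum_congr rfl fun j _ => ?_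
    rw [← map_smul]
    simp [E]
  have hpos : ∀ i j, 0 ≤ opNorm (E i j) := fun i j => norm_nonneg _
  have hent : ∀ i j, |g i j| ≤ nm g := by
    intro i j
    have a := abs_nonneg (g 0 0)
    have b := abs_nonneg (g 0 1)
    have c := abs_nonneg (g 1 0)
    have d := abs_nonneg (g 1 1)
    unfold nm
    fin_cases i <;> fin_cases j <;> simp <;> linarith
  calc opNorm g = ‖∑ i, ∑ j, g i j • Matrix.toEuclideanCLM (𝕜 := ℝ) (E i j)‖ := by
        unfold opNorm; rw [hg]
    _ ≤ ∑ i, ∑ j, nm g * opNorm (E i j) := by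
        refine (norm_sum_le _ _).trans (sum_le_sum fun i _ => (norm_sum_le _ _).trans
          (sum_le_sum fun j _ => ?_))
        rw [norm_smul]
        exact mul_le_mul_of_nonneg_right (hent i j) (norm_nonneg _)
    _ = (∑ i, ∑ j, opNorm (E i j)) * nm g := by
        simp only [← mul_sum]; ring
    _ ≤ _ := by nlinarith [nm_nonneg g]

lemma entry_le_opNorm (g : Mat2) (i j : Fin 2) : |g i j| ≤ opNorm g := by
  have h := (Matrix.toEuclideanCLM (𝕜 := ℝ) g).le_opNorm (EuclideanSpace.single j 1)
  rw [show ‖(EuclideanSpace.single j (1:ℝ) : E2)‖ = 1 by simp, mul_one] at h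
  refine le_trans ?_ h
  have h2 := PiLp.norm_apply_le (Matrix.toEuclideanCLM (𝕜 := ℝ) g (EuclideanSpace.single j 1)) i
  refine le_trans (le_of_eq ?_) h2
  simp

lemma nm_le_opNorm (g : Mat2) : nm g ≤ 4 * opNorm g := by
  unfold nm
  linarith [entry_le_opNorm g 0 0, entry_le_opNorm g 0 1, entry_le_opNorm g 1 0,
    entry_le_opNorm g 1 1]

lemma opNorm_mul (g h : Mat2) : opNorm (g * h) ≤ opNorm g * opNorm h := by
  unfold opNorm; rw [map_mul]; exact norm_mul_le _ _

lemma opNorm_pos (g : SL2) : 0 < opNorm g := by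
  have := nm_le_opNorm g
  linarith [nm_pos g]

lemma ex_words {κ : ℕ} (p : Fin κ → ℝ) (A : Fin κ → SL2) (n : ℕ) (φ : SL2 → ℝ) :
    ∑ w : Fin n → Fin κ, (∏ i, p (w i)) * φ (wordProd A w) = ex p A n φ := by
  induction n generalizing φ with
  | zero => simp [wordProd]
  | succ n ih =>
    rw [ex_succ, ← (Fin.consEquiv (fun _ => Fin κ)).sum_comp, Fintype.sum_prod_type]
    refine sum_congr rfl fun i _ => ?_
    rw [← ih, mul_sum]
    refine sum_congr rfl fun w _ => ?_
    simp [Fin.prod_univ_succ, wordProd, List.ofFn_succ, mul_assoc]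

lemma lyapLC_eq {κ : ℕ} {p : Fin κ → ℝ} (hp : Pr p) (A : Fin κ → SL2) :
    lyapLC p A = Ly p A := by
  set b : ℕ → ℝ := fun n => ex p A n (fun g => Real.log (opNorm g)) with hb
  have hL : lyapLC p A = ⨅ n : {m : ℕ // 0 < m}, (((n : ℕ) : ℝ))⁻¹ * b n := by
    unfold lyapLC
    congr 1
    ext n
    rw [hb]
    congr 1
    exact ex_words p A n (fun g => Real.log (opNorm g))
  obtain ⟨K, hK, hK2⟩ := opNorm_le_nm
  have h1 : ∀ n, b n ≤ aa p A n + Real.log K := by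
    intro n
    rw [hb, aa, ← ex_const (A := A) hp n (Real.log K), ← ex_add']
    refine ex_mono hp fun g => ?_
    rw [add_comm, ← Real.log_mul hK.ne' (nm_pos g).ne']
    exact Real.log_le_log (opNorm_pos g) (hK2 g)
  have h2 : ∀ n, aa p A n ≤ b n + Real.log 4 := by
    intro n
    rw [hb, aa, ← ex_const (A := A) hp n (Real.log 4), ← ex_add']
    refine ex_mono hp fun g => ?_
    rw [add_comm, ← Real.log_mul (by norm_num) (opNorm_pos g).ne']
    exact Real.log_le_log (nm_pos g) (nm_le_opNorm g)
  have hsub : ∀ m n, b (m+n) ≤ b m + b n := by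
    intro m n
    rw [hb]
    simp only
    rw [ex_add]
    calc _ ≤ ex p A m (fun g => Real.log (opNorm g) + b n) := by
          refine ex_mono hp fun g => ?_
          rw [add_comm, ← ex_const (A := A) hp n (Real.log (opNorm g)), ← ex_add']
          refine ex_mono hp fun h => ?_
          rw [← Real.log_mul (opNorm_pos _).ne' (opNorm_pos _).ne']
          exact Real.log_le_log (opNorm_pos _) (opNorm_mul _ _)
      _ = _ := by rw [ex_add', ex_const hp]
  have h3 : ∀ n, n * Ly p A ≤ b n := by
    intro n
    have hm : ∀ m : ℕ, b (m * n) ≤ m * b n + b 0 := by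
      intro m
      induction m with
      | zero => simp
      | succ m ih =>
        rw [Nat.succ_mul]
        have := hsub (m*n) n
        push_cast; linarith
    refine arch_le (C := Real.log 4 + b 0) fun m => ?_
    have e1 := ly_mul_le (A := A) hp (m * n)
    have e2 := h2 (m * n)
    have e3 := hm m
    push_cast at e1
    nlinarith
  have hbdd : BddBelow (Set.range fun n : {m : ℕ // 0 < m} => (((n : ℕ) : ℝ))⁻¹ * b n) := by
    refine ⟨Ly p A, ?_⟩
    rintro _ ⟨n, rfl⟩
    have hn : (0:ℝ) < ((n:ℕ):ℝ) := by exact_mod_cast n.2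
    simp only
    rw [inv_mul_eq_div, le_div_iff₀ hn]
    linarith [h3 n]
  have : Nonempty {m : ℕ // 0 < m} := ⟨⟨1, one_pos⟩⟩
  rw [hL]
  apply le_antisymm
  · refine le_of_forall_pos_le_add fun ε hε => ?_
    obtain ⟨C, hC⟩ := ly_up hp A hε
    set L' := ⨅ n : {m : ℕ // 0 < m}, (((n : ℕ) : ℝ))⁻¹ * b n
    refine arch_le (C := |C + Real.log K|) fun n => ?_
    rcases Nat.eq_zero_or_pos n with rfl | hn
    · simp
    · have hn' : (0:ℝ) < n := by exact_mod_cast hn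
      have := ciInf_le hbdd ⟨n, hn⟩
      simp only at this
      change L' ≤ _ at this
      rw [inv_mul_eq_div, le_div_iff₀ hn'] at this
      linarith [h1 n, hC n, le_abs_self (C + Real.log K)]
  · refine le_ciInf fun n => ?_
    have hn : (0:ℝ) < ((n:ℕ):ℝ) := by exact_mod_cast n.2
    rw [inv_mul_eq_div, le_div_iff₀ hn]
    linarith [h3 n]

lemma final_aux {κ : ℕ} (hκ : 2 ≤ κ) (p : Fin κ → ℝ) (hp : Pr p)
    (core : ∀ A : Fin κ → SL2, Hol p A ∨ (Ly p A = 0 ∧ LHol p A)) :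
    (∀ A : Fin κ → SL2, 0 < lyapLC p A →
      ∃ ε C θ : ℝ, 0 < ε ∧ 0 < C ∧ 0 < θ ∧
        ∀ B : Fin κ → SL2, tdist A B < ε →
          |lyapLC p A - lyapLC p B| ≤ C * (tdist A B) ^ θ) ∧
    (∀ A : Fin κ → SL2,
      ∃ ε C θ : ℝ, 0 < ε ∧ 0 < C ∧ 0 < θ ∧
        ∀ B : Fin κ → SL2, tdist A B < ε → B ≠ A →
          |lyapLC p A - lyapLC p B| ≤ C * (Real.log (1 / tdist A B)) ^ (-θ)) := by
  simp only [lyapLC_eq hp]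
  have : Nonempty (Fin κ) := ⟨⟨0, by omega⟩⟩
  have hle : ∀ (A B : Fin κ → SL2) i, nm ((A i : Mat2) - (B i : Mat2)) ≤ 4 * tdist A B := by
    intro A B i
    refine (nm_le_opNorm _).trans ?_
    have : opNorm ((A i : Mat2) - (B i : Mat2)) ≤ tdist A B :=
      le_ciSup (f := fun i => opNorm ((A i : Mat2) - (B i : Mat2))) (Set.finite_range _).bddAbove i
    linarith
  have h0 : ∀ A B : Fin κ → SL2, 0 ≤ tdist A B := by
    intro A B
    have := hle A B ⟨0, by omega⟩
    have h2 := nm_nonneg ((A ⟨0, by omega⟩ : Mat2) - (B ⟨0, by omega⟩ : Mat2))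
    linarith
  have heq : ∀ A B : Fin κ → SL2, tdist A B = 0 → B = A := by
    intro A B h
    ext1 i
    have h1 := hle A B i
    rw [h, mul_zero] at h1
    have a := abs_nonneg (A i 0 0 - B i 0 0)
    have b := abs_nonneg (A i 0 1 - B i 0 1)
    have c := abs_nonneg (A i 1 0 - B i 1 0)
    have d := abs_nonneg (A i 1 1 - B i 1 1)
    simp only [nm, Matrix.sub_apply] at h1
    have a' : |A i 0 0 - B i 0 0| = 0 := by linarith
    have b' : |A i 0 1 - B i 0 1| = 0 := by linarith
    have c' : |A i 1 0 - B i 1 0| = 0 := by linarith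
    have d' : |A i 1 1 - B i 1 1| = 0 := by linarith
    rw [abs_eq_zero, sub_eq_zero] at a' b' c' d'
    ext j k
    fin_cases j <;> fin_cases k
    · exact a'.symm
    · exact b'.symm
    · exact c'.symm
    · exact d'.symm
  have hHol : ∀ A : Fin κ → SL2, Hol p A → ∃ ε C θ : ℝ, 0 < ε ∧ 0 < C ∧ 0 < θ ∧
        ∀ B : Fin κ → SL2, tdist A B < ε → |Ly p A - Ly p B| ≤ C * (tdist A B) ^ θ := by
    rintro A ⟨ε, C, θ, h1, h2, h3, h4⟩
    refine ⟨ε / 4, C * 4 ^ θ, θ, by positivity, by positivity, h3, fun B hB => ?_⟩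
    rcases (h0 A B).eq_or_lt with h | h
    · rw [← h, heq A B h.symm, sub_self, abs_zero, Real.zero_rpow h3.ne', mul_zero]
    · have := h4 B (4 * tdist A B) (by positivity) (by linarith) (hle A B)
      rw [Real.mul_rpow (by norm_num) h.le] at this
      linarith
  refine ⟨fun A hA => ?_, fun A => ?_⟩
  · rcases core A with h | h
    · exact hHol A h
    · exact absurd h.1 hA.ne'
  · rcases core A with h | ⟨hz, ε, C, h1, h2, h4⟩
    · obtain ⟨ε, C, θ, h1, h2, h3, h4⟩ := hHol A h
      refine ⟨min ε 1, C / θ, 1, by positivity, by positivity, one_pos, fun B hB hne => ?_⟩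
      have hpos : 0 < tdist A B := (h0 A B).lt_of_ne fun h => hne (heq A B h.symm)
      have hlt1 : tdist A B < 1 := hB.trans_le (min_le_right _ _)
      refine (h4 B (hB.trans_le (min_le_left _ _))).trans ?_
      set d := tdist A B
      have hlog : 0 < Real.log (1 / d) := Real.log_pos (by rw [lt_div_iff₀ hpos]; linarith)
      rw [Real.rpow_neg_one, div_mul_eq_mul_div, mul_div_assoc]
      refine mul_le_mul_of_nonneg_left ?_ h2.le
      rw [le_div_iff₀ h3, ← one_div, le_div_iff₀ hlog]
      have e : Real.log (1 / d) = - Real.log d := by rw [one_div, Real.log_inv]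
      have h5 := Real.log_le_sub_one_of_pos (inv_pos.2 (Real.rpow_pos_of_pos hpos θ))
      rw [Real.log_inv, Real.log_rpow hpos] at h5
      have h6 : d ^ θ * (d ^ θ)⁻¹ = 1 := mul_inv_cancel₀ (Real.rpow_pos_of_pos hpos θ).ne'
      have h7 := Real.rpow_pos_of_pos hpos θ
      rw [e]
      nlinarith
    · refine ⟨min (ε / 4) (1 / 16), 2 * C, 1 / 2, by positivity, by positivity, by positivity,
        fun B hB hne => ?_⟩
      have hpos : 0 < tdist A B := (h0 A B).lt_of_ne fun h => hne (heq A B h.symm)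
      have hlt1 : tdist A B < 1 / 16 := hB.trans_le (min_le_right _ _)
      have hlt2 : tdist A B < ε / 4 := hB.trans_le (min_le_left _ _)
      have := h4 B (4 * tdist A B) (by positivity) (by linarith) (hle A B)
      rw [hz, zero_sub, abs_neg, abs_of_nonneg (ly_nonneg hp B)]
      refine this.trans ?_
      set d := tdist A B
      have hlog : 0 < Real.log (1 / d) := Real.log_pos (by rw [lt_div_iff₀ hpos]; linarith)
      rw [Real.rpow_neg hlog.le, ← Real.sqrt_eq_rpow, ← div_eq_mul_inv]
      have hl2 : Real.log (1 / d) / 4 ≤ Real.log (1 / (4 * d)) := by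
        have e : Real.log (1 / (4 * d)) = Real.log (1 / d) - Real.log 4 := by
          rw [← Real.log_div (by positivity) (by norm_num)]; congr 1; field_simp
        have e2 : 2 * Real.log 4 ≤ Real.log (1 / d) := by
          rw [show 2 * Real.log 4 = Real.log 16 by
            rw [show (16:ℝ) = 4 ^ 2 by norm_num, Real.log_pow]; norm_num]
          exact Real.log_le_log (by norm_num) (by rw [le_div_iff₀ hpos]; linarith)
        linarith
      have hs : √(Real.log (1 / d)) / 2 ≤ √(Real.log (1 / (4 * d))) := by
        rw [show √(Real.log (1 / d)) / 2 = √(Real.log (1 / d) / 4) by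
          rw [Real.sqrt_div' _ (by norm_num), show (4:ℝ) = 2 ^ 2 by norm_num,
            Real.sqrt_sq (by norm_num)]]
        exact Real.sqrt_le_sqrt hl2
      have hs0 : 0 < √(Real.log (1 / d)) := Real.sqrt_pos.2 hlog
      calc C / √(Real.log (1 / (4 * d))) ≤ C / (√(Real.log (1 / d)) / 2) := by gcongr
        _ = _ := by field_simp
end TV

namespace TV
open Finset

/-- projective distance -/
def dd (u w : V) : ℝ := |wd u w| / (en u * en w)

lemma dd_nonneg (u w : V) : 0 ≤ dd u w :=
  div_nonneg (abs_nonneg _) (mul_nonneg (en_nonneg _) (en_nonneg _))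
lemma dd_le_one (u w : V) : dd u w ≤ 1 :=
  div_le_one_of_le₀ (wd_le u w) (mul_nonneg (en_nonneg _) (en_nonneg _))
lemma wd_swap (u w : V) : wd u w = - wd w u := by unfold wd; ring
lemma dd_comm (u w : V) : dd u w = dd w u := by
  unfold dd; rw [wd_swap, abs_neg, mul_comm]

lemma dd_ac (g : SL2) {u w : V} (hu : u ≠ 0) (hw : w ≠ 0) :
    dd (ac g u) (ac g w) = dd u w * (en u / en (ac g u)) * (en w / en (ac g w)) := by
  unfold dd
  rw [wd_ac]
  have := (en_pos hu).ne'
  have := (en_pos hw).ne'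
  have := (en_pos (ac_ne g hu)).ne'
  have := (en_pos (ac_ne g hw)).ne'
  field_simp

lemma exists_coord (u w : V) : ∃ k : Fin 2, en u ≤ 2 * |u k| ∧ en (u k • w - w k • u) = |wd u w| := by
  rcases le_total |u 0| |u 1| with h | h
  · refine ⟨1, by unfold en; linarith, ?_⟩
    simp only [en, wd, Pi.sub_apply, Pi.smul_apply, smul_eq_mul]
    rw [show u 1 * w 1 - w 1 * u 1 = 0 by ring, abs_zero, add_zero, ← abs_neg]
    congr 1; ring
  · refine ⟨0, by unfold en; linarith, ?_⟩
    simp only [en, wd, Pi.sub_apply, Pi.smul_apply, smul_eq_mul]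
    rw [show u 0 * w 0 - w 0 * u 0 = 0 by ring, abs_zero, zero_add]
    congr 1; ring

lemma log_le_div {x y : ℝ} (hx : 0 < x) (hy : 0 < y) : Real.log x - Real.log y ≤ (x - y) / y := by
  have := Real.log_le_sub_one_of_pos (div_pos hx hy)
  rw [Real.log_div hx.ne' hy.ne'] at this
  rw [sub_div, div_self hy.ne']; exact this

lemma abs_en_sub (u v : V) : |en u - en v| ≤ en (u - v) := by
  have h1 := en_add (u - v) v
  have h2 := en_add (v - u) u
  rw [sub_add_cancel] at h1 h2
  rw [← neg_sub, en_neg] at h2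
  rw [abs_le]; constructor <;> linarith

lemma ell_sub_le {g : SL2} {M : ℝ} (hM : nm g ≤ M) {u w : V} (hu : u ≠ 0) (hw : w ≠ 0) :
    Real.log (en (ac g w) / en w) - Real.log (en (ac g u) / en u) ≤ 4 * M ^ 2 * dd u w := by
  have hM1 : 1 ≤ M := (nm_ge_one g).trans hM
  have pu := en_pos hu
  have pw := en_pos hw
  have pgu := en_pos (ac_ne g hu)
  have pgw := en_pos (ac_ne g hw)
  refine (log_le_div (div_pos pgw pw) (div_pos pgu pu)).trans ?_
  obtain ⟨k, hk, hr⟩ := exists_coord u w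
  have hk0 : 0 < |u k| := by linarith
  set D := |wd u w| with hD
  have hD0 : 0 ≤ D := abs_nonneg _
  have a1 : |w k| * en u ≤ |u k| * en w + D := by
    have := abs_en_sub (u k • w) (w k • u)
    rw [hr, en_smul, en_smul, abs_le] at this
    linarith
  have a2 : |u k| * en (ac g w) ≤ |w k| * en (ac g u) + M * D := by
    have := abs_en_sub (u k • ac g w) (w k • ac g u)
    rw [← ac_smul, ← ac_smul, ← ac_sub] at this
    have h2 := en_ac_le g (u k • w - w k • u)
    rw [hr] at h2
    rw [ac_smul, ac_smul, en_smul, en_smul, abs_le] at this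
    nlinarith
  have a3 : en (ac g u) ≤ M * en u := (en_ac_le g u).trans (by gcongr)
  have a4 : en u ≤ M * en (ac g u) := (en_le_ac g u).trans (by gcongr)
  have a5 : |u k| * (en (ac g w) * en u - en w * en (ac g u)) ≤ 2 * M * D * en u := by
    have b1 : |u k| * en (ac g w) * en u ≤ (|w k| * en (ac g u) + M * D) * en u := by gcongr
    have b2 : |w k| * en u * en (ac g u) ≤ (|u k| * en w + D) * en (ac g u) := by gcongr
    have b3 : D * en (ac g u) ≤ D * (M * en u) := by gcongr
    nlinarith
  have a6 : en (ac g w) * en u - en w * en (ac g u) ≤ 4 * M * D := by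
    by_contra hlt
    push Not at hlt
    have c1 : |u k| * (4 * M * D) < |u k| * (en (ac g w) * en u - en w * en (ac g u)) := by gcongr
    have c2 : en u * (2 * M * D) ≤ 2 * |u k| * (2 * M * D) := by gcongr
    nlinarith
  have e1 : (en (ac g w) / en w - en (ac g u) / en u) / (en (ac g u) / en u) =
      (en (ac g w) * en u - en w * en (ac g u)) / (en w * en (ac g u)) := by
    field_simp
  rw [e1, dd, ← hD, div_le_iff₀ (by positivity)]
  have e2 : 4 * M ^ 2 * (D / (en u * en w)) * (en w * en (ac g u)) =
      4 * M * D * (M * en (ac g u) / en u) := by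
    field_simp
  rw [e2]
  have e3 : 1 ≤ M * en (ac g u) / en u := by rw [le_div_iff₀ pu]; linarith
  have : 0 ≤ 4 * M * D := by positivity
  nlinarith

lemma ell_abs_sub_le {g : SL2} {M : ℝ} (hM : nm g ≤ M) {u w : V} (hu : u ≠ 0) (hw : w ≠ 0) :
    |Real.log (en (ac g w) / en w) - Real.log (en (ac g u) / en u)| ≤ 4 * M ^ 2 * dd u w := by
  rw [abs_le]
  have h1 := ell_sub_le hM hu hw
  have h2 := ell_sub_le hM hw hu
  rw [dd_comm] at h2
  constructor <;> linarith

lemma en_diff (g h : SL2) (v : V) {d : ℝ} (hd : nm ((g : Mat2) - (h : Mat2)) ≤ d) :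
    en (ac g v - ac h v) ≤ d * en v := by
  have : ac g v - ac h v = ((g : Mat2) - (h : Mat2)).mulVec v := by
    unfold ac; rw [Matrix.sub_mulVec]
  rw [this]
  refine (en_mulVec _ _).trans ?_
  have := en_nonneg v
  gcongr

lemma ell_close {g h : SL2} {M d : ℝ} (hM : nm h ≤ M) (hM' : nm g ≤ M)
    (hd : nm ((g : Mat2) - (h : Mat2)) ≤ d) {v : V}
    (hv : v ≠ 0) : |Real.log (en (ac g v) / en v) - Real.log (en (ac h v) / en v)| ≤ M * d := by
  have pv := en_pos hv
  have hd0 : 0 ≤ d := (nm_nonneg _).trans hd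
  have key : ∀ g h : SL2, nm h ≤ M → nm ((g : Mat2) - (h : Mat2)) ≤ d →
      Real.log (en (ac g v) / en v) - Real.log (en (ac h v) / en v) ≤ M * d := by
    intro g h hM hd
    have p1 := en_pos (ac_ne g hv)
    have p2 := en_pos (ac_ne h hv)
    rw [Real.log_div p1.ne' pv.ne', Real.log_div p2.ne' pv.ne', sub_sub_sub_cancel_right]
    refine (log_le_div p1 p2).trans ?_
    rw [div_le_iff₀ p2]
    have h1 := (abs_le.1 (abs_en_sub (ac g v) (ac h v))).2
    have h2 := en_diff g h v hd
    have h3 : en v ≤ M * en (ac h v) := (en_le_ac h v).trans (by gcongr)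
    nlinarith
  rw [abs_le]
  have h1 := key g h hM hd
  have h2 := key h g hM' (by rwa [nm_sub_comm])
  constructor <;> linarith

lemma dd_close {g h : SL2} {M d : ℝ} (hM : nm h ≤ M)
    (hd : nm ((g : Mat2) - (h : Mat2)) ≤ d) {v : V} (hv : v ≠ 0) :
    dd (ac g v) (ac h v) ≤ M * d := by
  have p1 := en_pos (ac_ne g hv)
  have p2 := en_pos (ac_ne h hv)
  have hd0 : 0 ≤ d := (nm_nonneg _).trans hd
  have e : wd (ac g v) (ac h v) = - wd (ac g v) (ac g v - ac h v) := by
    simp only [wd, Pi.sub_apply]; ring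
  unfold dd
  rw [e, abs_neg, div_le_iff₀ (by positivity)]
  have h1 := wd_le (ac g v) (ac g v - ac h v)
  have h2 := en_diff g h v hd
  have h3 : en v ≤ M * en (ac h v) := (en_le_ac h v).trans (by gcongr)
  calc _ ≤ en (ac g v) * (d * (M * en (ac h v))) := by
        refine h1.trans ?_
        gcongr
        exact h2.trans (by gcongr)
    _ = _ := by ring

section contr
variable {ι : Type*} [Fintype ι] {p : ι → ℝ} {A B : ι → SL2}

/-- moment of the contraction -/
def Fm (p : ι → ℝ) (A : ι → SL2) (t : ℝ) (n : ℕ) (v : V) : ℝ :=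
  ex p A n (fun g => (en v / en (ac g v)) ^ t)

lemma Fm_add (t : ℝ) (m n : ℕ) {v : V} (hv : v ≠ 0) : Fm p A t (m + n) v =
    ex p A m (fun g => (en v / en (ac g v)) ^ t * Fm p A t n (ac g v)) := by
  unfold Fm
  rw [ex_add]
  refine ex_congr m fun g => ?_
  rw [← ex_smul]
  refine ex_congr n fun h => ?_
  have p0 := en_pos hv
  have p1 := en_pos (ac_ne g hv)
  have p2 := en_pos (ac_ne h (ac_ne g hv))
  rw [← Real.mul_rpow (by positivity) (by positivity), ac_mul]
  congr 1
  field_simp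

lemma Fm_nonneg (hp : Pr p) (t : ℝ) (n : ℕ) (v : V) : 0 ≤ Fm p A t n v :=
  ex_nonneg hp fun g _ => Real.rpow_nonneg (div_nonneg (en_nonneg _) (en_nonneg _)) _

lemma Fm_bound (hp : Pr p) {M t : ℝ} (hM : 2 ≤ M) (hA : ∀ i, nm (A i) ≤ M) (ht : 0 ≤ t)
    {n N : ℕ} (hn : n ≤ N) {v : V} (hv : v ≠ 0) : Fm p A t n v ≤ (2 * M ^ N) ^ t := by
  rw [← ex_const (A := A) hp n ((2 * M ^ N) ^ t)]
  refine ex_mono_W hp fun g hg => ?_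
  refine Real.rpow_le_rpow (div_nonneg (en_nonneg _) (en_nonneg _)) ?_ ht
  rw [div_le_iff₀ (en_pos (ac_ne g hv))]
  refine (en_le_ac g v).trans ?_
  have h1 := W_bound hM hA hg
  have h2 : M ^ n ≤ M ^ N := pow_le_pow_right₀ (by linarith) hn
  have := en_nonneg (ac g v)
  gcongr
  linarith

lemma Fm_sum (hp : Pr p) {M t ρ : ℝ} (hM : 2 ≤ M) (hA : ∀ i, nm (A i) ≤ M) (ht : 0 ≤ t) {N : ℕ}
    (hN : 1 ≤ N) (hρ : ρ < 1) (h : ∀ v : V, v ≠ 0 → Fm p A t N v ≤ ρ) :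
    ∃ K : ℝ, 0 ≤ K ∧ ∀ n (v : V), v ≠ 0 → ∑ m ∈ range n, Fm p A t m v ≤ K := by
  set C1 : ℝ := N * (2 * M ^ N) ^ t with hC1
  have hC1' : 0 ≤ C1 := by positivity
  have h1ρ : 0 < 1 - ρ := by linarith
  refine ⟨C1 / (1 - ρ), by positivity, fun n => ?_⟩
  induction n with
  | zero => intro v hv; simp; positivity
  | succ n ih =>
    intro v hv
    have h1 : ∑ m ∈ range (n+1), Fm p A t m v ≤ ∑ m ∈ range (N+n), Fm p A t m v :=
      sum_le_sum_of_subset_of_nonneg (range_subset_range.2 (by omega))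
        fun i _ _ => Fm_nonneg hp t i v
    refine h1.trans ?_
    rw [sum_range_add]
    have h2 : ∑ m ∈ range N, Fm p A t m v ≤ C1 := by
      refine (sum_le_sum fun m hm => Fm_bound hp hM hA ht (mem_range.1 hm).le hv).trans ?_
      rw [sum_const, card_range, nsmul_eq_mul]
    have h3 : ∑ m ∈ range n, Fm p A t (N + m) v ≤ ρ * (C1 / (1 - ρ)) := by
      simp only [Fm_add t N _ hv]
      rw [← ex_sum]
      simp only [← mul_sum]
      calc _ ≤ ex p A N (fun g => (C1 / (1 - ρ)) * (en v / en (ac g v)) ^ t) := by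
            refine ex_mono hp fun g => ?_
            rw [mul_comm]
            refine mul_le_mul_of_nonneg_right (ih _ (ac_ne g hv)) ?_
            exact Real.rpow_nonneg (div_nonneg (en_nonneg _) (en_nonneg _)) _
        _ = (C1 / (1 - ρ)) * Fm p A t N v := ex_smul _ _ _
        _ ≤ _ := by rw [mul_comm]; exact mul_le_mul_of_nonneg_right (h v hv) (by positivity)
    have e : C1 + ρ * (C1 / (1 - ρ)) = C1 / (1 - ρ) := by field_simp; ring
    linarith

lemma La_succ_last (hp : Pr p) {v : V} (hv : v ≠ 0) (n : ℕ) : La p A (n+1) v =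
    La p A n v + ex p A n (fun g => ∑ i, p i *
      Real.log (en (ac (A i) (ac g v)) / en (ac g v))) := by
  unfold La
  rw [ex_succ_last, ← ex_add']
  refine ex_congr n fun g => ?_
  conv_rhs => rw [← one_mul (Real.log (en (ac g v) / en v)), ← hp.sum, sum_mul, ← sum_add_distrib]
  refine sum_congr rfl fun i _ => ?_
  have p0 := en_pos hv
  have p1 := en_pos (ac_ne g hv)
  have p2 := en_pos (ac_ne (A i) (ac_ne g hv))
  rw [← mul_add, ← Real.log_mul (by positivity) (by positivity), ac_mul]
  congr 2
  field_simp

lemma dd_moment (hp : Pr p) {s : ℝ} (n : ℕ) {u w : V} (hu : u ≠ 0) (hw : w ≠ 0) :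
    ex p A n (fun g => dd (ac g u) (ac g w) ^ s) ≤
      dd u w ^ s * (1/2 * (Fm p A (2*s) n u + Fm p A (2*s) n w)) := by
  unfold Fm
  rw [← ex_add', ← ex_smul, ← ex_smul]
  refine ex_mono hp fun g => ?_
  have p0 := en_pos hu
  have p1 := en_pos (ac_ne g hu)
  have p2 := en_pos hw
  have p3 := en_pos (ac_ne g hw)
  rw [dd_ac g hu hw, mul_assoc, Real.mul_rpow (dd_nonneg _ _) (by positivity)]
  refine mul_le_mul_of_nonneg_left ?_ (Real.rpow_nonneg (dd_nonneg _ _) _)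
  rw [Real.mul_rpow (by positivity) (by positivity), mul_comm 2 s,
    Real.rpow_mul (by positivity), Real.rpow_mul (by positivity)]
  set X := (en u / en (ac g u)) ^ s
  set Y := (en w / en (ac g w)) ^ s
  rw [Real.rpow_two, Real.rpow_two]
  nlinarith [sq_nonneg (X - Y)]

lemma La_holder (hp : Pr p) {M s K : ℝ} (hA : ∀ i, nm (A i) ≤ M) (hs : s ≤ 1)
    (hK : ∀ n (v : V), v ≠ 0 → ∑ m ∈ range n, Fm p A (2*s) m v ≤ K) (n : ℕ) {u w : V}
    (hu : u ≠ 0) (hw : w ≠ 0) : |La p A n u - La p A n w| ≤ 4 * M ^ 2 * K * dd u w ^ s := by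
  have h1 : |La p A n u - La p A n w| ≤
      ∑ m ∈ range n, 4 * M ^ 2 * ex p A m (fun g => dd (ac g u) (ac g w) ^ s) := by
    induction n with
    | zero => simp [La_zero hu, La_zero hw]
    | succ n ih =>
      rw [La_succ_last hp hu, La_succ_last hp hw, sum_range_succ, add_sub_add_comm, ← ex_sub]
      refine (abs_add_le _ _).trans (add_le_add ih ?_)
      refine (abs_ex_le hp _).trans ?_
      rw [← ex_smul]
      refine ex_mono hp fun g => ?_
      rw [← sum_sub_distrib]
      refine (abs_sum_le_sum_abs _ _).trans ?_
      calc _ ≤ ∑ i, p i * (4 * M ^ 2 * dd (ac g u) (ac g w) ^ s) := by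
            refine sum_le_sum fun i _ => ?_
            rw [← mul_sub, abs_mul, abs_of_pos (hp.pos i)]
            refine mul_le_mul_of_nonneg_left ?_ (hp.pos i).le
            refine (ell_abs_sub_le (hA i) (ac_ne g hw) (ac_ne g hu)).trans ?_
            rw [dd_comm]
            have : dd (ac g u) (ac g w) ≤ dd (ac g u) (ac g w) ^ s := by
              rcases (dd_nonneg (ac g u) (ac g w)).eq_or_lt with h | h
              · rw [← h]; exact Real.rpow_nonneg le_rfl _
              · have := Real.rpow_le_rpow_of_exponent_ge h (dd_le_one _ _) hs
                rwa [Real.rpow_one] at this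
            gcongr
        _ = _ := by rw [← sum_mul, hp.sum, one_mul]
  refine h1.trans ?_
  rw [← mul_sum]
  have h2 : ∑ m ∈ range n, ex p A m (fun g => dd (ac g u) (ac g w) ^ s) ≤ dd u w ^ s * K := by
    refine (sum_le_sum fun m _ => dd_moment hp m hu hw).trans ?_
    rw [← mul_sum, ← mul_sum, sum_add_distrib]
    refine mul_le_mul_of_nonneg_left ?_ (Real.rpow_nonneg (dd_nonneg _ _) _)
    linarith [hK n u hu, hK n w hw]
  calc _ ≤ 4 * M ^ 2 * (dd u w ^ s * K) := by gcongr
    _ = _ := by ring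

/-- Comparison of two cocycles through vectors. -/
lemma ly_compare (hp : Pr p) {E C : ℝ}
    (h : ∀ n (v : V), v ≠ 0 → |La p A n v - La p B n v| ≤ n * E + C) :
    |Ly p A - Ly p B| ≤ E := by
  have key : ∀ A B : ι → SL2, (∀ n (v : V), v ≠ 0 → |La p A n v - La p B n v| ≤ n * E + C) →
      Ly p A ≤ Ly p B + E := by
    intro A B h
    refine le_of_forall_pos_le_add fun ε hε => ?_
    obtain ⟨C', hC'⟩ := ly_up hp B hε
    refine vl_up hp (C := C + C') fun v hv n => ?_
    have h1 := (abs_le.1 (h n v hv)).2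
    have h2 := La_le (A := B) hp hv n
    linarith [hC' n]
  have h1 := key A B h
  have h2 := key B A fun n v hv => by rw [abs_sub_comm]; exact h n v hv
  rw [abs_le]; constructor <;> linarith

theorem hol_of_expanding (hp : Pr p) {N : ℕ} (h : ∀ v : V, v ≠ 0 → 1 ≤ La p A N v) : Hol p A := by
  have hN : 1 ≤ N := by
    rcases Nat.eq_zero_or_pos N with rfl | h'
    · have := h e0 (fun h => by have := congrFun h 0; simp [e0] at this)
      rw [La_zero (fun h => by have := congrFun h 0; simp [e0] at this)] at this
      linarith
    · exact h'
  obtain ⟨M0, hM0, hA0⟩ := exists_nm_bound A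
  set X := Real.log (2 * M0 ^ N) with hX
  have hbig : 1 ≤ M0 ^ N := one_le_pow₀ (by linarith)
  have hXpos : 0 < X := Real.log_pos (by linarith)
  -- choose s
  set s : ℝ := min 1 (min (1 / (2 * X)) (1 / (4 * X ^ 2))) with hs
  have hspos : 0 < s := by positivity
  have hs1 : s ≤ 1 := min_le_left _ _
  have hs2 : 2 * s * X ≤ 1 := by
    have : s ≤ 1 / (2 * X) := (min_le_right _ _).trans (min_le_left _ _)
    rw [le_div_iff₀ (by positivity)] at this; linarith
  have hs3 : 4 * s * X ^ 2 ≤ 1 := by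
    have : s ≤ 1 / (4 * X ^ 2) := (min_le_right _ _).trans (min_le_right _ _)
    rw [le_div_iff₀ (by positivity)] at this; linarith
  have hF : ∀ v : V, v ≠ 0 → Fm p A (2 * s) N v ≤ 1 - s := by
    intro v hv
    have p0 := en_pos hv
    have : Fm p A (2 * s) N v ≤
        ex p A N (fun g => (-(2 * s)) * Real.log (en (ac g v) / en v) + (1 + (2 * s * X) ^ 2)) := by
      refine ex_mono_W hp fun g hg => ?_
      have p1 := en_pos (ac_ne g hv)
      have hl : |Real.log (en (ac g v) / en v)| ≤ X := by
        have hg1 := W_bound hM0 hA0 hg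
        rw [abs_le]
        constructor
        · rw [hX, neg_le, ← Real.log_inv]
          refine Real.log_le_log (by positivity) ?_
          rw [inv_div, div_le_iff₀ p1]
          exact (en_le_ac g v).trans (by gcongr)
        · refine Real.log_le_log (by positivity) ?_
          rw [div_le_iff₀ p0]
          exact (en_ac_le g v).trans (by gcongr)
      set l := Real.log (en (ac g v) / en v) with hldef
      have e : (en v / en (ac g v)) ^ (2 * s) = Real.exp (-(2 * s) * l) := by
        rw [Real.rpow_def_of_pos (by positivity), hldef, ← inv_div, Real.log_inv]
        congr 1; ring
      rw [e]
      have hb : |-(2 * s) * l| ≤ 2 * s * X := by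
        rw [abs_mul, abs_neg, abs_of_pos (by positivity)]; gcongr
      have h2 := (abs_le.1 (Real.abs_exp_sub_one_sub_id_le (hb.trans hs2))).2
      have h3 : (-(2 * s) * l) ^ 2 ≤ (2 * s * X) ^ 2 := sq_le_sq' (abs_le.1 hb).1 (abs_le.1 hb).2
      linarith
    rw [ex_add', ex_smul, ex_const hp] at this
    have h4 : 1 ≤ La p A N v := h v hv
    unfold La at h4
    nlinarith
  obtain ⟨K, hK0, hK⟩ := Fm_sum hp hM0 hA0 (by positivity : 0 ≤ 2 * s) hN
    (by linarith : 1 - s < 1) hF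
  set M := M0 + 1 with hM
  have hA : ∀ i, nm (A i) ≤ M := fun i => (hA0 i).trans (by linarith)
  set H := 4 * M ^ 2 * K with hH
  refine ⟨1, M + H * M ^ s, s, one_pos, by positivity, hspos, fun B d hd hd1 hcl => ?_⟩
  have hB : ∀ i, nm (B i) ≤ M := fun i => hcl.bound hA0 hd1.le i
  set E := M * d + H * (M * d) ^ s with hE
  have hcomp : ∀ n (v : V), v ≠ 0 → |La p A n v - La p B n v| ≤ n * E + 0 := by
    intro n
    induction n with
    | zero => intro v hv; simp [La_zero hv]
    | succ n ih =>
      intro v hv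
      rw [La_succ hp hv, La_succ hp hv, ← sum_sub_distrib]
      refine (abs_sum_le_sum_abs _ _).trans ?_
      calc _ ≤ ∑ i, p i * ((n + 1) * E) := by
            refine sum_le_sum fun i _ => ?_
            rw [← mul_sub, abs_mul, abs_of_pos (hp.pos i)]
            refine mul_le_mul_of_nonneg_left ?_ (hp.pos i).le
            have t1 := ell_close (hB i) (hA i) (hcl i) hv
            have t2 := La_holder hp hA hs1 hK n (ac_ne (A i) hv) (ac_ne (B i) hv)
            have t3 := ih (ac (B i) v) (ac_ne (B i) hv)
            have t4 : dd (ac (A i) v) (ac (B i) v) ^ s ≤ (M * d) ^ s :=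
              Real.rpow_le_rpow (dd_nonneg _ _) (dd_close (hB i) (hcl i) hv) hspos.le
            have t5 : 4 * M ^ 2 * K * dd (ac (A i) v) (ac (B i) v) ^ s ≤ H * (M * d) ^ s := by
              rw [hH]; gcongr
            have e : ∀ a b c f x : ℝ, a + b - (c + f) = (a - c) + (b - x) + (x - f) := by
              intros; ring
            rw [e _ _ _ _ (La p A n (ac (B i) v))]
            refine (abs_add_three _ _ _).trans ?_
            rw [hE] at t3 ⊢
            linarith
        _ = _ := by rw [← sum_mul, hp.sum]; push_cast; ring
  refine (ly_compare hp hcomp).trans ?_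
  rw [hE, Real.mul_rpow (by linarith) hd.le]
  have : d ≤ d ^ s := by
    have := Real.rpow_le_rpow_of_exponent_ge hd hd1.le hs1
    rwa [Real.rpow_one] at this
  have : M * d ≤ M * d ^ s := by gcongr
  linarith

end contr
end TV

namespace TV
open Finset

/-- Measurable cones. -/
def Cone (E : Set V) : Prop := MeasurableSet E ∧ ∀ v ∈ E, ∀ c : ℝ, c ≠ 0 → c • v ∈ E

lemma Cone.union {E F : Set V} (hE : Cone E) (hF : Cone F) : Cone (E ∪ F) :=
  ⟨hE.1.union hF.1, fun v hv c hc => hv.imp (fun h => hE.2 v h c hc) (fun h => hF.2 v h c hc)⟩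

lemma Cone.compl {E : Set V} (hE : Cone E) : Cone Eᶜ :=
  ⟨hE.1.compl, fun v hv c hc h => hv (by
    have := hE.2 _ h c⁻¹ (inv_ne_zero hc)
    rwa [smul_smul, inv_mul_cancel₀ hc, one_smul] at this)⟩

lemma Cone.inter {E F : Set V} (hE : Cone E) (hF : Cone F) : Cone (E ∩ F) :=
  ⟨hE.1.inter hF.1, fun v hv c hc => ⟨hE.2 v hv.1 c hc, hF.2 v hv.2 c hc⟩⟩

lemma Cone.univ : Cone Set.univ := ⟨MeasurableSet.univ, fun _ _ _ _ => trivial⟩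
lemma Cone.zero : Cone {0} := ⟨measurableSet_singleton _, fun v hv c _ => by
  rw [Set.mem_singleton_iff] at hv ⊢; rw [hv, smul_zero]⟩

lemma continuous_ac (g : SL2) : Continuous (ac g) := by
  unfold ac
  exact Continuous.matrix_mulVec continuous_const continuous_id

lemma Cone.preimage {E : Set V} (hE : Cone E) (g : SL2) : Cone (ac g ⁻¹' E) :=
  ⟨(continuous_ac g).measurable hE.1, fun v hv c hc => by
    rw [Set.mem_preimage, ac_smul]; exact hE.2 _ hv c hc⟩

section mean
variable {ι : Type*} [Fintype ι] {A : ι → SL2} {m : Set V → ℝ}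

/-- Invariant finitely additive probability on cones. -/
structure Mean (A : ι → SL2) (m : Set V → ℝ) : Prop where
  nn : ∀ E, Cone E → 0 ≤ m E
  add : ∀ E F, Cone E → Cone F → Disjoint E F → m (E ∪ F) = m E + m F
  univ : m Set.univ = 1
  zero : m {0} = 0
  inv : ∀ i E, Cone E → m (ac (A i) ⁻¹' E) = m E

lemma Mean.mono (h : Mean A m) {E F : Set V} (hE : Cone E) (hF : Cone F) (hEF : E ⊆ F) :
    m E ≤ m F := by
  have h1 := h.add E (F ∩ Eᶜ) hE (hF.inter hE.compl) (by
    rw [Set.disjoint_left]; intro x hx hx2; exact hx2.2 hx)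
  have e : E ∪ F ∩ Eᶜ = F := by
    ext x
    constructor
    · rintro (h | h)
      · exact hEF h
      · exact h.1
    · intro hx
      by_cases hxE : x ∈ E
      · exact Or.inl hxE
      · exact Or.inr ⟨hx, hxE⟩
  rw [e] at h1
  linarith [h.nn _ (hF.inter hE.compl)]

lemma Mean.union_le (h : Mean A m) {E F : Set V} (hE : Cone E) (hF : Cone F) :
    m (E ∪ F) ≤ m E + m F := by
  have h1 := h.add E (F ∩ Eᶜ) hE (hF.inter hE.compl) (by
    rw [Set.disjoint_left]; intro x hx hx2; exact hx2.2 hx)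
  have e : E ∪ F ∩ Eᶜ = E ∪ F := by
    ext x
    by_cases hxE : x ∈ E <;> simp [hxE]
  rw [e] at h1
  have := h.mono (hF.inter hE.compl) hF Set.inter_subset_left
  linarith

lemma Mean.invW (h : Mean A m) {n : ℕ} {g : SL2} (hg : W A n g) {E : Set V} (hE : Cone E) :
    m (ac g ⁻¹' E) = m E := by
  induction hg with
  | one => congr 1; ext v; simp
  | @mul n g i _ ih =>
    rw [← ih, ← h.inv i _ (hE.preimage g)]
    congr 1
    ext v; simp [ac_mul]

/-- projective balls -/
def Bl (ε : ℝ) (z : V) : Set V := {v | |wd v z| ≤ ε * en v * en z}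

lemma continuous_en : Continuous en := by unfold en; fun_prop
lemma continuous_wd (z : V) : Continuous (fun v => wd v z) := by unfold wd; fun_prop

lemma wd_smul_left (c : ℝ) (v z : V) : wd (c • v) z = c * wd v z := by
  simp only [wd, Pi.smul_apply, smul_eq_mul]; ring

lemma wd_smul_right (c : ℝ) (v z : V) : wd v (c • z) = c * wd v z := by
  simp only [wd, Pi.smul_apply, smul_eq_mul]; ring

lemma cone_Bl (ε : ℝ) (z : V) : Cone (Bl ε z) := by
  constructor
  · apply IsClosed.measurableSet
    exact isClosed_le (continuous_abs.comp (continuous_wd z))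
      ((continuous_const.mul continuous_en).mul continuous_const)
  · intro v hv c hc
    simp only [Bl, Set.mem_setOf_eq] at hv ⊢
    rw [wd_smul_left, en_smul, abs_mul]
    have := abs_nonneg c
    nlinarith

lemma Bl_smul (ε : ℝ) (z : V) {c : ℝ} (hc : c ≠ 0) : Bl ε (c • z) = Bl ε z := by
  ext v
  simp only [Bl, Set.mem_setOf_eq]
  rw [wd_smul_right, en_smul, abs_mul]
  have := abs_pos.2 hc
  constructor
  · intro h
    have : |c| * |wd v z| ≤ |c| * (ε * en v * en z) := by linarith
    exact le_of_mul_le_mul_left this (abs_pos.2 hc)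
  · intro h; nlinarith

lemma compact_sphere : IsCompact {z : V | en z = 1} := by
  refine Metric.isCompact_of_isClosed_isBounded (isClosed_eq continuous_en continuous_const) ?_
  rw [isBounded_iff_forall_norm_le]
  refine ⟨1, fun z hz => ?_⟩
  rw [Set.mem_setOf_eq, en] at hz
  rw [pi_norm_le_iff_of_nonneg zero_le_one]
  intro i
  rw [Real.norm_eq_abs]
  have := abs_nonneg (z 0)
  have := abs_nonneg (z 1)
  fin_cases i
  · simp only [Fin.zero_eta]; linarith
  · simp only [Fin.mk_one]; linarith

lemma wd_sub_right (v z z' : V) : wd v (z - z') = wd v z - wd v z' := by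
  simp only [wd, Pi.sub_apply]; ring

/-- atoms of the mean -/
def Atom (m : Set V → ℝ) (z : V) : Prop := z ≠ 0 ∧ ∀ ε > 0, 1/2 ≤ m (Bl ε z)

lemma normalize {z : V} (hz : z ≠ 0) : en ((en z)⁻¹ • z) = 1 := by
  rw [en_smul, abs_of_pos (inv_pos.2 (en_pos hz)), inv_mul_cancel₀ (en_pos hz).ne']

lemma Mean.uniform (h : Mean A m) (hno : ∀ z, ¬ Atom m z) :
    ∃ ε > 0, ∀ z : V, z ≠ 0 → m (Bl ε z) < 1/2 := by
  have key : ∃ ε > 0, ∀ z ∈ {z : V | en z = 1}, m (Bl ε z) < 1/2 := by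
    refine compact_sphere.induction_on (p := fun s => ∃ ε > 0, ∀ z ∈ s, en z = 1 → m (Bl ε z) < 1/2)
      ⟨1, one_pos, fun z hz => absurd hz (by simp)⟩ ?_ ?_ ?_ |> fun ⟨ε, h1, h2⟩ =>
        ⟨ε, h1, fun z hz => h2 z hz hz⟩
    · rintro s t hst ⟨ε, h1, h2⟩
      exact ⟨ε, h1, fun z hz => h2 z (hst hz)⟩
    · rintro s t ⟨ε, h1, h2⟩ ⟨ε', h1', h2'⟩
      have hm : ∀ a b z, a ≤ b → m (Bl a z) ≤ m (Bl b z) := by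
        intro a b z hab
        refine h.mono (cone_Bl _ _) (cone_Bl _ _) fun v hv => ?_
        simp only [Bl, Set.mem_setOf_eq] at hv ⊢
        have := en_nonneg v
        have := en_nonneg z
        refine hv.trans ?_
        gcongr
      refine ⟨min ε ε', lt_min h1 h1', fun z hz hz1 => ?_⟩
      rcases hz with hz | hz
      · exact (hm _ _ z (min_le_left _ _)).trans_lt (h2 z hz hz1)
      · exact (hm _ _ z (min_le_right _ _)).trans_lt (h2' z hz hz1)
    · intro z hz
      have hz1 : en z = 1 := hz
      have hz0 : z ≠ 0 := by rintro rfl; simp [en] at hz1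
      have := hno z
      unfold Atom at this
      push Not at this
      obtain ⟨ε, hε, hlt⟩ := this hz0
      refine ⟨{z' | en (z - z') < ε / 2}, ?_, ε / 2, by positivity, ?_⟩
      · apply mem_nhdsWithin_of_mem_nhds
        apply IsOpen.mem_nhds
        · exact isOpen_lt (continuous_en.comp (continuous_const.sub continuous_id)) continuous_const
        · simp [en, hε]
      · intro z' hz' hz'1
        refine lt_of_le_of_lt (h.mono (cone_Bl _ _) (cone_Bl _ _) fun v hv => ?_) hlt
        simp only [Bl, Set.mem_setOf_eq] at hv hz' ⊢
        have e : wd v z = wd v z' + wd v (z - z') := by rw [wd_sub_right]; ring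
        rw [e]
        refine (abs_add_le _ _).trans ?_
        have h1 := wd_le v (z - z')
        rw [hz'1] at hv
        rw [hz1]
        have := en_nonneg v
        nlinarith
  obtain ⟨ε, hε, h2⟩ := key
  refine ⟨ε, hε, fun z hz => ?_⟩
  have := h2 _ (normalize hz)
  rwa [Bl_smul _ _ (inv_ne_zero (en_pos hz).ne')] at this

lemma Mean.bounded (h : Mean A m) {ε : ℝ} (hε : 0 < ε)
    (hu : ∀ z : V, z ≠ 0 → m (Bl ε z) < 1/2) {n : ℕ} {g : SL2} (hg : W A n g) :
    nm g ≤ 2 / ε := by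
  by_contra hlt
  push Not at hlt
  obtain ⟨z, hz1, hz2⟩ := exists_contr g
  obtain ⟨v0, hv1, hv2⟩ := exists_col g
  set y := ac g v0 with hy
  have hgpos := nm_pos g
  have hzpos : 0 < en z := by linarith
  have hypos : 0 < en y := by linarith
  have hz0 : z ≠ 0 := by rintro rfl; simp [en] at hzpos
  have hy0 : y ≠ 0 := by intro h; rw [h] at hypos; simp [en] at hypos
  have hcov : Set.univ ⊆ Bl ε z ∪ ac g ⁻¹' Bl ε y := by
    intro v _
    by_cases hv : v ∈ Bl ε z
    · exact Or.inl hv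
    · right
      simp only [Bl, Set.mem_setOf_eq, Set.mem_preimage, not_le] at hv ⊢
      have h1 := wd_le_ac g v z hz1
      have h2 : |wd (ac g v) y| ≤ en v := by
        rw [hy, wd_ac]
        have := wd_le v v0
        rwa [hv1, mul_one] at this
      refine h2.trans ?_
      have h3 : ε * en v * en z ≤ en (ac g v) := hv.le.trans h1
      have h4 : 1 ≤ ε * en z := by
        rw [div_lt_iff₀ hε] at hlt; nlinarith
      have h5 : 1 ≤ ε * en y := by
        rw [div_lt_iff₀ hε] at hlt; nlinarith
      have h6 := en_nonneg v
      calc en v ≤ en v * ((ε * en z) * (ε * en y)) := by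
            have : 1 ≤ (ε * en z) * (ε * en y) := one_le_mul_of_one_le_of_one_le h4 h5
            nlinarith
        _ = ε * (ε * en v * en z) * en y := by ring
        _ ≤ ε * en (ac g v) * en y := by gcongr
  have h1 := h.mono Cone.univ ((cone_Bl ε z).union ((cone_Bl ε y).preimage g)) hcov
  have h2 := h.union_le (cone_Bl ε z) ((cone_Bl ε y).preimage g)
  rw [h.univ] at h1
  rw [h.invW hg (cone_Bl ε y)] at h2
  linarith [hu z hz0, hu y hy0]

lemma Atom.inv (h : Mean A m) {z : V} (hz : Atom m z) (i : ι) : Atom m (ac (A i) z) := by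
  refine ⟨ac_ne _ hz.1, fun ε hε => ?_⟩
  have hM := nm_pos (A i)
  rw [← h.inv i _ (cone_Bl _ _)]
  refine (hz.2 (ε / nm (A i) ^ 2) (by positivity)).trans ?_
  refine h.mono (cone_Bl _ _) ((cone_Bl _ _).preimage _) fun v hv => ?_
  simp only [Bl, Set.mem_setOf_eq, Set.mem_preimage] at hv ⊢
  rw [wd_ac]
  refine hv.trans ?_
  have h1 := en_le_ac (A i) v
  have h2 := en_le_ac (A i) z
  have := en_nonneg v
  have := en_nonneg z
  have := en_nonneg (ac (A i) v)
  have := en_nonneg (ac (A i) z)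
  calc _ ≤ ε / nm (A i) ^ 2 * (nm (A i) * en (ac (A i) v)) * (nm (A i) * en (ac (A i) z)) := by
        gcongr
    _ = _ := by field_simp

lemma wd_id (v z1 z2 : V) : wd z1 z2 • v = wd v z2 • z1 - wd v z1 • z2 := by
  ext i; fin_cases i <;> simp [wd] <;> ring

lemma Bl_disjoint {z1 z2 : V} (h12 : wd z1 z2 ≠ 0) : ∃ ε > 0, ∀ δ ≤ ε,
    Disjoint (Bl δ z1 ∩ {0}ᶜ) (Bl δ z2 ∩ {0}ᶜ) := by
  have hz1 : z1 ≠ 0 := by rintro rfl; simp [wd] at h12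
  have hz2 : z2 ≠ 0 := by rintro rfl; simp [wd] at h12
  have p1 := en_pos hz1
  have p2 := en_pos hz2
  have pw := abs_pos.2 h12
  refine ⟨|wd z1 z2| / (4 * en z1 * en z2), by positivity, fun δ hδ => ?_⟩
  rw [Set.disjoint_left]
  rintro v ⟨hv1, hv0⟩ ⟨hv2, -⟩
  simp only [Bl, Set.mem_setOf_eq, Set.mem_compl_iff, Set.mem_singleton_iff] at hv1 hv2 hv0
  have pv := en_pos hv0
  have h1 := congrArg en (wd_id v z1 z2)
  rw [en_smul] at h1
  have h2 := en_sub (wd v z2 • z1) (wd v z1 • z2)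
  rw [en_smul, en_smul, ← h1] at h2
  rw [le_div_iff₀ (by positivity)] at hδ
  have h3 : |wd v z2| * en z1 ≤ δ * en v * en z2 * en z1 := by gcongr
  have h4 : |wd v z1| * en z2 ≤ δ * en v * en z1 * en z2 := by gcongr
  nlinarith

theorem Mean.tri (h : Mean A m) :
    (∃ R, ∀ n g, W A n g → nm g ≤ R) ∨ (∃ z : V, z ≠ 0 ∧ ∀ i, wd (ac (A i) z) z = 0) ∨
    (∃ z1 z2 : V, wd z1 z2 ≠ 0 ∧ ∀ i, (wd (ac (A i) z1) z1 = 0 ∧ wd (ac (A i) z2) z2 = 0) ∨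
      (wd (ac (A i) z1) z2 = 0 ∧ wd (ac (A i) z2) z1 = 0)) := by
  by_cases hno : ∀ z, ¬ Atom m z
  · obtain ⟨ε, hε, hu⟩ := h.uniform hno
    exact Or.inl ⟨2 / ε, fun n g hg => h.bounded hε hu hg⟩
  right
  push Not at hno
  obtain ⟨z1, hz1⟩ := hno
  by_cases hcol : ∀ z, Atom m z → wd z z1 = 0
  · exact Or.inl ⟨z1, hz1.1, fun i => hcol _ (hz1.inv h i)⟩
  right
  push Not at hcol
  obtain ⟨z2, hz2, h21⟩ := hcol
  have h12 : wd z1 z2 ≠ 0 := by rw [wd_swap]; simpa using h21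
  have hthird : ∀ z, Atom m z → wd z z1 = 0 ∨ wd z z2 = 0 := by
    intro z hz
    by_contra hc
    push Not at hc
    obtain ⟨c1, c2⟩ := hc
    obtain ⟨ε1, hε1, d1⟩ := Bl_disjoint c1
    obtain ⟨ε2, hε2, d2⟩ := Bl_disjoint c2
    obtain ⟨ε3, hε3, d3⟩ := Bl_disjoint h12
    set ε := min ε1 (min ε2 ε3) with hε
    have hεpos : 0 < ε := lt_min hε1 (lt_min hε2 hε3)
    have D1 := d1 ε (min_le_left _ _)
    have D2 := d2 ε ((min_le_right _ _).trans (min_le_left _ _))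
    have D3 := d3 ε ((min_le_right _ _).trans (min_le_right _ _))
    have hb : ∀ y, Atom m y → 1/2 ≤ m (Bl ε y ∩ {0}ᶜ) := by
      intro y hy
      have e1 := hy.2 ε hεpos
      have e2 := h.union_le ((cone_Bl ε y).inter Cone.zero.compl) Cone.zero
      have e3 := h.mono (cone_Bl ε y) (((cone_Bl ε y).inter Cone.zero.compl).union Cone.zero)
        (fun v hv => by
          by_cases hv0 : v = 0
          · exact Or.inr hv0
          · exact Or.inl ⟨hv, hv0⟩)
      rw [h.zero] at e2
      linarith
    have cc := fun y => (cone_Bl ε y).inter Cone.zero.compl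
    have s1 := h.add _ _ (cc z1) (cc z2) D3
    have s2 := h.add _ _ (cc z) ((cc z1).union (cc z2)) (D1.union_right D2)
    have s3 := h.mono ((cc z).union ((cc z1).union (cc z2))) Cone.univ (Set.subset_univ _)
    rw [h.univ] at s3
    linarith [hb z hz, hb z1 hz1, hb z2 hz2]
  refine ⟨z1, z2, h12, fun i => ?_⟩
  have nz : ∀ w : V, w ≠ 0 → wd (ac (A i) z1) w = 0 → wd (ac (A i) z2) w = 0 → False := by
    intro w hw a b
    have := wd_id w (ac (A i) z1) (ac (A i) z2)
    rw [wd_swap] at a b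
    rw [neg_eq_zero] at a b
    rw [a, b, zero_smul, zero_smul, sub_zero, wd_ac, smul_eq_zero] at this
    exact this.elim h12 hw
  rcases hthird _ (hz1.inv h i) with a | a <;> rcases hthird _ (hz2.inv h i) with b | b
  · exact (nz z1 hz1.1 a b).elim
  · exact Or.inl ⟨a, b⟩
  · exact Or.inr ⟨a, b⟩
  · exact (nz z2 hz2.1 a b).elim

end mean
end TV

namespace TV
open Finset

/-! ### Atoms of the walk on the projective line, uniform expansion -/

section atoms
variable {ι : Type*} [Fintype ι] {p : ι → ℝ} {A : ι → SL2}

lemma ex_eventually {G : Type*} [Monoid G] {A : ι → G} (hp : Pr p) {α : Type*} {F : Filter α} (k : ℕ)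
    {φ : α → G → ℝ}
    {ψ : G → ℝ} (h : ∀ g, ∀ᶠ x in F, φ x g ≤ ψ g) :
    ∀ᶠ x in F, ex p A k (φ x) ≤ ex p A k ψ := by
  induction k generalizing φ ψ with
  | zero => exact h 1
  | succ k ih =>
    have h1 : ∀ i, ∀ᶠ x in F, ex p A k (fun g => φ x (g * A i)) ≤ ex p A k (fun g => ψ (g * A i)) :=
      fun i => ih fun g => h _
    filter_upwards [Filter.eventually_all.2 h1] with x hx
    exact sum_le_sum fun i _ => mul_le_mul_of_nonneg_left (hx i) (hp.pos i).le

open Classical in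
/-- Probability that the walk started at `v` hits the line of `z` at time `k`. -/
def Pk (p : ι → ℝ) (A : ι → SL2) (k : ℕ) (v z : V) : ℝ :=
  ex p A k (fun g => if wd (ac g v) z = 0 then 1 else 0)

open Classical in
/-- Neighbourhood version. -/
def Qk (p : ι → ℝ) (A : ι → SL2) (k : ℕ) (ε : ℝ) (v z : V) : ℝ :=
  ex p A k (fun g => if |wd (ac g v) z| ≤ ε then 1 else 0)

lemma Qk_small (hp : Pr p) {k : ℕ} (h : ∀ v z : V, v ≠ 0 → z ≠ 0 → Pk p A k v z ≤ 1/4) :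
    ∃ ε > 0, ∀ v z : V, en v = 1 → en z = 1 → Qk p A k ε v z ≤ 1/4 := by
  classical
  have key : ∀ᶠ ε in nhds (0:ℝ), ∀ y ∈ {z : V | en z = 1} ×ˢ {z : V | en z = 1},
      Qk p A k ε y.1 y.2 ≤ 1/4 := by
    refine IsCompact.eventually_forall_of_forall_eventually
      (compact_sphere.prod compact_sphere) ?_
    rintro ⟨v, z⟩ ⟨hv, hz⟩
    simp only [Set.mem_setOf_eq] at hv hz
    have hv0 : v ≠ 0 := fun h0 => by rw [en_eq_zero.2 h0] at hv; exact zero_ne_one hv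
    have hz0 : z ≠ 0 := fun h0 => by rw [en_eq_zero.2 h0] at hz; exact zero_ne_one hz
    have := ex_eventually (A := A) hp k (F := nhds ((0:ℝ), (v, z)))
      (φ := fun x g => if |wd (ac g x.2.1) x.2.2| ≤ x.1 then (1:ℝ) else 0)
      (ψ := fun g => if wd (ac g v) z = 0 then (1:ℝ) else 0) ?_
    · filter_upwards [this] with x hx
      exact hx.trans (h v z hv0 hz0)
    intro g
    by_cases hw : wd (ac g v) z = 0
    · refine Filter.Eventually.of_forall fun x => ?_
      rw [if_pos hw]
      split_ifs <;> norm_num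
    · have hc : Continuous (fun x : ℝ × (V × V) => |wd (ac g x.2.1) x.2.2|) := by
        have h1 : Continuous (fun x : ℝ × (V × V) => ac g x.2.1) :=
          (continuous_ac g).comp (continuous_fst.comp continuous_snd)
        unfold wd; fun_prop
      have := (isOpen_lt continuous_fst hc).mem_nhds
        (show ((0:ℝ), (v, z)) ∈ {x : ℝ × (V × V) | x.1 < |wd (ac g x.2.1) x.2.2|} from abs_pos.2 hw)
      filter_upwards [this] with x hx
      rw [if_neg (not_le.2 hx), if_neg hw]
  obtain ⟨δ, hδ, hb⟩ := Metric.eventually_nhds_iff.1 key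
  refine ⟨δ/2, by linarith, fun v z hv hz => ?_⟩
  have := @hb (δ/2) (by rw [Real.dist_eq, sub_zero, abs_of_pos] <;> linarith)
  exact this (v, z) ⟨hv, hz⟩

lemma La_smul {c : ℝ} (hc : c ≠ 0) (n : ℕ) (v : V) : La p A n (c • v) = La p A n v := by
  unfold La
  refine ex_congr n fun g => ?_
  rw [ac_smul, en_smul, en_smul, mul_div_mul_left _ _ (abs_pos.2 hc).ne']

lemma La_lower (hp : Pr p) {k : ℕ} (h : ∀ v z : V, v ≠ 0 → z ≠ 0 → Pk p A k v z ≤ 1/4) :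
    ∃ C : ℝ, ∀ n, ∀ v : V, v ≠ 0 → aa p A n / 2 - C ≤ La p A (k + n) v := by
  classical
  obtain ⟨ε, hε, hQ⟩ := Qk_small hp h
  obtain ⟨M, hM, hA⟩ := exists_nm_bound A
  set R : ℝ := 2 * M ^ k with hR
  have hR1 : 1 ≤ R := by
    have : 1 ≤ M ^ k := one_le_pow₀ (by linarith)
    linarith
  have hC1 : 0 ≤ |Real.log (ε / 2)| := abs_nonneg _
  have hC2 : 0 ≤ Real.log R := Real.log_nonneg hR1
  set C := |Real.log (ε / 2)| + Real.log R with hC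
  have key : ∀ n, ∀ v : V, en v = 1 → aa p A n / 2 - C ≤ La p A (k + n) v := by
    intro n v hv
    have hv0 : v ≠ 0 := fun h0 => by rw [en_eq_zero.2 h0] at hv; exact zero_ne_one hv
    unfold La
    rw [ex_add, ex_comm]
    have e1 : aa p A n / 2 - C = ex p A n (fun h => 1/2 * Real.log (nm h) - C) := by
      rw [ex_sub, ex_smul, ex_const hp]; unfold aa; ring
    rw [e1]
    refine ex_mono hp fun h => ?_
    obtain ⟨z, hz1, hz2⟩ := exists_contr h
    have hz0 : z ≠ 0 := by
      rintro rfl; rw [ac_zero, en_eq_zero.2 rfl] at hz1; exact zero_ne_one hz1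
    have pz := en_pos hz0
    have hq := hQ v ((en z)⁻¹ • z) hv (normalize hz0)
    have hl := log_nm_nonneg h
    calc 1/2 * Real.log (nm h) - C
        ≤ (Real.log (nm h) - C) - 2 * Real.log (nm h) * Qk p A k ε v ((en z)⁻¹ • z) := by
          have := mul_le_mul_of_nonneg_left hq hl
          linarith
      _ = ex p A k (fun g => (Real.log (nm h) - C) - 2 * Real.log (nm h) *
            (if |wd (ac g v) ((en z)⁻¹ • z)| ≤ ε then 1 else 0)) := by
          rw [ex_sub, ex_smul, ex_const hp]; rfl
      _ ≤ _ := by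
          refine ex_mono_W hp fun g hg => ?_
          have hg' := W_bound hM hA hg
          rw [hv, div_one, ac_mul]
          have pu := en_pos (ac_ne h (ac_ne g hv0))
          have pn := nm_pos h
          split_ifs with hb
          · have h1 := en_le_ac h (ac g v)
            have h2 := en_le_ac g v
            rw [hv] at h2
            have h3 : 1 ≤ R * (nm h * en (ac h (ac g v))) := by
              calc 1 ≤ nm g * en (ac g v) := h2
                _ ≤ R * (nm h * en (ac h (ac g v))) :=
                  mul_le_mul hg' h1 (en_nonneg _) (by linarith)
            have h4 := Real.log_nonneg h3
            rw [Real.log_mul (by linarith) (by positivity), Real.log_mul pn.ne' pu.ne'] at h4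
            linarith
          · push Not at hb
            rw [wd_smul_right, abs_mul, abs_of_pos (inv_pos.2 pz), inv_mul_eq_div,
              lt_div_iff₀ pz] at hb
            have h1 := wd_le_ac h (ac g v) z hz1
            have h3 : ε / 2 * nm h ≤ en (ac h (ac g v)) := by nlinarith
            have h4 := Real.log_le_log (by positivity) h3
            rw [Real.log_mul (by positivity) pn.ne'] at h4
            have := neg_abs_le (Real.log (ε / 2))
            linarith
  refine ⟨C, fun n v hv => ?_⟩
  rw [← La_smul (inv_ne_zero (en_pos hv).ne')]
  exact key n _ (normalize hv)

theorem hol_of_atoms (hp : Pr p) (hL : 0 < Ly p A) {k : ℕ}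
    (h : ∀ v z : V, v ≠ 0 → z ≠ 0 → Pk p A k v z ≤ 1/4) : Hol p A := by
  obtain ⟨C, hC⟩ := La_lower hp h
  obtain ⟨n, hn⟩ := exists_nat_gt ((2 * (C + 1)) / Ly p A)
  rw [div_lt_iff₀ hL] at hn
  refine hol_of_expanding hp (N := k + n) fun v hv => ?_
  have h1 := hC n v hv
  have h2 := ly_mul_le (A := A) hp n
  linarith

/-! finite invariant sets of lines -/

/-- slope -/
def sl (v : V) : Option ℝ := if v 0 = 0 then none else some (v 1 / v 0)
/-- representative vector -/
def rv : Option ℝ → V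
  | none => ![0, 1]
  | some x => ![1, x]

lemma rv_ne (s : Option ℝ) : rv s ≠ 0 := by
  intro h
  cases s with
  | none => have := congrFun h 1; simp [rv] at this
  | some x => have := congrFun h 0; simp [rv] at this

lemma sl_rv (s : Option ℝ) : sl (rv s) = s := by
  cases s <;> simp [sl, rv]

lemma rv_sl {u : V} (hu : u ≠ 0) : ∃ c : ℝ, c ≠ 0 ∧ rv (sl u) = c • u := by
  by_cases h : u 0 = 0
  · have h1 : u 1 ≠ 0 := fun h1 => hu (by ext i; fin_cases i <;> simp [h, h1])
    refine ⟨(u 1)⁻¹, inv_ne_zero h1, ?_⟩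
    ext i; fin_cases i <;> simp [sl, rv, h, h1]
  · refine ⟨(u 0)⁻¹, inv_ne_zero h, ?_⟩
    ext i; fin_cases i <;> simp [sl, rv, h, div_eq_inv_mul]

lemma sl_smul {c : ℝ} (hc : c ≠ 0) (u : V) : sl (c • u) = sl u := by
  simp only [sl, Pi.smul_apply, smul_eq_mul, mul_eq_zero, hc, false_or]
  rw [mul_div_mul_left _ _ hc]

lemma wd_sl {u w : V} (hu : u ≠ 0) (hw : w ≠ 0) (h : wd u w = 0) : sl u = sl w := by
  unfold wd at h
  have hu1 : u 0 = 0 → u 1 ≠ 0 := fun h h1 => hu (by ext i; fin_cases i <;> simp [h, h1])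
  have hw1 : w 0 = 0 → w 1 ≠ 0 := fun h h1 => hw (by ext i; fin_cases i <;> simp [h, h1])
  unfold sl
  by_cases a : u 0 = 0 <;> by_cases b : w 0 = 0
  · simp [a, b]
  · exfalso; simp [a] at h; exact h.elim (hu1 a) b
  · exfalso; simp [b] at h; exact h.elim a (hw1 b)
  · rw [if_neg a, if_neg b]; congr 1; field_simp; linarith

lemma Pk_shift (k r : ℕ) (v z : V) :
    Pk p A (k + r) v z = ex p A r (fun h => Pk p A k v (ac h⁻¹ z)) := by
  unfold Pk
  rw [ex_add, ex_comm]
  simp only [ac_mul, wd_ac_left]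

lemma Pk_le_one (hp : Pr p) (k : ℕ) (v z : V) : Pk p A k v z ≤ 1 := by
  unfold Pk
  refine le_of_le_of_eq (ex_mono (ψ := fun _ => 1) hp fun g => ?_) (ex_const (A := A) hp k 1)
  split_ifs <;> norm_num

lemma ex_weight {G : Type*} [Monoid G] {A : ι → G} (hp : Pr p) {π c : ℝ} (hπ : ∀ i, π ≤ p i) (h0 : 0 ≤ π)
    {r : ℕ} {φ : G → ℝ} (hφ : ∀ g, W A r g → φ g ≤ c) {h : G} (hh : W A r h) :
    ex p A r φ ≤ c - π ^ r * (c - φ h) := by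
  classical
  induction hh generalizing φ with
  | one => simp
  | @mul n g i hg ih =>
    have h1 := ih (φ := fun g => φ (g * A i)) (fun g hg => hφ _ (W.mul i hg))
    rw [ex_succ]
    have h2 : ∀ j, p j * ex p A n (fun g => φ (g * A j)) ≤
        p j * c - (if j = i then π * (π ^ n * (c - φ (g * A i))) else 0) := by
      intro j
      split_ifs with hj
      · subst hj
        have h3 : 0 ≤ π ^ n * (c - φ (g * A j)) :=
          mul_nonneg (pow_nonneg h0 n) (by linarith [hφ _ (W.mul j hg)])
        have h4 := mul_le_mul_of_nonneg_right (hπ j) h3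
        have h5 := mul_le_mul_of_nonneg_left h1 (hp.pos j).le
        linarith
      · rw [sub_zero]
        refine mul_le_mul_of_nonneg_left ?_ (hp.pos j).le
        rw [← ex_const (A := A) hp n c]
        exact ex_mono_W hp fun g hg => hφ _ (W.mul j hg)
    refine (sum_le_sum fun j _ => h2 j).trans ?_
    rw [sum_sub_distrib, ← sum_mul, hp.sum, sum_ite_eq' univ i]
    simp [pow_succ]; linarith

lemma card_atoms (hp : Pr p) {k : ℕ} {v : V} (hv : v ≠ 0) (T : Finset (Option ℝ))
    (hT : ∀ s ∈ T, 1/8 ≤ Pk p A k v (rv s)) : T.card ≤ 8 := by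
  classical
  have h1 : (T.card : ℝ) * (1/8) ≤ ∑ s ∈ T, Pk p A k v (rv s) := by
    rw [← nsmul_eq_mul]; exact card_nsmul_le_sum T _ _ hT
  have h2 : ∑ s ∈ T, Pk p A k v (rv s) ≤ 1 := by
    unfold Pk
    rw [← ex_sum]
    refine le_of_le_of_eq (ex_mono (ψ := fun _ => 1) hp fun g => ?_) (ex_const (A := A) hp k 1)
    have : ∀ s ∈ T, (if wd (ac g v) (rv s) = 0 then (1:ℝ) else 0) ≤
        if s = sl (ac g v) then 1 else 0 := by
      intro s _
      by_cases h : wd (ac g v) (rv s) = 0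
      · have := wd_sl (ac_ne g hv) (rv_ne s) h
        rw [sl_rv] at this
        rw [if_pos h, if_pos this.symm]
      · rw [if_neg h]; split_ifs <;> norm_num
    refine (sum_le_sum this).trans ?_
    rw [sum_ite_eq' T]; split_ifs <;> norm_num
  have h3 : (T.card : ℝ) ≤ 8 := by linarith
  exact_mod_cast h3

open Classical in
/-- orbits of a line under inverse words -/
def So (A : ι → SL2) (z : V) : ℕ → Finset (Option ℝ)
  | 0 => {sl z}
  | j+1 => univ.biUnion fun i => (So A z j).image fun s => sl (ac (A i)⁻¹ (rv s))

lemma So_word {z : V} (hz : z ≠ 0) {j : ℕ} {s : Option ℝ} (hs : s ∈ So A z j) :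
    ∃ h, W A j h ∧ s = sl (ac h⁻¹ z) := by
  induction j generalizing s with
  | zero => exact ⟨1, W.one, by simpa [So] using hs⟩
  | succ j ih =>
    simp only [So, mem_biUnion, mem_univ, true_and, mem_image] at hs
    obtain ⟨i, t, ht, rfl⟩ := hs
    obtain ⟨h, hh, rfl⟩ := ih ht
    refine ⟨h * A i, W.mul i hh, ?_⟩
    obtain ⟨c, hc, e⟩ := rv_sl (ac_ne h⁻¹ hz)
    rw [e, ac_smul, sl_smul hc, mul_inv_rev, ac_mul]

lemma So_mono {o : ι} (ho : A o = 1) (z : V) (j : ℕ) : So A z j ⊆ So A z (j+1) := by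
  intro s hs
  simp only [So, mem_biUnion, mem_univ, true_and, mem_image]
  exact ⟨o, s, hs, by rw [ho, inv_one, ac_one, sl_rv]⟩

lemma W_pad {o : ι} (ho : A o = 1) {j : ℕ} {h : SL2} (hh : W A j h) (r : ℕ) : W A (j + r) h := by
  induction r with
  | zero => exact hh
  | succ r ih => have := W.mul o ih; rwa [ho, mul_one] at this

open Classical in
lemma mean_of_finite (S : Finset (Option ℝ)) (hS : S.Nonempty)
    (hinv : ∀ i, ∀ s ∈ S, sl (ac (A i)⁻¹ (rv s)) ∈ S) : ∃ m, Mean A m := by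
  have hc : (0:ℝ) < S.card := by exact_mod_cast card_pos.2 hS
  refine ⟨fun E => (∑ s ∈ S, if rv s ∈ E then (1:ℝ) else 0) / S.card, ?_, ?_, ?_, ?_, ?_⟩
  · intro E _
    exact div_nonneg (sum_nonneg fun s _ => by split_ifs <;> norm_num) hc.le
  · intro E F _ _ hd
    rw [← add_div, ← sum_add_distrib]
    congr 1
    refine sum_congr rfl fun s _ => ?_
    by_cases h1 : rv s ∈ E <;> by_cases h2 : rv s ∈ F
    · exact (Set.disjoint_left.1 hd h1 h2).elim
    all_goals simp [h1, h2]
  · simp [hc.ne']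
  · simp [rv_ne]
  · intro i E hE
    congr 1
    set T : Option ℝ → Option ℝ := fun s => sl (ac (A i)⁻¹ (rv s)) with hT
    have hTi : Function.Injective T := by
      intro s t hst
      obtain ⟨c, hc, e⟩ := rv_sl (ac_ne (A i)⁻¹ (rv_ne s))
      obtain ⟨c', hc', e'⟩ := rv_sl (ac_ne (A i)⁻¹ (rv_ne t))
      have e2 : sl (ac (A i)⁻¹ (rv s)) = sl (ac (A i)⁻¹ (rv t)) := hst
      rw [e2, e'] at e
      have e3 := congrArg (fun v => sl (ac (A i) v)) e
      simp only [ac_smul, ac_inv', sl_smul hc, sl_smul hc', sl_rv] at e3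
      exact e3.symm
    have himg : S.image T = S :=
      eq_of_subset_of_card_le (image_subset_iff.2 fun s hs => hinv i s hs)
        (by rw [card_image_of_injective _ hTi])
    conv_lhs => rw [← himg]
    rw [sum_image fun a _ b _ h => hTi h]
    refine sum_congr rfl fun t _ => ?_
    obtain ⟨c, hc, e⟩ := rv_sl (ac_ne (A i)⁻¹ (rv_ne t))
    have : rv (T t) ∈ ac (A i) ⁻¹' E ↔ rv t ∈ E := by
      rw [Set.mem_preimage, hT, e, ac_smul, ac_inv']
      constructor
      · intro h
        have := hE.2 _ h c⁻¹ (inv_ne_zero hc)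
        rwa [smul_smul, inv_mul_cancel₀ hc, one_smul] at this
      · intro h; exact hE.2 _ h c hc
    simp only [this]

theorem mean_of_no_atoms (hp : Pr p) {o : ι} (ho : A o = 1)
    (hno : ∀ k, ∃ v z : V, v ≠ 0 ∧ z ≠ 0 ∧ 1/4 < Pk p A k v z) : ∃ m, Mean A m := by
  classical
  -- minimal weight
  obtain ⟨π, hπ0, hπ⟩ : ∃ π : ℝ, 0 < π ∧ ∀ i, π ≤ p i := by
    have : Nonempty ι := ⟨o⟩
    obtain ⟨i, hi⟩ := Finite.exists_min p
    exact ⟨p i, hp.pos i, hi⟩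
  set S : ℕ → Set ℝ := fun k => {x | ∃ v z : V, v ≠ 0 ∧ z ≠ 0 ∧ x = Pk p A k v z} with hSdef
  have hSb : ∀ k, BddAbove (S k) := fun k => ⟨1, by
    rintro x ⟨v, z, _, _, rfl⟩; exact Pk_le_one hp k v z⟩
  set q : ℕ → ℝ := fun k => sSup (S k) with hq
  have hqle : ∀ k (v z : V), v ≠ 0 → z ≠ 0 → Pk p A k v z ≤ q k := fun k v z hv hz =>
    le_csSup (hSb k) ⟨v, z, hv, hz, rfl⟩
  have hq4 : ∀ k, 1/4 ≤ q k := fun k => by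
    obtain ⟨v, z, hv, hz, h⟩ := hno k
    exact h.le.trans (hqle k v z hv hz)
  have hqb : BddBelow (Set.range q) := ⟨1/4, by rintro _ ⟨k, rfl⟩; exact hq4 k⟩
  set η : ℝ := π ^ 9 / 16 with hη
  have hη0 : 0 < η := by positivity
  obtain ⟨k, hk⟩ : ∃ k, q k < (⨅ j, q j) + η / 2 := exists_lt_of_ciInf_lt (by linarith)
  have hk9 : (⨅ j, q j) ≤ q (k + 9) := ciInf_le hqb _
  obtain ⟨x, ⟨v, z, hv, hz, rfl⟩, hx⟩ : ∃ x ∈ S (k + 9), q (k+9) - η / 2 < x := by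
    refine exists_lt_of_lt_csSup ?_ (by simp only [hq]; linarith)
    obtain ⟨v, z, hv, hz, h⟩ := hno (k + 9)
    exact ⟨_, v, z, hv, hz, rfl⟩
  have hbig : ∀ h, W A 9 h → 1/8 ≤ Pk p A k v (ac h⁻¹ z) := by
    intro h hh
    have h1 := ex_weight (φ := fun h => Pk p A k v (ac h⁻¹ z)) (c := q k) hp hπ hπ0.le
      (fun g _ => hqle k v _ hv (ac_ne _ hz)) hh
    rw [← Pk_shift] at h1
    have h2 : π ^ 9 * (q k - Pk p A k v (ac h⁻¹ z)) < π ^ 9 * (1 / 16) := by linarith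
    have h3 := lt_of_mul_lt_mul_left h2 (by positivity)
    linarith [hq4 k]
  have hcard : ∀ j ≤ 9, (So A z j).card ≤ 8 := by
    intro j hj
    refine card_atoms hp hv (A := A) (k := k) _ fun s hs => ?_
    obtain ⟨h, hh, rfl⟩ := So_word hz hs
    have h1 := W_pad ho hh (9 - j)
    rw [Nat.add_sub_cancel' hj] at h1
    obtain ⟨c, hc, e⟩ := rv_sl (ac_ne h⁻¹ hz)
    have := hbig h h1
    unfold Pk at this ⊢
    rw [e]
    simpa only [wd_smul_right, mul_eq_zero, hc, false_or] using this
  obtain ⟨j, hj⟩ : ∃ j, So A z (j+1) = So A z j := by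
    by_contra hcon
    push Not at hcon
    have : ∀ j, j + 1 ≤ (So A z j).card := by
      intro j
      induction j with
      | zero => simp [So]
      | succ j ih =>
        have := card_lt_card (Finset.ssubset_iff_subset_ne.2 ⟨So_mono ho z j, (hcon j).symm⟩)
        omega
    have h1 := this 9
    have h2 := hcard 9 le_rfl
    omega
  refine mean_of_finite (So A z j) ?_ fun i s hs => ?_
  · have : ∀ j, (So A z j).Nonempty := by
      intro j
      induction j with
      | zero => exact ⟨sl z, by simp [So]⟩
      | succ j ih => exact ih.mono (So_mono ho z j)
    exact this j
  · rw [← hj]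
    simp only [So, mem_biUnion, mem_univ, true_and, mem_image]
    exact ⟨i, s, hs, rfl⟩

end atoms
end TV

namespace TV
open Finset

/-! ### Zero exponent gives an invariant mean -/

lemma mp_ac (g : SL2) : MeasurePreserving (ac g) (volume : Measure V) volume := by
  refine ⟨(continuous_ac g).measurable, ?_⟩
  have h1 : ((g : Mat2)).det = 1 := g.2
  have h := Real.map_matrix_volume_pi_eq_smul_volume_pi (M := (g : Mat2)) (by rw [h1]; exact one_ne_zero)
  rw [h1] at h
  simp only [inv_one, abs_one, ENNReal.ofReal_one, one_smul] at h
  have h2 : (ac g) = Matrix.toLin' (g : Mat2) := by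
    ext v : 1; rw [Matrix.toLin'_apply]; rfl
  rw [h2]; exact h

/-- the Hilbert space -/
abbrev HH := Lp ℝ 2 (volume : Measure V)

/-- Koopman operator -/
def Us (g : SL2) : HH →ₗᵢ[ℝ] HH := Lp.compMeasurePreservingₗᵢ ℝ (ac g) (mp_ac g)

lemma Us_coe (g : SL2) (f : HH) : (Us g f : V → ℝ) =ᵐ[volume] (f : V → ℝ) ∘ ac g :=
  Lp.coeFn_compMeasurePreserving f (mp_ac g)

lemma Us_mul (g h : SL2) (f : HH) : Us g (Us h f) = Us (h * g) f := by
  apply Lp.ext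
  have h1 := Us_coe g (Us h f)
  have h2 := (mp_ac g).quasiMeasurePreserving.ae_eq_comp (Us_coe h f)
  have h3 := Us_coe (h * g) f
  refine h1.trans (h2.trans ?_)
  refine Filter.EventuallyEq.trans (Filter.EventuallyEq.of_eq ?_) h3.symm
  ext v; simp [ac_mul]

lemma Us_one (f : HH) : Us 1 f = f := by
  apply Lp.ext
  refine (Us_coe 1 f).trans (Filter.EventuallyEq.of_eq ?_)
  ext v; simp

section gap
variable {ι : Type*} [Fintype ι] {p : ι → ℝ} {A : ι → SL2}

/-- averaging operator -/
def Pa (p : ι → ℝ) (A : ι → SL2) (f : HH) : HH := ∑ i, p i • Us (A i) f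

lemma gap_alt (hp : Pr p) {o : ι} (ho : A o = 1) {ε : ℝ} (hε : 0 < ε)
    (h : ∀ f : HH, ‖f‖ = 1 → ∃ i, ε < ‖Us (A i) f - f‖) :
    ∃ ρ : ℝ, 0 < ρ ∧ ρ < 1 ∧ ∀ f : HH, ‖Pa p A f‖ ≤ ρ * ‖f‖ := by
  classical
  obtain ⟨π, hπ0, hπ⟩ : ∃ π : ℝ, 0 < π ∧ ∀ i, π ≤ p i := by
    have : Nonempty ι := ⟨o⟩
    obtain ⟨i, hi⟩ := Finite.exists_min p
    exact ⟨p i, hp.pos i, hi⟩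
  have hs : √(4 - ε ^ 2) < 2 := by
    rw [Real.sqrt_lt' (by norm_num)]; nlinarith
  set s := √(4 - ε ^ 2) with hsdef
  have hs0 : 0 ≤ s := Real.sqrt_nonneg _
  refine ⟨max (1/2) (1 - 2 * π + π * s), by positivity, max_lt (by norm_num) (by nlinarith), ?_⟩
  have key : ∀ f : HH, ‖f‖ = 1 → ‖Pa p A f‖ ≤ 1 - 2 * π + π * s := by
    intro f hf
    obtain ⟨i, hi⟩ := h f hf
    have hio : i ≠ o := by
      rintro rfl
      rw [ho, Us_one, sub_self, norm_zero] at hi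
      linarith
    have hU : ∀ j, ‖Us (A j) f‖ = 1 := fun j => by rw [LinearIsometry.norm_map, hf]
    have hpar := parallelogram_law_with_norm ℝ (Us (A i) f) f
    rw [hU, hf] at hpar
    have h1 : ‖Us (A i) f + f‖ ≤ s := by
      apply Real.le_sqrt_of_sq_le
      nlinarith
    have hdec : Pa p A f = (∑ j, (p j - (if j = i then π else 0) - (if j = o then π else 0)) • Us (A j) f)
        + π • (Us (A i) f + f) := by
      unfold Pa
      simp only [sub_smul, sum_sub_distrib, ite_smul, zero_smul, sum_ite_eq', mem_univ, if_true]
      rw [ho, Us_one, smul_add]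
      abel
    rw [hdec]
    refine (norm_add_le _ _).trans ?_
    have h2 : ‖∑ j, (p j - (if j = i then π else 0) - (if j = o then π else 0)) • Us (A j) f‖ ≤
        1 - 2 * π := by
      refine (norm_sum_le _ _).trans ?_
      have : ∀ j, ‖(p j - (if j = i then π else 0) - (if j = o then π else 0)) • Us (A j) f‖ =
          p j - (if j = i then π else 0) - (if j = o then π else 0) := by
        intro j
        rw [norm_smul, hU, mul_one, Real.norm_eq_abs, abs_of_nonneg]
        by_cases hj : j = i
        · subst hj; rw [if_pos rfl, if_neg hio]; linarith [hπ j]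
        · rw [if_neg hj]; split_ifs <;> linarith [hπ j]
      rw [sum_congr rfl fun j _ => this j]
      simp only [sum_sub_distrib, hp.sum, sum_ite_eq', mem_univ, if_true]
      linarith
    rw [norm_smul, Real.norm_eq_abs, abs_of_pos hπ0]
    nlinarith
  intro f
  by_cases hf : f = 0
  · subst hf; simp [Pa]
  have hn := norm_pos_iff.2 hf
  have h1 := key (‖f‖⁻¹ • f) (by rw [norm_smul, norm_inv, norm_norm, inv_mul_cancel₀ hn.ne'])
  have h2 : Pa p A (‖f‖⁻¹ • f) = ‖f‖⁻¹ • Pa p A f := by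
    unfold Pa
    rw [smul_sum]
    exact sum_congr rfl fun i _ => by rw [map_smul, smul_comm]
  rw [h2, norm_smul, norm_inv, norm_norm, inv_mul_le_iff₀ hn, mul_comm] at h1
  exact h1.trans (mul_le_mul_of_nonneg_right (le_max_right _ _) hn.le)

lemma inner_iter (n : ℕ) (f f' : HH) :
    inner ℝ ((Pa p A)^[n] f) f' = ex p A n (fun g => inner ℝ (Us g f) f') := by
  induction n generalizing f with
  | zero => simp [Us_one]
  | succ n ih =>
    rw [Function.iterate_succ_apply, ih, ex_succ_last]
    refine ex_congr n fun g => ?_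
    unfold Pa
    rw [map_sum, sum_inner]
    refine sum_congr rfl fun i _ => ?_
    rw [map_smul, inner_smul_left, Us_mul]; rfl

/-- indicator of the unit ball -/
def fB : HH := indicatorConstLp 2 (s := Metric.ball (0:V) 1) measurableSet_ball
  (measure_ball_lt_top).ne (1:ℝ)

lemma inner_fB (g : SL2) : (nm g)⁻¹ ^ 2 ≤ inner ℝ (Us g fB) fB := by
  have hms : MeasurableSet (ac g ⁻¹' Metric.ball (0:V) 1) := (mp_ac g).measurable measurableSet_ball
  have hfin : volume (ac g ⁻¹' Metric.ball (0:V) 1) ≠ ⊤ := by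
    rw [(mp_ac g).measure_preimage measurableSet_ball.nullMeasurableSet]
    exact (measure_ball_lt_top).ne
  have hfin2 : volume (Metric.ball (0:V) 1) ≠ ⊤ := (measure_ball_lt_top).ne
  have e : Us g fB = indicatorConstLp 2 hms hfin (1:ℝ) :=
    Lp.indicatorConstLp_compMeasurePreserving (p := 2) (s := Metric.ball (0:V) 1) measurableSet_ball
      (measure_ball_lt_top).ne (1:ℝ) (mp_ac g)
  rw [e]
  unfold fB
  rw [L2.real_inner_indicatorConstLp_one_indicatorConstLp_one hms measurableSet_ball hfin hfin2]
  have pn := nm_pos g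
  have hsub : Metric.ball (0:V) ((2 * nm g)⁻¹) ⊆ (ac g ⁻¹' Metric.ball (0:V) 1) ∩ Metric.ball (0:V) 1 := by
    intro v hv
    rw [mem_ball_zero_iff] at hv
    have h1 : en v ≤ 2 * ‖v‖ := by
      have a := norm_le_pi_norm v 0
      have b := norm_le_pi_norm v 1
      rw [Real.norm_eq_abs] at a b
      unfold en; linarith
    have h2 : ∀ w : V, ‖w‖ ≤ en w := by
      intro w
      rw [pi_norm_le_iff_of_nonneg (en_nonneg w)]
      intro i
      rw [Real.norm_eq_abs]
      have a := abs_nonneg (w 0)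
      have b := abs_nonneg (w 1)
      fin_cases i
      · change |w 0| ≤ en w; unfold en; linarith
      · change |w 1| ≤ en w; unfold en; linarith
    have h3 : 2 * nm g * ‖v‖ < 1 := by
      have := mul_lt_mul_of_pos_left hv (show 0 < 2 * nm g by positivity)
      rwa [mul_inv_cancel₀ (by positivity)] at this
    refine ⟨?_, ?_⟩
    · rw [Set.mem_preimage, mem_ball_zero_iff]
      have h4 := en_ac_le g v
      have h5 := h2 (ac g v)
      nlinarith
    · rw [mem_ball_zero_iff]
      nlinarith [nm_ge_one g, norm_nonneg v]
  have hvol : volume.real (Metric.ball (0:V) ((2 * nm g)⁻¹)) = (nm g)⁻¹ ^ 2 := by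
    rw [Measure.real, Real.volume_pi_ball _ (by positivity), ENNReal.toReal_ofReal (by positivity)]
    simp only [Fintype.card_fin]
    congr 1
    field_simp
  rw [← hvol]
  refine measureReal_mono hsub ?_
  exact ((measure_mono Set.inter_subset_right).trans_lt measure_ball_lt_top).ne

lemma ly_pos_of_gap (hp : Pr p) {ρ : ℝ} (h0 : 0 < ρ) (h1 : ρ < 1)
    (h : ∀ f : HH, ‖Pa p A f‖ ≤ ρ * ‖f‖) : 0 < Ly p A := by
  have hit : ∀ n, ‖(Pa p A)^[n] fB‖ ≤ ρ ^ n * ‖fB‖ := by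
    intro n
    induction n with
    | zero => simp
    | succ n ih =>
      rw [Function.iterate_succ_apply']
      refine (h _).trans ?_
      rw [pow_succ']
      nlinarith
  have hfb : 0 < ‖fB‖ ^ 2 := by
    rw [← real_inner_self_eq_norm_sq]
    have := inner_fB 1
    rw [Us_one] at this
    refine lt_of_lt_of_le ?_ this
    have := nm_pos 1
    positivity
  set K := ‖fB‖ ^ 2 with hK
  have hex : ∀ n, ex p A n (fun g => (nm g)⁻¹ ^ 2) ≤ ρ ^ n * K := by
    intro n
    calc _ ≤ ex p A n (fun g => inner ℝ (Us g fB) fB) := ex_mono hp inner_fB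
      _ = inner ℝ ((Pa p A)^[n] fB) fB := (inner_iter n _ _).symm
      _ ≤ ‖(Pa p A)^[n] fB‖ * ‖fB‖ := real_inner_le_norm _ _
      _ ≤ ρ ^ n * ‖fB‖ * ‖fB‖ := mul_le_mul_of_nonneg_right (hit n) (norm_nonneg _)
      _ = _ := by rw [hK]; ring
  have hlog : ∀ n : ℕ, n * (-Real.log ρ / 2) - Real.log K / 2 ≤ aa p A n := by
    intro n
    have hpos : ∀ g, W A n g → 0 < (nm g)⁻¹ ^ 2 := fun g _ => by
      have := nm_pos g
      positivity
    have a := ex_log_le hp hpos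
    have b := Real.log_le_log (ex_pos hp hpos) (hex n)
    have c : ex p A n (fun g => Real.log ((nm g)⁻¹ ^ 2)) = -2 * aa p A n := by
      unfold aa
      rw [← ex_smul]
      refine ex_congr n fun g => ?_
      rw [Real.log_pow, Real.log_inv]; push_cast; ring
    rw [Real.log_mul (by positivity) hfb.ne', Real.log_pow] at b
    linarith
  have := le_ly_of hp hlog
  have := Real.log_neg h0 h1
  linarith

lemma sq_norm_eq (f : HH) : ∫ v, (f v) ^ 2 = ‖f‖ ^ 2 := by
  rw [← real_inner_self_eq_norm_sq, L2.inner_def]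
  refine integral_congr_ae (Filter.Eventually.of_forall fun v => ?_)
  simp [pow_two]

lemma int_sq (f : HH) : Integrable (fun v => (f v) ^ 2) volume := (Lp.memLp f).integrable_sq

lemma set_change (g : SL2) {E : Set V} (hE : MeasurableSet E) {f : HH} (hf : ‖f‖ = 1) {ε : ℝ} (hε : 0 < ε)
    (h : ‖Us g f - f‖ ≤ ε) :
    |(∫ v in ac g ⁻¹' E, (f v) ^ 2) - ∫ v in E, (f v) ^ 2| ≤ 3 * ε := by
  have hme : MeasurableEmbedding (ac g) :=
    (continuous_ac g).measurableEmbedding (fun u v huv => by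
      rw [← ac_inv g u, huv, ac_inv])
  have e1 : ∫ v in E, (f v) ^ 2 = ∫ v in ac g ⁻¹' E, (Us g f v) ^ 2 := by
    rw [← (mp_ac g).setIntegral_preimage_emb hme]
    refine integral_congr_ae (ae_restrict_of_ae ?_)
    filter_upwards [Us_coe g f] with v hv
    rw [hv]; rfl
  set u := Us g f with hu
  have hun : ‖u‖ = 1 := by rw [hu, LinearIsometry.norm_map, hf]
  rw [e1, ← integral_sub (int_sq f).integrableOn (int_sq u).integrableOn]
  have hF := (continuous_ac g).measurable hE
  have hb : ∀ᵐ v, |(f v) ^ 2 - (u v) ^ 2| ≤ (1/2) * (ε⁻¹ * ((u - f : HH) v) ^ 2 + ε * ((u + f : HH) v) ^ 2) := by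
    filter_upwards [Lp.coeFn_sub u f, Lp.coeFn_add u f] with v h1 h2
    rw [h1, h2, Pi.sub_apply, Pi.add_apply]
    have e3 : (f v) ^ 2 - (u v) ^ 2 = -((u v - f v) * (u v + f v)) := by ring
    rw [e3, abs_neg]
    have h4 : ε⁻¹ * ε = 1 := inv_mul_cancel₀ hε.ne'
    have h5 : 0 < ε⁻¹ := inv_pos.2 hε
    set a := u v - f v
    set b := u v + f v
    have h6 : 0 ≤ ε⁻¹ * (a - ε * b) ^ 2 := by positivity
    have h7 : 0 ≤ ε⁻¹ * (a + ε * b) ^ 2 := by positivity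
    have h8 : ε⁻¹ * (a - ε * b) ^ 2 = ε⁻¹ * a ^ 2 - 2 * (ε⁻¹ * ε) * a * b + (ε⁻¹ * ε) * ε * b ^ 2 := by ring
    have h9 : ε⁻¹ * (a + ε * b) ^ 2 = ε⁻¹ * a ^ 2 + 2 * (ε⁻¹ * ε) * a * b + (ε⁻¹ * ε) * ε * b ^ 2 := by ring
    rw [h4] at h8 h9
    rw [abs_le]; constructor <;> nlinarith
  have hi2 : Integrable (fun v => (1/2) * (ε⁻¹ * ((u - f : HH) v) ^ 2 + ε * ((u + f : HH) v) ^ 2)) volume :=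
    (((int_sq (u - f)).const_mul _).add ((int_sq (u + f)).const_mul _)).const_mul _
  have hi1 : Integrable (fun v => |(f v) ^ 2 - (u v) ^ 2|) volume := ((int_sq f).sub (int_sq u)).abs
  calc _ ≤ ∫ v in ac g ⁻¹' E, |(f v) ^ 2 - (u v) ^ 2| := abs_integral_le_integral_abs
    _ ≤ ∫ v, |(f v) ^ 2 - (u v) ^ 2| := setIntegral_le_integral hi1 (Filter.Eventually.of_forall fun v => abs_nonneg _)
    _ ≤ ∫ v, (1/2) * (ε⁻¹ * ((u - f : HH) v) ^ 2 + ε * ((u + f : HH) v) ^ 2) := integral_mono_ae hi1 hi2 hb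
    _ = (1/2) * (ε⁻¹ * ‖u - f‖ ^ 2 + ε * ‖u + f‖ ^ 2) := by
        rw [integral_const_mul, integral_add ((int_sq (u - f)).const_mul _) ((int_sq (u + f)).const_mul _),
          integral_const_mul, integral_const_mul, sq_norm_eq, sq_norm_eq]
    _ ≤ (1/2) * (ε⁻¹ * ε ^ 2 + ε * 2 ^ 2) := by
        have := norm_add_le u f
        gcongr
        rw [hun, hf] at this; linarith
    _ ≤ 3 * ε := by
        have : ε⁻¹ * ε ^ 2 = ε := by field_simp
        rw [this]; linarith

open Filter in
theorem mean_of_ly_zero (hp : Pr p) {o : ι} (ho : A o = 1) (hL : Ly p A = 0) : ∃ m, Mean A m := by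
  have halm : ∀ ε : ℝ, 0 < ε → ∃ f : HH, ‖f‖ = 1 ∧ ∀ i, ‖Us (A i) f - f‖ ≤ ε := by
    intro ε hε
    by_contra hcon
    push Not at hcon
    obtain ⟨ρ, h0, h1, h⟩ := gap_alt hp ho hε hcon
    exact (ly_pos_of_gap hp h0 h1 h).ne' hL
  choose f hf1 hf2 using fun n : ℕ => halm (1 / ((n:ℝ) + 1)) (by positivity)
  set mn : ℕ → Set V → ℝ := fun n E => ∫ v in E, (f n v) ^ 2 with hmn
  have hsq : ∀ n, ∫ v, (f n v) ^ 2 = 1 := fun n => by rw [sq_norm_eq, hf1]; norm_num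
  have hnn : ∀ n E, 0 ≤ mn n E := fun n E => integral_nonneg fun v => sq_nonneg _
  have hle : ∀ n E, mn n E ≤ 1 := fun n E => by
    rw [← hsq n]
    exact setIntegral_le_integral (int_sq _) (Eventually.of_forall fun v => sq_nonneg _)
  have hlim : ∀ E, ∃ x, Tendsto (fun n => mn n E) (hyperfilter ℕ : Filter ℕ) (nhds x) := by
    intro E
    obtain ⟨x, _, hx⟩ := (isCompact_Icc (a := (0:ℝ)) (b := 1)).ultrafilter_le_nhds
      ((hyperfilter ℕ).map (fun n => mn n E)) (by
        rw [Filter.le_principal_iff]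
        rw [Ultrafilter.coe_map, Filter.mem_map]
        exact Filter.Eventually.of_forall fun n : ℕ => ⟨hnn n E, hle n E⟩)
    exact ⟨x, hx⟩
  choose m hm using hlim
  refine ⟨m, ?_, ?_, ?_, ?_, ?_⟩
  · intro E _
    exact ge_of_tendsto' (hm E) fun n => hnn n E
  · intro E F hE hF hd
    refine tendsto_nhds_unique (hm (E ∪ F)) (((hm E).add (hm F)).congr fun n => ?_)
    simp only [hmn]
    rw [setIntegral_union hd hF.1 (int_sq _).integrableOn (int_sq _).integrableOn]
  · refine tendsto_nhds_unique (hm _) (tendsto_const_nhds.congr fun n => ?_)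
    simp only [hmn]
    rw [setIntegral_univ, hsq]
  · refine tendsto_nhds_unique (hm _) (tendsto_const_nhds.congr fun n => ?_)
    simp only [hmn]
    rw [setIntegral_measure_zero]
    simp
  · intro i E hE
    have h1 := (hm (ac (A i) ⁻¹' E)).sub (hm E)
    have h2 : Tendsto (fun n : ℕ => 3 * (1 / ((n:ℝ) + 1))) (hyperfilter ℕ : Filter ℕ) (nhds (3 * 0)) :=
      (tendsto_one_div_add_atTop_nhds_zero_nat.const_mul 3).mono_left Nat.hyperfilter_le_atTop
    have h3 : Tendsto (fun n => mn n (ac (A i) ⁻¹' E) - mn n E) (hyperfilter ℕ : Filter ℕ) (nhds 0) := by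
      rw [mul_zero] at h2
      refine squeeze_zero_norm (fun n => ?_) h2
      rw [Real.norm_eq_abs]
      exact set_change (A i) hE.1 (hf1 n) (by positivity) (hf2 n i)
    have := tendsto_nhds_unique h1 h3
    linarith

end gap
end TV

namespace TV
open Finset

/-! ### Monomial cocycles -/

/-- monomial matrices -/
def Mono (g : SL2) : Prop := (g 0 1 = 0 ∧ g 1 0 = 0) ∨ (g 0 0 = 0 ∧ g 1 1 = 0)

/-- sign of a monomial matrix -/
def sg (g : SL2) : ℝ := if g 1 0 = 0 then 1 else -1
/-- log size of the first column -/
def lX (g : SL2) : ℝ := Real.log (|g 0 0| + |g 1 0|)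

lemma mono_one : Mono 1 := Or.inl ⟨by simp, by simp⟩

lemma sg_abs (g : SL2) : |sg g| = 1 := by unfold sg; split_ifs <;> simp
lemma sg_sq (g : SL2) : sg g * sg g = 1 := by unfold sg; split_ifs <;> simp

lemma mono_mul {a g : SL2} (ha : Mono a) (hg : Mono g) :
    Mono (a * g) ∧ sg (a * g) = sg a * sg g ∧ lX (a * g) = lX g + sg g * lX a := by
  have da := det2 a
  have dg := det2 g
  unfold Mono sg lX
  simp only [sl_mul]
  rcases ha with ⟨a1, a2⟩ | ⟨a1, a2⟩ <;> rcases hg with ⟨g1, g2⟩ | ⟨g1, g2⟩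
  · have h1 : a 0 0 ≠ 0 := fun h => by rw [h, a1] at da; simp at da
    have h2 : g 0 0 ≠ 0 := fun h => by rw [h, g1] at dg; simp at dg
    refine ⟨Or.inl ⟨by simp [a1, g1], by simp [a2, g2]⟩, by simp [a2, g2], ?_⟩
    simp only [a1, a2, g2, mul_zero, zero_mul, add_zero, abs_zero, if_true, one_mul, abs_mul]
    rw [Real.log_mul (abs_ne_zero.2 h1) (abs_ne_zero.2 h2), add_comm]
  · have h1 : a 0 0 ≠ 0 := fun h => by rw [h, a1] at da; simp at da
    have h2 : g 1 0 ≠ 0 := fun h => by rw [h, g1] at dg; simp at dg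
    have h3 : a 1 1 = (a 0 0)⁻¹ := by
      rw [a1, zero_mul, sub_zero] at da; exact eq_inv_of_mul_eq_one_right da
    have h4 := inv_ne_zero h1
    refine ⟨Or.inr ⟨by simp [a1, g1], by simp [a2, g2]⟩, by simp [a2, g1, h2, h3, h4, h1], ?_⟩
    simp only [a1, a2, g1, mul_zero, zero_mul, zero_add, add_zero, abs_zero, abs_mul, h3, if_neg h2, abs_inv]
    rw [Real.log_mul (inv_ne_zero (abs_ne_zero.2 h1)) (abs_ne_zero.2 h2), Real.log_inv]; ring
  · have h1 : a 1 0 ≠ 0 := fun h => by rw [h, a1] at da; simp at da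
    have h2 : g 0 0 ≠ 0 := fun h => by rw [h, g1] at dg; simp at dg
    refine ⟨Or.inr ⟨by simp [a1, g2], by simp [a2, g1]⟩, by simp [a2, g2, h1, h2], ?_⟩
    simp only [a1, a2, g2, mul_zero, zero_mul, zero_add, add_zero, abs_zero, if_true, one_mul, abs_mul]
    rw [Real.log_mul (abs_ne_zero.2 h1) (abs_ne_zero.2 h2), add_comm]
  · have h1 : a 1 0 ≠ 0 := fun h => by rw [h, a1] at da; simp at da
    have h2 : g 1 0 ≠ 0 := fun h => by rw [h, g1] at dg; simp at dg
    have h3 : a 0 1 = -(a 1 0)⁻¹ := by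
      rw [a1, zero_mul, zero_sub] at da
      rw [← neg_eq_iff_eq_neg]
      refine eq_inv_of_mul_eq_one_left ?_
      linarith
    refine ⟨Or.inl ⟨by simp [a1, g2], by simp [a2, g1]⟩, by simp [a2, g1, h1, h2], ?_⟩
    simp only [a1, a2, g1, mul_zero, zero_mul, zero_add, add_zero, abs_zero, abs_mul, h3, if_neg h2, abs_inv,
      abs_neg]
    rw [Real.log_mul (inv_ne_zero (abs_ne_zero.2 h1)) (abs_ne_zero.2 h2), Real.log_inv]; ring

lemma log_inv_add {a : ℝ} (ha : 0 < a) : Real.log (a + a⁻¹) ≤ Real.log 2 + |Real.log a| := by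
  rw [← Real.log_exp |Real.log a|, ← Real.log_mul two_ne_zero (Real.exp_pos _).ne']
  refine Real.log_le_log (by positivity) ?_
  have h1 : a ≤ Real.exp |Real.log a| := by
    rw [← Real.log_le_iff_le_exp ha]; exact le_abs_self _
  have h2 : a⁻¹ ≤ Real.exp |Real.log a| := by
    rw [← Real.log_le_iff_le_exp (inv_pos.2 ha), Real.log_inv]; exact neg_le_abs _
  linarith

lemma mono_nm {g : SL2} (hg : Mono g) : Real.log (nm g) ≤ Real.log 2 + |lX g| := by
  have dg := det2 g
  unfold nm lX
  rcases hg with ⟨g1, g2⟩ | ⟨g1, g2⟩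
  · have h2 : g 0 0 ≠ 0 := fun h => by rw [h, g1] at dg; simp at dg
    have h3 : g 1 1 = (g 0 0)⁻¹ := by
      rw [g1, zero_mul, sub_zero] at dg; exact eq_inv_of_mul_eq_one_right dg
    rw [g1, g2, h3, abs_zero, add_zero, add_zero, abs_inv]
    exact log_inv_add (abs_pos.2 h2)
  · have h2 : g 1 0 ≠ 0 := fun h => by rw [h, g1] at dg; simp at dg
    have h3 : g 0 1 = -(g 1 0)⁻¹ := by
      rw [g1, zero_mul, zero_sub] at dg
      rw [← neg_eq_iff_eq_neg]
      refine eq_inv_of_mul_eq_one_left ?_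
      linarith
    rw [g1, g2, h3, abs_zero, add_zero, zero_add, zero_add, abs_neg, abs_inv, add_comm]
    exact log_inv_add (abs_pos.2 h2)

section mono
variable {ι : Type*} [Fintype ι] {p : ι → ℝ} {A : ι → SL2}

lemma W_mono (hA : ∀ i, Mono (A i)) {n : ℕ} {g : SL2} (hg : W A n g) : Mono g := by
  induction hg with
  | one => exact mono_one
  | mul i _ ih => exact (mono_mul ih (hA i)).1

theorem mono_sqrt (hp : Pr p) (hA : ∀ i, Mono (A i)) {x : ℝ}
    (hx : ∑ i, p i * lX (A i) = x * (1 - ∑ i, p i * sg (A i))) :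
    ∃ C, ∀ n : ℕ, 1 ≤ n → aa p A n ≤ C * √n := by
  set Y : SL2 → ℝ := fun g => lX g + sg g * x with hY
  set δ : ι → ℝ := fun i => lX (A i) + sg (A i) * x - x with hδ
  have hδ0 : ∑ i, p i * δ i = 0 := by
    have : ∑ i, p i * δ i = ∑ i, p i * lX (A i) + x * ∑ i, p i * sg (A i) - x * ∑ i, p i := by
      rw [mul_sum, mul_sum, ← sum_add_distrib, ← sum_sub_distrib]
      exact sum_congr rfl fun i _ => by simp only [hδ]; ring
    rw [this, hx, hp.sum]; ring
  set D := ∑ i, p i * δ i ^ 2 with hD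
  have hD0 : 0 ≤ D := sum_nonneg fun i _ => mul_nonneg (hp.pos i).le (sq_nonneg _)
  have hstep : ∀ n, ex p A (n+1) (fun g => Y g ^ 2) = ex p A n (fun g => Y g ^ 2) + D := by
    intro n
    rw [ex_succ_last, ← ex_const (A := A) hp n D, ← ex_add']
    refine ex_congr_W n fun g hg => ?_
    have hg' := W_mono hA hg
    have h1 : ∀ i, Y (A i * g) = Y g + sg g * δ i := by
      intro i
      obtain ⟨_, h2, h3⟩ := mono_mul (hA i) hg'
      simp only [hY, hδ, h2, h3]; ring
    calc ∑ i, p i * Y (A i * g) ^ 2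
        = ∑ i, (Y g ^ 2 * p i + 2 * Y g * sg g * (p i * δ i) + (sg g * sg g) * (p i * δ i ^ 2)) :=
          sum_congr rfl fun i _ => by rw [h1]; ring
      _ = _ := by
          rw [sum_add_distrib, sum_add_distrib, ← mul_sum, ← mul_sum, ← mul_sum, hp.sum, hδ0, sg_sq,
            ← hD]; ring
  have hsq : ∀ n : ℕ, ex p A n (fun g => Y g ^ 2) = x ^ 2 + n * D := by
    intro n
    induction n with
    | zero => simp [hY, lX, sg]
    | succ n ih => rw [hstep, ih]; push_cast; ring
  refine ⟨Real.log 2 + |x| + (x ^ 2 + D + 1) / 2, fun n hn => ?_⟩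
  have hn1 : (1:ℝ) ≤ n := by exact_mod_cast hn
  have hs1 : 1 ≤ √n := Real.one_le_sqrt.2 hn1
  have hs0 : 0 < √(n:ℝ) := by linarith
  have hss : √(n:ℝ) * √n = n := Real.mul_self_sqrt (by linarith)
  have hpt : aa p A n ≤ ex p A n (fun g => (Real.log 2 + |x| + √n / 2) + (1 / (2 * √n)) * Y g ^ 2) := by
    refine ex_mono_W hp fun g hg => ?_
    have h1 := mono_nm (W_mono hA hg)
    have h2 : |lX g| ≤ |Y g| + |x| := by
      have : lX g = Y g - sg g * x := by simp only [hY]; ring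
      rw [this]
      refine (abs_sub _ _).trans ?_
      rw [abs_mul, sg_abs, one_mul]
    have h3 : |Y g| ≤ √n / 2 + (1 / (2 * √n)) * Y g ^ 2 := by
      rw [← sq_abs (Y g)]
      set y := |Y g|
      have : √n / 2 + (1 / (2 * √n)) * y ^ 2 - y = (√n - y) ^ 2 / (2 * √n) := by
        field_simp; ring
      have h4 : 0 ≤ (√n - y) ^ 2 / (2 * √n) := by positivity
      linarith
    linarith
  rw [ex_add', ex_smul, ex_const hp, hsq] at hpt
  refine hpt.trans ?_
  have h5 : 1 / (2 * √n) * (x ^ 2 + n * D) ≤ (x ^ 2 + D) / 2 * √n := by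
    rw [div_mul_eq_mul_div, one_mul, div_le_iff₀ (by positivity)]
    have : (x ^ 2 + D) / 2 * √n * (2 * √n) = (x ^ 2 + D) * n := by
      have h7 : (x ^ 2 + D) / 2 * √n * (2 * √n) = (x ^ 2 + D) * (√n * √n) := by ring
      rw [h7, hss]
    rw [this]
    nlinarith [sq_nonneg x]
  have h6 : 0 ≤ Real.log 2 + |x| := add_nonneg (Real.log_nonneg (by norm_num)) (abs_nonneg _)
  nlinarith

lemma sg_diag {g : SL2} (h : g 1 0 = 0) : sg g = 1 := if_pos h

theorem diag_sqrt (hp : Pr p) (hA : ∀ i, (A i) 0 1 = 0 ∧ (A i) 1 0 = 0)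
    (hm : ∑ i, p i * Real.log |(A i) 0 0| = 0) : ∃ C, ∀ n : ℕ, 1 ≤ n → aa p A n ≤ C * √n := by
  refine mono_sqrt hp (fun i => Or.inl (hA i)) (x := 0) ?_
  rw [zero_mul, ← hm]
  exact sum_congr rfl fun i _ => by rw [lX, (hA i).2, abs_zero, add_zero]

lemma aa_sqrt_conj (hp : Pr p) (S : SL2)
    (h : ∃ C, ∀ n : ℕ, 1 ≤ n → aa p (fun i => S * A i * S⁻¹) n ≤ C * √n) :
    ∃ C, ∀ n : ℕ, 1 ≤ n → aa p A n ≤ C * √n := by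
  obtain ⟨C, hC⟩ := h
  refine ⟨C + 2 * Real.log (nm (S⁻¹ : SL2)), fun n hn => ?_⟩
  have h1 := aa_conj hp S⁻¹ (fun i => S * A i * S⁻¹) n
  rw [conj_conj] at h1
  have h2 := hC n hn
  have h3 := log_nm_nonneg S⁻¹
  have hs1 : 1 ≤ √(n:ℝ) := Real.one_le_sqrt.2 (by exact_mod_cast hn)
  have h4 := mul_le_mul_of_nonneg_left hs1 h3
  refine h1.trans ((add_le_add_left h2 _).trans ?_)
  generalize Real.log (nm (S⁻¹ : SL2)) = l at *
  linarith

lemma bdd_sqrt (hp : Pr p) {R : ℝ} (h : ∀ n g, W A n g → nm g ≤ R) :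
    ∃ C, ∀ n : ℕ, 1 ≤ n → aa p A n ≤ C * √n := by
  have hR : 1 ≤ R := (nm_ge_one 1).trans (h 0 1 W.one)
  refine ⟨Real.log R, fun n hn => ?_⟩
  have hs1 : 1 ≤ √(n:ℝ) := Real.one_le_sqrt.2 (by exact_mod_cast hn)
  have h1 : aa p A n ≤ Real.log R := by
    refine le_of_le_of_eq (ex_mono_W hp (ψ := fun _ => Real.log R) fun g hg => ?_) (ex_const hp n _)
    exact Real.log_le_log (nm_pos g) (h n g hg)
  have := Real.log_nonneg hR
  nlinarith

/-- matrix with given columns -/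
def colM (z1 z2 : V) (h : wd z1 z2 = 1) : SL2 :=
  ⟨!![z1 0, z2 0; z1 1, z2 1], by rw [Matrix.det_fin_two_of]; unfold wd at h; linarith⟩

lemma colM00 (z1 z2 : V) (h : wd z1 z2 = 1) : (colM z1 z2 h) 0 0 = z1 0 := rfl
lemma colM01 (z1 z2 : V) (h : wd z1 z2 = 1) : (colM z1 z2 h) 0 1 = z2 0 := rfl
lemma colM10 (z1 z2 : V) (h : wd z1 z2 = 1) : (colM z1 z2 h) 1 0 = z1 1 := rfl
lemma colM11 (z1 z2 : V) (h : wd z1 z2 = 1) : (colM z1 z2 h) 1 1 = z2 1 := rfl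

/-- entries of a conjugate -/
lemma conj_entries (z1 z2 : V) (h : wd z1 z2 = 1) (a : SL2) :
    ((colM z1 z2 h)⁻¹ * a * (colM z1 z2 h)) 0 0 = wd (ac a z1) z2 ∧
    ((colM z1 z2 h)⁻¹ * a * (colM z1 z2 h)) 1 0 = wd z1 (ac a z1) ∧
    ((colM z1 z2 h)⁻¹ * a * (colM z1 z2 h)) 0 1 = wd (ac a z2) z2 ∧
    ((colM z1 z2 h)⁻¹ * a * (colM z1 z2 h)) 1 1 = wd z1 (ac a z2) := by
  refine ⟨?_, ?_, ?_, ?_⟩ <;> simp only [sl_mul, inv00, inv01, inv10, inv11, wd, ac0, ac1,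
    colM00, colM01, colM10, colM11] <;> ring

theorem pair_sqrt (hp : Pr p) {z1 z2 : V} (h12 : wd z1 z2 ≠ 0)
    (h : ∀ i, (wd (ac (A i) z1) z1 = 0 ∧ wd (ac (A i) z2) z2 = 0) ∨
      (wd (ac (A i) z1) z2 = 0 ∧ wd (ac (A i) z2) z1 = 0))
    (hirr : ¬ ∃ z : V, z ≠ 0 ∧ ∀ i, wd (ac (A i) z) z = 0) :
    ∃ C, ∀ n : ℕ, 1 ≤ n → aa p A n ≤ C * √n := by
  set c := (wd z1 z2)⁻¹ with hc
  have hc0 : c ≠ 0 := inv_ne_zero h12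
  have hn : wd (c • z1) z2 = 1 := by rw [wd_smul_left, hc, inv_mul_cancel₀ h12]
  set T := colM (c • z1) z2 hn with hT
  apply aa_sqrt_conj hp T⁻¹
  rw [inv_inv]
  set B : ι → SL2 := fun i => T⁻¹ * A i * T with hB
  have hBm : ∀ i, Mono (B i) := by
    intro i
    obtain ⟨e1, e2, e3, e4⟩ := conj_entries _ _ hn (A i)
    rcases h i with ⟨a, b⟩ | ⟨a, b⟩
    · refine Or.inl ⟨e3.trans b, e2.trans ?_⟩
      rw [ac_smul, wd_smul_left, wd_smul_right, wd_swap, a]; simp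
    · refine Or.inr ⟨e1.trans ?_, e4.trans ?_⟩
      · rw [ac_smul, wd_smul_left, a, mul_zero]
      · rw [wd_smul_left, wd_swap, b]; simp
  have hex : ∃ i, sg (B i) = -1 := by
    by_contra hcon
    push Not at hcon
    refine hirr ⟨z1, by rintro rfl; simp [wd] at h12, fun i => ?_⟩
    obtain ⟨e1, e2, e3, e4⟩ := conj_entries _ _ hn (A i)
    have h1 : (B i) 1 0 = 0 := by
      by_contra hne
      exact hcon i (if_neg hne)
    have h2 := e2.symm.trans h1
    rw [ac_smul, wd_smul_left, wd_smul_right, mul_eq_zero, mul_eq_zero] at h2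
    rw [wd_swap]; simp only [hc0, false_or] at h2; rw [h2, neg_zero]
  obtain ⟨i0, hi0⟩ := hex
  have hlt : ∑ i, p i * sg (B i) < 1 := by
    rw [← hp.sum]
    refine sum_lt_sum (fun i _ => ?_) ⟨i0, mem_univ _, by rw [hi0]; linarith [hp.pos i0]⟩
    have h1 : sg (B i) ≤ 1 := (le_abs_self _).trans (sg_abs _).le
    nlinarith [hp.pos i]
  refine mono_sqrt hp hBm (x := (∑ i, p i * lX (B i)) / (1 - ∑ i, p i * sg (B i))) ?_
  rw [div_mul_cancel₀]
  linarith

end mono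
end TV

namespace TV
open Finset

/-! ### Perturbation of hyperbolic diagonal cocycles -/
section case3
variable {ι : Type*} [Fintype ι] {p : ι → ℝ} {D B : ι → SL2}

/-- Poisson-type inequality controls the exponent. -/
theorem poisson_ly (hp : Pr p) {l : ι → ℝ} {P : V → Prop} {w U : V → ℝ} {F E : ℝ}
    (hP0 : ∀ v, P v → v ≠ 0) (hPB : ∀ v i, P v → P (ac (B i) v)) (hPk : ∀ j, P (vk j))
    (hU : ∀ v, P v → 0 ≤ U v)
    (hell : ∀ v i, P v → |Real.log (en (ac (B i) v) / en v) - l i| ≤ F + w v)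
    (hdr : ∀ v, P v → w v + ∑ i, p i * U (ac (B i) v) ≤ U v + E) :
    |Ly p B - ∑ i, p i * l i| ≤ F + E := by
  set m := ∑ i, p i * l i with hm
  have key : ∀ n : ℕ, ∀ v, P v → |La p B n v - n * m| ≤ n * (F + E) + U v := by
    intro n
    induction n with
    | zero => intro v hv; simpa [La_zero (hP0 v hv)] using hU v hv
    | succ n ih =>
      intro v hv
      have e : La p B (n+1) v - ((n+1 : ℕ) : ℝ) * m = ∑ i, p i *
          ((Real.log (en (ac (B i) v) / en v) - l i) + (La p B n (ac (B i) v) - n * m)) := by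
        rw [La_succ hp (hP0 v hv)]
        have : ((n+1 : ℕ) : ℝ) * m = ∑ i, p i * (l i + n * m) := by
          simp only [mul_add, sum_add_distrib]
          rw [← sum_mul, hp.sum, ← hm]; push_cast; ring
        rw [this, ← sum_sub_distrib]
        exact sum_congr rfl fun i _ => by ring
      rw [e]
      refine (abs_sum_le_sum_abs _ _).trans ?_
      have h1 : ∀ i ∈ univ, |p i * ((Real.log (en (ac (B i) v) / en v) - l i) +
          (La p B n (ac (B i) v) - n * m))| ≤
          p i * (F + w v + n * (F + E)) + p i * U (ac (B i) v) := by
        intro i _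
        rw [abs_mul, abs_of_pos (hp.pos i), ← mul_add]
        refine mul_le_mul_of_nonneg_left ?_ (hp.pos i).le
        refine (abs_add_le _ _).trans ?_
        linarith [hell v i hv, ih _ (hPB v i hv)]
      refine (sum_le_sum h1).trans ?_
      rw [sum_add_distrib, ← sum_mul, hp.sum]
      push_cast
      linarith [hdr v hv]
  have h1 : Ly p B ≤ m + (F + E) := vl_up' hp (C := fun j => U (vk j)) fun j n => by
    have := (abs_le.1 (key n _ (hPk j))).2
    linarith
  have h2 : m - (F + E) ≤ Ly p B := vl_low hp (v := vk 0) (C := U (vk 0)) (vk_ne 0) fun n => by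
    have := (abs_le.1 (key n _ (hPk 0))).1
    linarith
  rw [abs_le]; constructor <;> linarith

lemma exists_s (hp : Pr p) {l : ι → ℝ} (hl : ∑ i, p i * l i < 0) :
    ∃ s : ℝ, 0 < s ∧ s ≤ 1 ∧ ∑ i, p i * Real.exp (s * l i) < 1 := by
  set X := 1 + ∑ i, |l i| with hX
  have hX1 : 1 ≤ X := by
    have := sum_nonneg (s := univ) fun i (_ : i ∈ univ) => abs_nonneg (l i)
    linarith
  have hlX : ∀ i, |l i| ≤ X := fun i => by
    have := single_le_sum (s := univ) (f := fun i => |l i|) (fun i _ => abs_nonneg _) (mem_univ i)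
    linarith
  set q := - ∑ i, p i * l i with hq
  have hq0 : 0 < q := by linarith
  set s := min (1 / X) (q / (2 * X ^ 2)) with hs
  have hs0 : 0 < s := by positivity
  have hs1 : s * X ≤ 1 := by
    have : s ≤ 1 / X := min_le_left _ _
    rwa [le_div_iff₀ (by linarith)] at this
  have hs2 : s * (2 * X ^ 2) ≤ q := by
    have : s ≤ q / (2 * X ^ 2) := min_le_right _ _
    rwa [le_div_iff₀ (by positivity)] at this
  refine ⟨s, hs0, by nlinarith, ?_⟩
  have h1 : ∀ i ∈ univ, p i * Real.exp (s * l i) ≤ p i * (1 + (s * X) ^ 2) + s * (p i * l i) := by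
    intro i _
    have hb : |s * l i| ≤ s * X := by rw [abs_mul, abs_of_pos hs0]; gcongr; exact hlX i
    have h2 := (abs_le.1 (Real.abs_exp_sub_one_sub_id_le (hb.trans hs1))).2
    have h3 : (s * l i) ^ 2 ≤ (s * X) ^ 2 := sq_le_sq' (abs_le.1 hb).1 (abs_le.1 hb).2
    have := hp.pos i
    have h4 : Real.exp (s * l i) ≤ 1 + (s * X) ^ 2 + s * l i := by linarith
    nlinarith
  refine (sum_le_sum h1).trans_lt ?_
  rw [sum_add_distrib, ← sum_mul, hp.sum, ← mul_sum]
  nlinarith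

/-- slope function -/
def rr (b d : ℝ) (v : V) : ℝ := (|v 1| + d * |v 0|) / (|v 0| + b * |v 1|)

lemma rr_nonneg {b d : ℝ} (hb : 0 ≤ b) (hd : 0 ≤ d) (v : V) : 0 ≤ rr b d v := by
  unfold rr; positivity

set_option maxHeartbeats 800000 in
lemma drift_r {a b d M t η σ : ℝ} (g : SL2) (v : V) (ha0 : a ≠ 0) (ha : |a| ≤ M) (ha' : |a|⁻¹ ≤ M)
    (hM : 2 ≤ M) (hb : 0 ≤ b) (hbd : b ≤ d) (hd1 : d ≤ 1) (hη : 0 ≤ η)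
    (h00 : |g 0 0 - a| ≤ d) (h01 : |g 0 1| ≤ b) (h10 : |g 1 0| ≤ d) (h11 : |g 1 1 - a⁻¹| ≤ d)
    (hσ : 2 * M * (d + η) ≤ σ) (hσ2 : σ ≤ 1/2) (ht : 1 + σ ≤ t * (1 - σ))
    (hv : v 0 ≠ 0) (hvη : b * |v 1| ≤ η * |v 0|) :
    rr b d (ac g v) ≤ t * (|a| ^ 2)⁻¹ * rr b d v + 4 * M ^ 2 * d := by
  have hA : 0 < |a| := abs_pos.2 ha0
  have hx : 0 < |v 0| := abs_pos.2 hv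
  have hy : 0 ≤ |v 1| := abs_nonneg _
  have hd : 0 ≤ d := hb.trans hbd
  set x := |v 0|
  set y := |v 1|
  set A := |a|
  have hA1 : 1 ≤ A * M := by
    rw [inv_le_iff_one_le_mul₀ hA] at ha'; linarith
  have hg11 : |g 1 1| ≤ A⁻¹ + d := by
    have := abs_add_le (g 1 1 - a⁻¹) a⁻¹
    rw [sub_add_cancel, abs_inv] at this
    linarith
  have hg00 : |g 0 0| ≤ A + d := by
    have := abs_add_le (g 0 0 - a) a
    rw [sub_add_cancel] at this
    linarith
  have hg00' : A - d ≤ |g 0 0| := by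
    have := abs_sub_abs_le_abs_sub a (g 0 0)
    rw [abs_sub_comm] at h00
    linarith
  have hX' : |ac g v 0| ≤ (A + d) * x + b * y := by
    rw [ac0]; refine (abs_add_le _ _).trans ?_
    rw [abs_mul, abs_mul]
    gcongr
  have hX'' : A * (1 - σ) * (x + b * y) ≤ |ac g v 0| := by
    have h1 : |g 0 0| * x - b * y ≤ |ac g v 0| := by
      rw [ac0]
      have := abs_sub_abs_le_abs_sub (g 0 0 * v 0) (-(g 0 1 * v 1))
      rw [sub_neg_eq_add, abs_neg, abs_mul, abs_mul] at this
      have h2 : |g 0 1| * |v 1| ≤ b * y := by gcongr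
      linarith
    have h2 : (A - d) * x ≤ |g 0 0| * x := by gcongr
    have h3 : (A - d - η) * x ≤ |ac g v 0| := by linarith
    have h4 : x + b * y ≤ (1 + η) * x := by linarith
    have h5 : A * (1 - σ) * (x + b * y) ≤ A * (1 - σ) * ((1 + η) * x) :=
      mul_le_mul_of_nonneg_left h4 (mul_nonneg hA.le (by linarith))
    have h6 : A * (1 - σ) * (1 + η) ≤ A - d - η := by
      -- A (1-σ)(1+η) ≤ A (1 - σ + η) ≤ A - M A(d+η)
      have e0 : 0 ≤ d + η := by linarith
      have e1 : d + η ≤ A * (M * (d + η)) := by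
        have := mul_le_mul_of_nonneg_right hA1 e0
        linarith
      have e2 : η ≤ M * (d + η) := by
        have := mul_le_mul_of_nonneg_right (by linarith : 1 ≤ M) e0
        linarith
      have e3 : 0 ≤ σ * η := mul_nonneg (by linarith) hη
      have e4 : (1 - σ) * (1 + η) ≤ 1 - M * (d + η) := by linarith
      have e5 := mul_le_mul_of_nonneg_left e4 hA.le
      linarith
    have h7 := mul_le_mul_of_nonneg_right h6 hx.le
    linarith
  have hY' : |ac g v 1| ≤ d * x + (A⁻¹ + d) * y := by
    rw [ac1]; refine (abs_add_le _ _).trans ?_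
    rw [abs_mul, abs_mul]
    gcongr
  have hs : 0 < x + b * y := by positivity
  have hden : 0 < A * (1 - σ) * (x + b * y) := mul_pos (mul_pos hA (by linarith)) hs
  have hnum : |ac g v 1| + d * |ac g v 0| ≤ A⁻¹ * (1 + σ) * y + 2 * M * d * x := by
    have e1 : d * |ac g v 0| ≤ d * ((A + d) * x + b * y) := by gcongr
    have e2 : d * b ≤ d := mul_le_of_le_one_right hd (hbd.trans hd1)
    have e3 : 2 * d ≤ A⁻¹ * σ := by
      have i1 : 2 * M * d ≤ σ := by
        have : 0 ≤ M * η := mul_nonneg (by linarith) hη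
        linarith
      have i2 : 1 ≤ A⁻¹ * M := by rw [inv_mul_eq_div, le_div_iff₀ hA]; linarith
      have i3 : 0 ≤ A⁻¹ := by positivity
      have i4 := mul_le_mul_of_nonneg_left i1 i3
      have i5 := mul_le_mul_of_nonneg_left i2 (by linarith : 0 ≤ 2 * d)
      linarith
    have e4 : d * (1 + A + d) ≤ d * (2 * M) := by gcongr; linarith
    have e5 := mul_le_mul_of_nonneg_right e4 hx.le
    have e6 := mul_le_mul_of_nonneg_right (by linarith : d + d * b ≤ A⁻¹ * σ) hy
    linarith
  unfold rr
  rw [div_le_iff₀ (lt_of_lt_of_le hden (hX''.trans (by have := mul_nonneg hb (abs_nonneg (ac g v 1)); linarith)))]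
  have hbig : A * (1 - σ) * (x + b * y) ≤ |ac g v 0| + b * |ac g v 1| :=
    hX''.trans (by have := mul_nonneg hb (abs_nonneg (ac g v 1)); linarith)
  refine hnum.trans ?_
  have ht0 : 0 ≤ t := by
    by_contra h; push Not at h
    nlinarith
  have hc0 : 0 ≤ t * (A ^ 2)⁻¹ * ((y + d * x) / (x + b * y)) + 4 * M ^ 2 * d := by positivity
  refine le_trans ?_ (mul_le_mul_of_nonneg_left hbig hc0)
  have e : (t * (A ^ 2)⁻¹ * ((y + d * x) / (x + b * y)) + 4 * M ^ 2 * d) * (A * (1 - σ) * (x + b * y)) =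
      A⁻¹ * (t * (1 - σ)) * (y + d * x) + 4 * M ^ 2 * d * (A * (1 - σ) * (x + b * y)) := by
    field_simp
  rw [e]
  have e1 : A⁻¹ * (1 + σ) * y ≤ A⁻¹ * (t * (1 - σ)) * (y + d * x) := by
    have : y ≤ y + d * x := by have := mul_nonneg hd hx.le; linarith
    have i0 : 0 ≤ t * (1 - σ) := mul_nonneg ht0 (by linarith)
    gcongr
  have e2 : 2 * M * d * x ≤ 4 * M ^ 2 * d * (A * (1 - σ) * (x + b * y)) := by
    have j1 : x ≤ x + b * y := by have := mul_nonneg hb hy; linarith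
    have j2 : 2 * M * d * x ≤ 2 * M * d * (x + b * y) := by gcongr
    have j3 : 1 ≤ 2 * M * (A * (1 - σ)) := by
      have := mul_le_mul_of_nonneg_left (by linarith : 1/2 ≤ 1 - σ) (by linarith : 0 ≤ A * M)
      linarith
    have j4 : 0 ≤ 2 * M * d * (x + b * y) := by positivity
    have j5 := mul_le_mul_of_nonneg_right j3 j4
    linarith
  linarith

lemma ell_diag {g : SL2} (v : V) {M : ℝ} (hg : g 0 1 = 0 ∧ g 1 0 = 0) (hM : nm g ≤ M) (hv : v 0 ≠ 0) :
    |Real.log (en (ac g v) / en v) - Real.log (|g 0 0|)| ≤ M ^ 2 * (|v 1| / |v 0|) := by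
  have hM1 : 1 ≤ M := (nm_ge_one g).trans hM
  have dg := det2 g
  rw [hg.1, zero_mul, sub_zero] at dg
  have ha0 : g 0 0 ≠ 0 := fun h => by rw [h] at dg; simp at dg
  have hA : 0 < |g 0 0| := abs_pos.2 ha0
  have hx : 0 < |v 0| := abs_pos.2 hv
  have hy : 0 ≤ |v 1| := abs_nonneg _
  have hdd : |g 0 0| * |g 1 1| = 1 := by rw [← abs_mul, dg, abs_one]
  have hd : |g 1 1| ≤ M := by
    unfold nm at hM
    linarith [abs_nonneg (g 0 0), abs_nonneg (g 0 1), abs_nonneg (g 1 0)]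
  have e1 : en (ac g v) = |g 0 0| * |v 0| + |g 1 1| * |v 1| := by
    unfold en; rw [ac0, ac1, hg.1, hg.2, zero_mul, zero_mul, add_zero, zero_add, abs_mul, abs_mul]
  have e2 : en v = |v 0| + |v 1| := rfl
  rw [e1, e2]
  set A := |g 0 0|
  set A' := |g 1 1|
  set x := |v 0|
  set y := |v 1|
  have hA' : 0 ≤ A' := abs_nonneg _
  have hpos : 0 < A * x + A' * y := by positivity
  rw [Real.log_div hpos.ne' (by positivity)]
  have h1 := log_le_div (x := A * x + A' * y) (y := A * (x + y)) hpos (by positivity)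
  have h2 := log_le_div (y := A * x + A' * y) (x := A * (x + y)) (by positivity) hpos
  rw [Real.log_mul hA.ne' (by positivity)] at h1 h2
  have b1 : (A * x + A' * y - A * (x + y)) / (A * (x + y)) ≤ M ^ 2 * (y / x) := by
    rw [div_le_iff₀ (by positivity)]
    have : M ^ 2 * (y / x) * (A * (x + y)) = M ^ 2 * A * y + M ^ 2 * A * y * (y / x) := by
      field_simp
    rw [this]
    have i1 : A' ≤ M ^ 2 * A := by
      have : A' * 1 = A' * A' * A := by rw [← hdd]; ring
      nlinarith [mul_le_mul hd hd hA' (by linarith)]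
    have i2 : 0 ≤ M ^ 2 * A * y * (y / x) := by positivity
    nlinarith
  have b2 : (A * (x + y) - (A * x + A' * y)) / (A * x + A' * y) ≤ M ^ 2 * (y / x) := by
    rw [div_le_iff₀ (by positivity)]
    have : M ^ 2 * (y / x) * (A * x + A' * y) = M ^ 2 * A * y + M ^ 2 * A' * y * (y / x) := by
      field_simp
    rw [this]
    have i2 : 0 ≤ M ^ 2 * A' * y * (y / x) := by positivity
    have i3 : A * y ≤ M ^ 2 * (A * y) := by
      have : 1 ≤ M ^ 2 := by nlinarith
      nlinarith [mul_nonneg hA.le hy]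
    nlinarith [mul_nonneg hA' hy]
  rw [abs_le]; constructor <;> linarith

end case3
end TV

namespace TV
open Finset

section case3b
variable {ι : Type*} [Fintype ι] {p : ι → ℝ} {D B : ι → SL2}

/-- Poisson inequality from an `N`-step drift. -/
theorem poisson_N (hp : Pr p) {l : ι → ℝ} {P : V → Prop} {w : V → ℝ} {F E C c : ℝ} {N : ℕ}
    (hc : 0 < c) (hC : 0 ≤ C)
    (hP0 : ∀ v, P v → v ≠ 0) (hPB : ∀ v i, P v → P (ac (B i) v)) (hPk : ∀ j, P (vk j))
    (hw : ∀ v, 0 ≤ w v)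
    (hell : ∀ v i, P v → |Real.log (en (ac (B i) v) / en v) - l i| ≤ F + C * w v)
    (hdr : ∀ v, P v → ex p B N (fun g => w (ac g v)) ≤ (1 - c) * w v + E) :
    |Ly p B - ∑ i, p i * l i| ≤ F + C / c * E := by
  set U : V → ℝ := fun v => C / c * ∑ j ∈ range N, ex p B j (fun g => w (ac g v)) with hU
  refine poisson_ly (w := fun v => C * w v) (U := U) hp hP0 hPB hPk (fun v _ => ?_) hell fun v hv => ?_
  · refine mul_nonneg (by positivity) (sum_nonneg fun j _ => ex_nonneg hp fun g _ => hw _)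
  · have h1 : ∑ i, p i * U (ac (B i) v) =
        C / c * ∑ j ∈ range N, ex p B (j+1) (fun g => w (ac g v)) := by
      simp only [hU, ex_succ, ac_mul]
      rw [sum_comm, mul_sum]
      refine sum_congr rfl fun i _ => ?_
      rw [← mul_sum]; ring
    have h2 : ∑ j ∈ range N, ex p B (j+1) (fun g => w (ac g v)) =
        ∑ j ∈ range N, ex p B j (fun g => w (ac g v)) + ex p B N (fun g => w (ac g v)) - w v := by
      have := sum_range_succ' (fun j => ex p B j (fun g => w (ac g v))) N
      rw [sum_range_succ] at this
      simp only [ex_zero, ac_one] at this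
      linarith
    rw [h1, h2]
    have h3 := mul_le_mul_of_nonneg_left (hdr v hv) (by positivity : 0 ≤ C / c)
    have h4 : C / c * ((1 - c) * w v + E) = C / c * w v - C * w v + C / c * E := by
      field_simp
    simp only [hU]
    rw [h4] at h3
    linarith

lemma ex_iter (hp : Pr p) {P : V → Prop} {w : V → ℝ} {E : ℝ}
    (hPB : ∀ v i, P v → P (ac (B i) v))
    (h : ∀ v, P v → ∑ i, p i * w (ac (B i) v) ≤ w v + E) (n : ℕ) :
    ∀ v, P v → ex p B n (fun g => w (ac g v)) ≤ w v + n * E := by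
  induction n with
  | zero => intro v _; simp
  | succ n ih =>
    intro v hv
    rw [ex_succ]
    simp only [ac_mul]
    have h1 : ∀ i ∈ univ, p i * ex p B n (fun g => w (ac g (ac (B i) v))) ≤
        p i * w (ac (B i) v) + p i * (n * E) := fun i _ => by
      rw [← mul_add]
      exact mul_le_mul_of_nonneg_left (ih _ (hPB v i hv)) (hp.pos i).le
    refine (sum_le_sum h1).trans ?_
    rw [sum_add_distrib, ← sum_mul, hp.sum]
    push_cast
    linarith [h v hv]

lemma ex_iter' (hp : Pr p) {P : V → Prop} {w : V → ℝ} {E X : ℝ}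
    (hPB : ∀ v i, P v → P (ac (B i) v))
    (h : ∀ v, P v → ∑ i, p i * w (ac (B i) v) ≤ w v + E) (n : ℕ) {v : V} (hv : P v)
    (h' : ∑ i, p i * w (ac (B i) v) ≤ X) :
    ex p B (n+1) (fun g => w (ac g v)) ≤ X + n * E := by
  rw [ex_succ]
  simp only [ac_mul]
  have h1 : ∀ i ∈ univ, p i * ex p B n (fun g => w (ac g (ac (B i) v))) ≤
      p i * w (ac (B i) v) + p i * (n * E) := fun i _ => by
    rw [← mul_add]
    exact mul_le_mul_of_nonneg_left (ex_iter hp hPB h n _ (hPB v i hv)) (hp.pos i).le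
  refine (sum_le_sum h1).trans ?_
  rw [sum_add_distrib, ← sum_mul, hp.sum]
  linarith

lemma escape_iter {i1 : ι} {d lam R : ℝ} (hlam : 1 < lam) (hd : 0 ≤ d) (hR : 0 ≤ R)
    (h01 : (B i1) 0 1 = 0) (h00 : lam ≤ |(B i1) 0 0|) (h11 : |(B i1) 1 1| ≤ 1)
    (h10 : |(B i1) 1 0| ≤ d) {u : V} (hu : u 0 ≠ 0) (huR : |u 1| ≤ R * |u 0|) (k : ℕ) :
    ∃ g, W B k g ∧ (ac g u) 0 ≠ 0 ∧ |(ac g u) 1| ≤ (lam⁻¹ ^ k * R + k * d) * |(ac g u) 0| := by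
  induction k with
  | zero => exact ⟨1, W.one, by simpa using hu, by simpa using huR⟩
  | succ k ih =>
    obtain ⟨g, hg, h0, h1⟩ := ih
    refine ⟨B i1 * g, W.cons i1 hg, ?_, ?_⟩
    · rw [ac_mul, ac0, h01, zero_mul, add_zero]
      refine mul_ne_zero (fun h => ?_) h0
      rw [h, abs_zero] at h00; linarith
    · rw [ac_mul]
      set z := ac g u
      rw [ac0, ac1, h01, zero_mul, add_zero, abs_mul]
      have hx : 0 < |z 0| := abs_pos.2 h0
      have a1 : |(B i1) 1 0 * z 0 + (B i1) 1 1 * z 1| ≤ d * |z 0| + 1 * |z 1| := by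
        refine (abs_add_le _ _).trans ?_
        rw [abs_mul, abs_mul]
        gcongr
      set S := lam⁻¹ ^ k * R + k * d with hS
      have hS0 : 0 ≤ S := by positivity
      have a2 : |(B i1) 1 0 * z 0 + (B i1) 1 1 * z 1| ≤ (S + d) * |z 0| := by linarith
      refine a2.trans ?_
      have a3 : |z 0| ≤ lam⁻¹ * (|(B i1) 0 0| * |z 0|) := by
        rw [← mul_assoc]
        refine le_mul_of_one_le_left hx.le ?_
        rw [inv_mul_eq_div, le_div_iff₀ (by linarith)]; linarith
      have a4 := mul_le_mul_of_nonneg_left a3 (by linarith : 0 ≤ S + d)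
      refine a4.trans ?_
      rw [← mul_assoc]
      refine mul_le_mul_of_nonneg_right ?_ (by positivity)
      have hl0 : 0 < lam⁻¹ := by positivity
      have hl1 : lam⁻¹ ≤ 1 := inv_le_one_of_one_le₀ hlam.le
      rw [hS, pow_succ]; push_cast
      have b1 : k * d * lam⁻¹ ≤ k * d := mul_le_of_le_one_right (by positivity) hl1
      have b2 : d * lam⁻¹ ≤ d := mul_le_of_le_one_right (by positivity) hl1
      linarith

lemma escape {i1 j : ι} {b d lam M : ℝ} (hlam : 1 < lam) (hb : 0 < b) (hbd : b ≤ d) (hd1 : d ≤ 1)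
    (hM : 1 ≤ M) (h01 : (B i1) 0 1 = 0) (h00 : lam ≤ |(B i1) 0 0|) (h11 : |(B i1) 1 1| ≤ 1)
    (h10 : ∀ i, |(B i) 1 0| ≤ d) (hj : |(B j) 0 1| = b) (hj0 : |(B j) 0 0| ≤ M) (hj1 : |(B j) 1 1| ≤ M)
    {u : V} (hu : u ≠ 0) (k : ℕ) :
    ∃ g, W B (k+1) g ∧ (ac g u) 0 ≠ 0 ∧
      |(ac g u) 1| ≤ (lam⁻¹ ^ k * (4 * M / b) + (k + 1) * d) * |(ac g u) 0| := by
  have hd : 0 ≤ d := hb.le.trans hbd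
  have hl0 : 0 < lam⁻¹ := by positivity
  have hl1 : lam⁻¹ ≤ 1 := inv_le_one_of_one_le₀ hlam.le
  have hR : 0 ≤ 4 * M / b := by positivity
  by_cases hc : b * |u 1| ≤ 4 * M * |u 0|
  · have hu0 : u 0 ≠ 0 := by
      intro h
      rw [h, abs_zero, mul_zero] at hc
      have h1 : |u 1| = 0 := by
        have := abs_nonneg (u 1)
        by_contra hne
        have : 0 < |u 1| := lt_of_le_of_ne this (Ne.symm hne)
        nlinarith
      apply hu
      ext i; fin_cases i
      · exact h
      · exact abs_eq_zero.1 h1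
    have huR : |u 1| ≤ 4 * M / b * |u 0| := by
      rw [div_mul_eq_mul_div, le_div_iff₀ hb]; linarith
    obtain ⟨g, hg, g0, g1⟩ := escape_iter hlam hd hR h01 h00 h11 (h10 i1) hu0 huR (k+1)
    refine ⟨g, hg, g0, g1.trans ?_⟩
    push_cast
    have : lam⁻¹ ^ (k+1) ≤ lam⁻¹ ^ k := pow_le_pow_of_le_one hl0.le hl1 (by omega)
    gcongr
  · push Not at hc
    have hy : 0 < |u 1| := by
      by_contra h
      have h2 := abs_nonneg (u 1)
      have h3 := abs_nonneg (u 0)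
      have : |u 1| = 0 := by linarith
      rw [this] at hc
      nlinarith
    have hx := abs_nonneg (u 0)
    set z := ac (B j) u with hz
    have z0 : b * |u 1| / 2 ≤ |z 0| := by
      rw [hz, ac0]
      have := abs_sub_abs_le_abs_sub ((B j) 0 1 * u 1) (-((B j) 0 0 * u 0))
      rw [sub_neg_eq_add, abs_neg, abs_mul, abs_mul, hj, add_comm] at this
      have h2 : |(B j) 0 0| * |u 0| ≤ M * |u 0| := by gcongr
      have := mul_nonneg (by linarith : 0 ≤ M) hx
      linarith
    have z1 : |z 1| ≤ 2 * M * |u 1| := by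
      rw [hz, ac1]
      refine (abs_add_le _ _).trans ?_
      rw [abs_mul, abs_mul]
      have h2 : |(B j) 1 1| * |u 1| ≤ M * |u 1| := by gcongr
      have h3 : |(B j) 1 0| * |u 0| ≤ 1 * |u 0| := by gcongr; exact (h10 j).trans hd1
      have h4 : |u 0| ≤ M * |u 1| := by
        have h5 : |u 0| ≤ M * |u 0| := le_mul_of_one_le_left hx hM
        have h6 : b * |u 1| ≤ M * |u 1| := by gcongr; linarith
        linarith
      linarith
    have z0' : z 0 ≠ 0 := by
      intro h
      rw [h, abs_zero] at z0
      have := mul_pos hb hy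
      linarith
    have zR : |z 1| ≤ 4 * M / b * |z 0| := by
      rw [div_mul_eq_mul_div, le_div_iff₀ hb]
      have h1 := mul_le_mul_of_nonneg_right z1 hb.le
      have h2 := mul_le_mul_of_nonneg_left z0 (by linarith : 0 ≤ 4 * M)
      linarith
    obtain ⟨g, hg, g0, g1⟩ := escape_iter hlam hd hR h01 h00 h11 (h10 i1) z0' zR k
    refine ⟨g * B j, W.mul j hg, ?_, ?_⟩
    · rw [ac_mul]; exact g0
    · rw [ac_mul]
      refine g1.trans ?_
      gcongr
      linarith

lemma nm_entry {X : Mat2} {d : ℝ} (h : nm X ≤ d) (i j : Fin 2) : |X i j| ≤ d := by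
  unfold nm at h
  have h1 := abs_nonneg (X 0 0)
  have h2 := abs_nonneg (X 0 1)
  have h3 := abs_nonneg (X 1 0)
  have h4 := abs_nonneg (X 1 1)
  fin_cases i <;> fin_cases j <;> simp only [Fin.zero_eta, Fin.mk_one, Fin.isValue] <;> linarith

lemma Cl.entry {d : ℝ} (h : Cl D B d) (k : ι) (i j : Fin 2) : |(B k) i j - (D k) i j| ≤ d := by
  rw [abs_sub_comm]
  exact nm_entry (h k) i j

lemma rr_small {b d M s C : ℝ} {g : SL2} {v : V} (hb : 0 ≤ b) (hb1 : b ≤ 1) (hd : 0 ≤ d) (hs : 0 < s) (hs1 : s ≤ 1)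
    (hg : g 0 1 = 0 ∧ g 1 0 = 0) (hM : nm g ≤ M) (hv : v ≠ 0) (hv' : 0 < |v 0| + b * |v 1|) {T : ℝ} (hT : 1 ≤ T)
    (hC : 2 * M ^ 2 + 4 * M ≤ C) :
    |Real.log (en (ac g v) / en v) - Real.log (|g 0 0|)| ≤ C * (min (rr b d v) T) ^ s := by
  have hM1 : 1 ≤ M := (nm_ge_one g).trans hM
  have hr0 := rr_nonneg hb hd v
  rcases le_or_gt (rr b d v) (1/2) with h | h
  · have hmin : min (rr b d v) T = rr b d v := min_eq_left (by linarith)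
    rw [hmin]
    set r := rr b d v with hr
    have h1 : |v 1| + d * |v 0| = r * (|v 0| + b * |v 1|) := by
      rw [hr, rr, div_mul_cancel₀ _ hv'.ne']
    have hy := abs_nonneg (v 1)
    have hx := abs_nonneg (v 0)
    have h2 : r * (b * |v 1|) ≤ 1/2 * (1 * |v 1|) := by gcongr
    have h3 : |v 1| ≤ 2 * r * |v 0| := by
      have := mul_nonneg hd hx
      linarith
    have hv0 : v 0 ≠ 0 := by
      intro h0
      rw [h0, abs_zero, mul_zero] at h3
      apply hv
      ext i; fin_cases i
      · exact h0
      · exact abs_eq_zero.1 (le_antisymm h3 hy)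
    refine (ell_diag v hg hM hv0).trans ?_
    have h4 : |v 1| / |v 0| ≤ 2 * r := by rw [div_le_iff₀ (abs_pos.2 hv0)]; exact h3
    have h5 : r ≤ r ^ s := by
      rcases hr0.eq_or_lt with h0 | h0
      · rw [← h0, Real.zero_rpow hs.ne']
      · have := Real.rpow_le_rpow_of_exponent_ge h0 (by linarith) hs1
        rwa [Real.rpow_one] at this
    calc M ^ 2 * (|v 1| / |v 0|) ≤ M ^ 2 * (2 * r ^ s) := by gcongr; linarith
      _ = 2 * M ^ 2 * r ^ s := by ring
      _ ≤ C * r ^ s := by gcongr; linarith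
  · have h1 : 1/2 ≤ (min (rr b d v) T) ^ s := by
      have h2 : (1/2 : ℝ) ≤ min (rr b d v) T := le_min h.le (by linarith)
      have h3 := Real.rpow_le_rpow (by norm_num) h2 hs.le
      have h4 := Real.rpow_le_rpow_of_exponent_ge (by norm_num : (0:ℝ) < 1/2) (by norm_num) hs1
      rw [Real.rpow_one] at h4
      linarith
    have dg := det2 g
    rw [hg.1, zero_mul, sub_zero] at dg
    have ha0 : g 0 0 ≠ 0 := fun h => by rw [h] at dg; simp at dg
    have hdd : |g 0 0| * |g 1 1| = 1 := by rw [← abs_mul, dg, abs_one]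
    have l1 : |Real.log (en (ac g v) / en v)| ≤ M := by
      have hlM : Real.log M ≤ M := (Real.log_le_sub_one_of_pos (by linarith)).trans (by linarith)
      refine le_trans ?_ hlM
      have p0 := en_pos hv
      have p1 := en_pos (ac_ne g hv)
      rw [abs_le]
      constructor
      · rw [neg_le, ← Real.log_inv]
        refine Real.log_le_log (by positivity) ?_
        rw [inv_div, div_le_iff₀ p1]
        exact (en_le_ac g v).trans (by gcongr)
      · refine Real.log_le_log (by positivity) ?_
        rw [div_le_iff₀ p0]
        exact (en_ac_le g v).trans (by gcongr)
    have l2 : |Real.log (|g 0 0|)| ≤ M := by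
      have hlM : Real.log M ≤ M := (Real.log_le_sub_one_of_pos (by linarith)).trans (by linarith)
      refine le_trans ?_ hlM
      have p0 : 0 < |g 0 0| := abs_pos.2 ha0
      have e : (|g 0 0|)⁻¹ = |g 1 1| := inv_eq_of_mul_eq_one_right hdd
      rw [abs_le]
      constructor
      · rw [neg_le, ← Real.log_inv, e]
        refine Real.log_le_log (by rw [← e]; positivity) (nm_entry hM 1 1)
      · exact Real.log_le_log p0 (nm_entry hM 0 0)
    refine (abs_sub _ _).trans ?_
    have h5 : C * (1/2) ≤ C * (min (rr b d v) T) ^ s := by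
      have : 0 ≤ C := by nlinarith
      gcongr
    have : 0 ≤ M ^ 2 := sq_nonneg M
    linarith

end case3b
end TV

namespace TV
open Finset

section case3c
variable {ι : Type*} [Fintype ι] {p : ι → ℝ} {D B : ι → SL2}

/-- one step drift below the cap -/
lemma drift_pow (hp : Pr p) {b d M t η σ s : ℝ} {v : V}
    (hD : ∀ i, (D i) 0 1 = 0 ∧ (D i) 1 0 = 0) (hMD : ∀ i, nm (D i) ≤ M)
    (hM : 2 ≤ M) (hb : 0 ≤ b) (hbd : b ≤ d) (hd1 : d ≤ 1) (hη : 0 ≤ η)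
    (hcl : Cl D B d) (h01 : ∀ i, |(B i) 0 1| ≤ b) (ht0 : 0 < t)
    (hσ : 2 * M * (d + η) ≤ σ) (hσ2 : σ ≤ 1/2) (ht : 1 + σ ≤ t * (1 - σ))
    (hs : 0 < s) (hs1 : s ≤ 1)
    (hv : v 0 ≠ 0) (hvη : b * |v 1| ≤ η * |v 0|) :
    ∑ i, p i * rr b d (ac (B i) v) ^ s ≤
      (∑ i, p i * Real.exp (s * (Real.log t - 2 * Real.log (|(D i) 0 0|)))) * rr b d v ^ s +
        (4 * M ^ 2) ^ s * d ^ s := by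
  have hd : 0 ≤ d := hb.trans hbd
  have h1 : ∀ i ∈ univ, p i * rr b d (ac (B i) v) ^ s ≤
      p i * Real.exp (s * (Real.log t - 2 * Real.log (|(D i) 0 0|))) * rr b d v ^ s +
        p i * ((4 * M ^ 2) ^ s * d ^ s) := by
    intro i _
    rw [mul_assoc, ← mul_add]
    refine mul_le_mul_of_nonneg_left ?_ (hp.pos i).le
    have dg := det2 (D i)
    rw [(hD i).1, zero_mul, sub_zero] at dg
    have ha0 : (D i) 0 0 ≠ 0 := fun h => by rw [h] at dg; simp at dg
    have e : ((D i) 0 0)⁻¹ = (D i) 1 1 := inv_eq_of_mul_eq_one_right dg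
    have hA : 0 < |(D i) 0 0| := abs_pos.2 ha0
    have c01 := hcl.entry i 0 1
    have c10 := hcl.entry i 1 0
    have c11 := hcl.entry i 1 1
    rw [(hD i).2, sub_zero] at c10
    rw [← e] at c11
    have key := drift_r (B i) v ha0 (nm_entry (hMD i) 0 0)
      (by rw [← abs_inv, e]; exact nm_entry (hMD i) 1 1) hM hb hbd hd1 hη (hcl.entry i 0 0) (h01 i)
      c10 c11 hσ hσ2 ht hv hvη
    have r0 := rr_nonneg hb hd v
    have r1 := rr_nonneg hb hd (ac (B i) v)
    refine (Real.rpow_le_rpow r1 key hs.le).trans ?_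
    refine (Real.rpow_add_le_add_rpow (by positivity) (by positivity) hs.le hs1).trans ?_
    rw [Real.mul_rpow (by positivity) r0, Real.mul_rpow (by positivity) hd]
    have e2 : (t * (|(D i) 0 0| ^ 2)⁻¹) ^ s =
        Real.exp (s * (Real.log t - 2 * Real.log (|(D i) 0 0|))) := by
      rw [Real.rpow_def_of_pos (by positivity), Real.log_mul ht0.ne' (by positivity), Real.log_inv,
        Real.log_pow]
      congr 1; push_cast; ring
    rw [e2]
  refine (sum_le_sum h1).trans ?_
  rw [sum_add_distrib, ← sum_mul, ← sum_mul, hp.sum, one_mul]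

set_option maxHeartbeats 1000000 in
theorem case3_core (hp : Pr p) (hD : ∀ i, (D i) 0 1 = 0 ∧ (D i) 1 0 = 0)
    (hm : 0 < ∑ i, p i * Real.log (|(D i) 0 0|)) {i1 : ι} (hi1 : 1 < |(D i1) 0 0|) :
    ∃ ε C s : ℝ, 0 < ε ∧ 0 < C ∧ 0 < s ∧ s ≤ 1 ∧ ∀ (B : ι → SL2) (d : ℝ), 0 < d → d < ε → Cl D B d →
      (B i1) 0 1 = 0 → |Ly p B - ∑ i, p i * Real.log (|(D i) 0 0|)| ≤ C * d ^ s := by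
  classical
  obtain ⟨M, hM, hMD⟩ := exists_nm_bound D
  set m := ∑ i, p i * Real.log (|(D i) 0 0|) with hmdef
  set t := Real.exp m with ht
  have ht1 : 1 < t := by rw [ht]; exact Real.one_lt_exp_iff.2 hm
  have hlt : Real.log t = m := Real.log_exp m
  obtain ⟨s, hs, hs1, hρ⟩ := exists_s hp (l := fun i => Real.log t - 2 * Real.log (|(D i) 0 0|)) (by
    simp only [mul_sub, sum_sub_distrib, ← sum_mul, hp.sum, one_mul]
    have : ∑ i, p i * (2 * Real.log (|(D i) 0 0|)) = 2 * m := by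
      rw [hmdef, mul_sum]; exact sum_congr rfl fun i _ => by ring
    rw [this, hlt]; linarith)
  set ρ := ∑ i, p i * Real.exp (s * (Real.log t - 2 * Real.log (|(D i) 0 0|))) with hρdef
  set σ := min (1/2) ((t - 1) / (t + 1)) with hσ
  have hσ0 : 0 < σ := lt_min (by norm_num) (div_pos (by linarith) (by linarith))
  have hσ2 : σ ≤ 1/2 := min_le_left _ _
  have htσ : 1 + σ ≤ t * (1 - σ) := by
    have : σ ≤ (t - 1) / (t + 1) := min_le_right _ _
    rw [le_div_iff₀ (by linarith)] at this
    linarith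
  set η := σ / (4 * M) with hη
  have hη0 : 0 < η := by positivity
  set K := 1 + 1 / η with hK
  have hK1 : 1 ≤ K := by rw [hK]; have : 0 < 1 / η := by positivity
                         linarith
  set lam := (1 + |(D i1) 0 0|) / 2 with hlam
  have hlam1 : 1 < lam := by rw [hlam]; linarith
  have hli0 : 0 < lam⁻¹ := by positivity
  obtain ⟨k, hk⟩ := exists_pow_lt_of_lt_one (by positivity : 0 < 1 / (16 * (M + 1) * K))
    (inv_lt_one_of_one_lt₀ hlam1)
  have hne := hp.nonempty
  obtain ⟨i2, hi2⟩ := Finite.exists_min p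
  set π := p i2 with hπ
  have hπ0 : 0 < π := hp.pos i2
  have hπ1 : π ≤ 1 := by
    rw [← hp.sum]; exact single_le_sum (f := p) (fun i _ => (hp.pos i).le) (mem_univ i2)
  set h2s := (1/2 : ℝ) ^ s with hh2s
  have h2s1 : h2s < 1 := Real.rpow_lt_one (by norm_num) (by norm_num) hs
  have h2s0 : 0 < h2s := Real.rpow_pos_of_pos (by norm_num) s
  set c := min (1 - ρ) (π ^ (k+1) * (1 - h2s)) with hc
  have hc0 : 0 < c := lt_min (by linarith) (mul_pos (by positivity) (by linarith))
  have hcρ : ρ ≤ 1 - c := by have : c ≤ 1 - ρ := min_le_left _ _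
                             linarith
  have hcπ : 1 - π ^ (k+1) * (1 - h2s) ≤ 1 - c := by
    have : c ≤ π ^ (k+1) * (1 - h2s) := min_le_right _ _
    linarith
  set C1 := (4 * M ^ 2) ^ s with hC1
  have hC10 : 0 < C1 := by positivity
  set C2 := 2 * M ^ 2 + 4 * M with hC2
  have hC20 : 0 < C2 := by positivity
  have ha1inv : (|(D i1) 0 0|)⁻¹ < 1 := inv_lt_one_of_one_lt₀ hi1
  set ε := min (min 1 (σ / (4 * M))) (min (min ((|(D i1) 0 0| - 1) / 2) (1 - (|(D i1) 0 0|)⁻¹))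
    (1 / (4 * K * (k + 2)))) with hε
  have hε0 : 0 < ε := by
    refine lt_min (lt_min one_pos (by positivity)) (lt_min (lt_min ?_ ?_) (by positivity))
    · linarith
    · linarith
  refine ⟨ε, (M + 1) + C2 / c * ((k + 1) * C1), s, hε0, by positivity, hs, hs1,
    fun B d hd hdε hcl hB1 => ?_⟩
  have hdm := lt_min_iff.1 hdε
  have hd1 : d ≤ 1 := (lt_min_iff.1 hdm.1).1.le
  have hdσ : d ≤ σ / (4 * M) := (lt_min_iff.1 hdm.1).2.le
  have hdm2 := lt_min_iff.1 hdm.2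
  have hda : d ≤ (|(D i1) 0 0| - 1) / 2 := (lt_min_iff.1 hdm2.1).1.le
  have hda' : d ≤ 1 - (|(D i1) 0 0|)⁻¹ := (lt_min_iff.1 hdm2.1).2.le
  have hdK : d ≤ 1 / (4 * K * (k + 2)) := hdm2.2.le
  have hσ' : 2 * M * (d + η) ≤ σ := by
    have h1 : d + η ≤ σ / (2 * M) := by
      have : σ / (2 * M) = σ / (4 * M) + σ / (4 * M) := by field_simp; ring
      rw [this]; linarith
    rw [le_div_iff₀ (by positivity)] at h1; linarith
  obtain ⟨j, hj⟩ := Finite.exists_max (fun i => |(B i) 0 1|)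
  set b := |(B j) 0 1| with hb
  have hb0 : 0 ≤ b := abs_nonneg _
  have hbd : b ≤ d := by
    have := hcl.entry j 0 1
    rw [(hD j).1, sub_zero] at this
    exact this
  have hBM : ∀ i, nm (B i) ≤ M + 1 := fun i => hcl.bound hMD hd1 i
  have hdds : d ≤ d ^ s := by
    have := Real.rpow_le_rpow_of_exponent_ge hd hd1 hs1
    rwa [Real.rpow_one] at this
  -- the local estimate
  have hell : ∀ v i (T : ℝ), v ≠ 0 → 0 < |v 0| + b * |v 1| → 1 ≤ T →
      |Real.log (en (ac (B i) v) / en v) - Real.log (|(D i) 0 0|)| ≤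
      (M + 1) * d + C2 * (min (rr b d v) T) ^ s := by
    intro v i T hv hv' hT
    have h1 := ell_close (d := d) ((hMD i).trans (by linarith : M ≤ M + 1)) (hBM i)
      (by rw [nm_sub_comm]; exact hcl i) hv
    have h2 := rr_small (d := d) hb0 (hbd.trans hd1) hd.le hs hs1 (hD i) (hMD i) hv hv' hT hC2.symm.le
    have e : ∀ x y z : ℝ, x - z = (x - y) + (y - z) := fun x y z => by ring
    rw [e _ (Real.log (en (ac (D i) v) / en v)) _]
    refine (abs_add_le _ _).trans ?_
    linarith
  have hdrift : ∀ v : V, v 0 ≠ 0 → b * |v 1| ≤ η * |v 0| →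
      ∑ i, p i * rr b d (ac (B i) v) ^ s ≤ ρ * rr b d v ^ s + C1 * d ^ s := fun v hv hv' =>
    drift_pow hp hD hMD hM hb0 hbd hd1 hη0.le hcl hj (by linarith) hσ' hσ2 htσ hs hs1 hv hv'
  have hrr0 := rr_nonneg hb0 hd.le
  have hfin : ∀ N : ℕ, N ≤ k + 1 → (M + 1) * d + C2 / c * (N * (C1 * d ^ s)) ≤
      ((M + 1) + C2 / c * ((k + 1) * C1)) * d ^ s := by
    intro N hN
    have hN' : (N:ℝ) ≤ k + 1 := by exact_mod_cast hN
    have h1 : (N:ℝ) * (C1 * d ^ s) ≤ (k + 1) * (C1 * d ^ s) := by gcongr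
    have h2 : C2 / c * (N * (C1 * d ^ s)) ≤ C2 / c * ((k + 1) * (C1 * d ^ s)) := by gcongr
    have h3 : (M + 1) * d ≤ (M + 1) * d ^ s := by gcongr
    linarith
  rcases hb0.eq_or_lt with hbz | hbpos
  · -- triangular case
    have hBz : ∀ i, (B i) 0 1 = 0 := fun i => by
      have := hj i
      rw [← hbz] at this
      exact abs_eq_zero.1 (le_antisymm this (abs_nonneg _))
    have hpos : ∀ v : V, v 0 ≠ 0 → 0 < |v 0| + b * |v 1| := fun v hv => by
      rw [← hbz, zero_mul, add_zero]; exact abs_pos.2 hv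
    have hv0 : ∀ v : V, v 0 ≠ 0 → v ≠ 0 := fun v hv h => hv (by rw [h]; rfl)
    refine (poisson_N hp (P := fun v => v 0 ≠ 0) (w := fun v => rr b d v ^ s) (N := 1)
      (F := (M + 1) * d) (E := ((1:ℕ):ℝ) * (C1 * d ^ s)) (C := C2) hc0 hC20.le hv0 (fun v i hv => ?_) (fun j => ?_)
      (fun v => Real.rpow_nonneg (hrr0 v) s) (fun v i hv => ?_) (fun v hv => ?_)).trans (hfin 1 (by omega))
    · change ac (B i) v 0 ≠ 0
      rw [ac0, hBz i, zero_mul, add_zero]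
      refine mul_ne_zero (fun h => ?_) hv
      have dg := det2 (B i)
      rw [h, hBz i] at dg; simp at dg
    · simp [vk]
    · have := hell v i (max 1 (rr b d v)) (hv0 v hv) (hpos v hv) (le_max_left _ _)
      rwa [min_eq_left (le_max_right _ _)] at this
    · have h1 := hdrift v hv (by rw [← hbz, zero_mul]; positivity)
      rw [ex_succ]
      simp only [ex_zero, ac_mul, ac_one]
      refine h1.trans ?_
      push_cast
      have := mul_le_mul_of_nonneg_right hcρ (Real.rpow_nonneg (hrr0 v) s)
      linarith
  · -- main case
    set T := 1 / (K * b) with hT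
    have hT0 : 0 < T := by positivity
    have hKd : d * (4 * K * (k + 2)) ≤ 1 := by
      rwa [le_div_iff₀ (by positivity)] at hdK
    have hk0 : (0:ℝ) ≤ k := Nat.cast_nonneg k
    have hKd1 : K * d * (k + 2) ≤ 1 / 4 := by linarith
    have hKd0 : 0 ≤ K * d := by positivity
    have hT1 : 1 ≤ T := by
      rw [hT, le_div_iff₀ (by positivity), one_mul]
      have : K * b ≤ K * d := by gcongr
      nlinarith
    set w : V → ℝ := fun v => (min (rr b d v) T) ^ s with hw
    have hmin0 : ∀ v, 0 ≤ min (rr b d v) T := fun v => le_min (hrr0 v) hT0.le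
    have hw0 : ∀ v, 0 ≤ w v := fun v => Real.rpow_nonneg (hmin0 v) s
    have hwT : ∀ v, w v ≤ T ^ s := fun v => Real.rpow_le_rpow (hmin0 v) (min_le_right _ _) hs.le
    have hwr : ∀ v, w v ≤ rr b d v ^ s := fun v => Real.rpow_le_rpow (hmin0 v) (min_le_left _ _) hs.le
    have hpos : ∀ v : V, v ≠ 0 → 0 < |v 0| + b * |v 1| := fun v hv => by
      have h1 := en_pos hv
      unfold en at h1
      have h2 : b * |v 0| ≤ |v 0| := mul_le_of_le_one_left (abs_nonneg _) (hbd.trans hd1)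
      have h3 := mul_pos hbpos h1
      linarith
    have hds0 : 0 ≤ C1 * d ^ s := by positivity
    -- below the cap
    have hbelow : ∀ v : V, v ≠ 0 → rr b d v < T → ∑ i, p i * w (ac (B i) v) ≤ ρ * w v + C1 * d ^ s := by
      intro v hv hlt
      have e : w v = rr b d v ^ s := by simp only [hw]; rw [min_eq_left hlt.le]
      have hX := hpos v hv
      have h1 : (|v 1| + d * |v 0|) * (K * b) < |v 0| + b * |v 1| := by
        unfold rr at hlt
        rw [hT, div_lt_div_iff₀ hX (by positivity)] at hlt
        linarith
      have h2 : b * |v 1| < η * |v 0| := by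
        have h3 : |v 1| * (K * b) ≤ (|v 1| + d * |v 0|) * (K * b) := by
          have := mul_nonneg hd.le (abs_nonneg (v 0))
          gcongr; linarith
        have h4 : 1 / η * (b * |v 1|) < |v 0| := by
          rw [hK] at h1 h3
          have : |v 1| * ((1 + 1 / η) * b) = b * |v 1| + 1 / η * (b * |v 1|) := by ring
          linarith
        rw [one_div, inv_mul_lt_iff₀ hη0] at h4
        exact h4
      have hv0 : v 0 ≠ 0 := by
        intro h
        rw [h, abs_zero, mul_zero] at h2
        have := mul_nonneg hb0 (abs_nonneg (v 1))
        linarith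
      rw [e]
      refine le_trans (sum_le_sum fun i _ => ?_) (hdrift v hv0 h2.le)
      exact mul_le_mul_of_nonneg_left (hwr _) (hp.pos i).le
    have hone : ∀ v : V, v ≠ 0 → ∑ i, p i * w (ac (B i) v) ≤ w v + C1 * d ^ s := by
      intro v hv
      rcases lt_or_ge (rr b d v) T with h | h
      · refine (hbelow v hv h).trans ?_
        have : ρ * w v ≤ 1 * w v := mul_le_mul_of_nonneg_right hρ.le (hw0 v)
        linarith
      · have e : w v = T ^ s := by simp only [hw]; rw [min_eq_right h]
        have h1 : ∑ i, p i * w (ac (B i) v) ≤ ∑ i, p i * T ^ s :=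
          sum_le_sum fun i _ => mul_le_mul_of_nonneg_left (hwT _) (hp.pos i).le
        rw [← sum_mul, hp.sum, one_mul] at h1
        linarith
    have hesc : ∀ v : V, v ≠ 0 → ∃ g, W B (k+1) g ∧ w (ac g v) ≤ h2s * T ^ s := by
      intro v hv
      have c00 := hcl.entry i1 0 0
      have c11 := hcl.entry i1 1 1
      have dg := det2 (D i1)
      rw [(hD i1).1, zero_mul, sub_zero] at dg
      have e11 : (D i1) 1 1 = ((D i1) 0 0)⁻¹ := (inv_eq_of_mul_eq_one_right dg).symm
      have g00 : lam ≤ |(B i1) 0 0| := by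
        have := abs_sub_abs_le_abs_sub ((D i1) 0 0) ((B i1) 0 0)
        rw [abs_sub_comm] at c00
        rw [hlam]; linarith
      have g11 : |(B i1) 1 1| ≤ 1 := by
        have := abs_sub_abs_le_abs_sub ((B i1) 1 1) ((D i1) 1 1)
        rw [e11, abs_inv] at this
        rw [e11] at c11
        linarith
      obtain ⟨g, hg, g0, g1⟩ := escape (u := v) hlam1 hbpos hbd hd1 (by linarith : 1 ≤ M + 1) hB1 g00 g11
        (fun i => by have := hcl.entry i 1 0; rwa [(hD i).2, sub_zero] at this) hb.symm
        (nm_entry (hBM j) 0 0) (nm_entry (hBM j) 1 1) hv k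
      refine ⟨g, hg, ?_⟩
      set z := ac g v
      have hz : 0 < |z 0| := abs_pos.2 g0
      set S := lam⁻¹ ^ k * (4 * (M + 1) / b) + (k + 1) * d with hS
      have hS0 : 0 ≤ S := by positivity
      have r1 : rr b d z ≤ S + d := by
        unfold rr
        rw [div_le_iff₀ (by positivity)]
        have : 0 ≤ (S + d) * (b * |z 1|) := by positivity
        linarith
      have r2 : S + d ≤ 1/2 * T := by
        have q1 : lam⁻¹ ^ k * (4 * (M + 1) / b) ≤ 1 / 4 * T := by
          have : 1 / (16 * (M + 1) * K) * (4 * (M + 1) / b) = 1 / 4 * T := by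
            rw [hT]; field_simp; norm_num
          rw [← this]
          gcongr
        have q2 : (k + 2) * d ≤ 1 / 4 * T := by
          rw [hT, ← mul_div_assoc, mul_one, le_div_iff₀ (by positivity)]
          have : (k + 2) * d * (K * b) ≤ (k + 2) * d * (K * 1) := by
            gcongr; exact hbd.trans hd1
          linarith
        rw [hS]; linarith
      have h3 : min (rr b d z) T ≤ 1/2 * T := (min_le_left _ _).trans (r1.trans r2)
      have h4 := Real.rpow_le_rpow (hmin0 z) h3 hs.le
      rwa [Real.mul_rpow (by norm_num) hT0.le] at h4
    refine (poisson_N hp (P := fun v => v ≠ 0) (w := w) (N := k+1)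
      (F := (M + 1) * d) (E := ((k+1:ℕ):ℝ) * (C1 * d ^ s)) (C := C2) hc0 hC20.le (fun v hv => hv)
      (fun v i hv => ac_ne _ hv) vk_ne
      hw0 (fun v i hv => hell v i T hv (hpos v hv) hT1) (fun v hv => ?_)).trans (hfin (k+1) le_rfl)
    rcases lt_or_ge (rr b d v) T with h | h
    · refine (ex_iter' hp (P := fun v => v ≠ 0) (fun v i hv => ac_ne _ hv) hone k hv (hbelow v hv h)).trans ?_
      have := mul_le_mul_of_nonneg_right hcρ (hw0 v)
      push_cast
      linarith
    · have e : w v = T ^ s := by simp only [hw]; rw [min_eq_right h]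
      obtain ⟨g, hg, hgw⟩ := hesc v hv
      have h1 := ex_weight (φ := fun g => w (ac g v)) (c := T ^ s) hp hi2 hπ0.le (fun g _ => hwT _) hg
      refine h1.trans ?_
      rw [e]
      have hTs : 0 ≤ T ^ s := Real.rpow_nonneg hT0.le s
      have h2 := mul_le_mul_of_nonneg_right hcπ hTs
      have h3 : π ^ (k+1) * (T ^ s - h2s * T ^ s) ≤ π ^ (k+1) * (T ^ s - w (ac g v)) := by
        gcongr
      have h4 : 0 ≤ ((k+1:ℕ):ℝ) * (C1 * d ^ s) := by positivity
      linarith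

end case3c
end TV

namespace TV
open Finset

section case3
variable {ι : Type*} [Fintype ι] {p : ι → ℝ} {D B : ι → SL2}

lemma quad_root_pos {γ e β c d : ℝ} (hc : 0 < c) (hd : 0 ≤ d) (hdc : 2 * d ≤ c) (hγ : |γ| ≤ d)
    (hβ : |β| ≤ d) (he : c ≤ e) : ∃ x : ℝ, |x| ≤ 2 * d / c ∧ γ * x ^ 2 + e * x - β = 0 := by
  set r := 2 * d / c with hr
  have hr0 : 0 ≤ r := by positivity
  have hr1 : r ≤ 1 := by rw [hr, div_le_one hc]; exact hdc
  have hcr : c * r = 2 * d := by rw [hr]; field_simp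
  have her : 2 * d ≤ e * r := by rw [← hcr]; exact mul_le_mul_of_nonneg_right he hr0
  have hr2 : r ^ 2 ≤ 1 := pow_le_one₀ hr0 hr1
  have hg : |γ * r ^ 2| ≤ d := by
    rw [abs_mul, abs_of_nonneg (sq_nonneg r)]
    calc |γ| * r ^ 2 ≤ |γ| * 1 := mul_le_mul_of_nonneg_left hr2 (abs_nonneg _)
      _ ≤ d := by linarith
  have hg' := abs_le.1 hg
  have hb' := abs_le.1 hβ
  have hcont : ContinuousOn (fun x : ℝ => γ * x ^ 2 + e * x - β) (Set.Icc (-r) r) := by fun_prop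
  have hiv := intermediate_value_Icc (by linarith : -r ≤ r) hcont
  obtain ⟨x, hx, hx0⟩ := hiv (show (0:ℝ) ∈ Set.Icc _ _ from ⟨by
    have : (-r) ^ 2 = r ^ 2 := by ring
    simp only [this]; linarith, by linarith⟩)
  exact ⟨x, abs_le.2 ⟨hx.1, hx.2⟩, hx0⟩

lemma quad_root {γ e β c d : ℝ} (hc : 0 < c) (hd : 0 ≤ d) (hdc : 2 * d ≤ c) (hγ : |γ| ≤ d)
    (hβ : |β| ≤ d) (he : c ≤ |e|) : ∃ x : ℝ, |x| ≤ 2 * d / c ∧ γ * x ^ 2 + e * x - β = 0 := by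
  rcases abs_cases e with ⟨h, _⟩ | ⟨h, _⟩
  · exact quad_root_pos hc hd hdc hγ hβ (h ▸ he)
  · obtain ⟨x, hx, h0⟩ := quad_root_pos (γ := -γ) (e := -e) (β := -β) hc hd hdc (by rwa [abs_neg])
      (by rwa [abs_neg]) (h ▸ he)
    exact ⟨x, hx, by linarith⟩

/-- Hölder estimate of exponents near `D` against a value. -/
def DH (p : ι → ℝ) (D : ι → SL2) (m : ℝ) : Prop := ∃ ε C θ : ℝ, 0 < ε ∧ 0 < C ∧ 0 < θ ∧
  ∀ (B : ι → SL2) (d : ℝ), 0 < d → d < ε → Cl D B d → |Ly p B - m| ≤ C * d ^ θ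

lemma case3_pos (hp : Pr p) (hD : ∀ i, (D i) 0 1 = 0 ∧ (D i) 1 0 = 0)
    (hm : 0 < ∑ i, p i * Real.log (|(D i) 0 0|)) :
    DH p D (∑ i, p i * Real.log (|(D i) 0 0|)) := by
  obtain ⟨i1, hi1⟩ : ∃ i, 1 < |(D i) 0 0| := by
    by_contra hcon
    push Not at hcon
    refine absurd hm (not_lt.2 (sum_nonpos fun i _ => ?_))
    exact mul_nonpos_of_nonneg_of_nonpos (hp.pos i).le
      (Real.log_nonpos (abs_nonneg _) (hcon i))
  obtain ⟨ε, C, s, hε, hC, hs, hs1, H⟩ := case3_core hp hD hm hi1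
  obtain ⟨M, hM, hMD⟩ := exists_nm_bound D
  have hdet := det2 (D i1)
  rw [(hD i1).1, zero_mul, sub_zero] at hdet
  set a := (D i1) 0 0 with ha
  set a' := (D i1) 1 1 with ha'
  have hab : |a| * |a'| = 1 := by rw [← abs_mul, hdet, abs_one]
  have ha1 : |a'| < 1 := by
    by_contra hcon
    push Not at hcon
    have := mul_le_mul_of_nonneg_left hcon (abs_nonneg a)
    linarith
  set c := (|a| - |a'|) / 2 with hc
  have hc0 : 0 < c := by rw [hc]; linarith
  have hc2 : 2 * c ≤ |a' - a| := by
    rw [abs_sub_comm]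
    have := abs_sub_abs_le_abs_sub a a'
    rw [hc]; linarith
  set K := 2 / c with hK
  have hK0 : 0 < K := by positivity
  set C' := 10 + 2 * (M + 1) * K with hC'
  have hC'0 : 0 < C' := by positivity
  refine ⟨min (min 1 (c / 2)) (ε / C'), C * C' ^ s, s, by positivity, by positivity, hs,
    fun B d hd hdε hcl => ?_⟩
  have hd1 : d ≤ 1 := (hdε.trans_le ((min_le_left _ _).trans (min_le_left _ _))).le
  have hdc : d ≤ c / 2 := (hdε.trans_le ((min_le_left _ _).trans (min_le_right _ _))).le
  have hdε' : C' * d < ε := by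
    have := hdε.trans_le (min_le_right _ _)
    rw [lt_div_iff₀ hC'0] at this; linarith
  have hBM : ∀ i, nm (B i) ≤ M + 1 := fun i => hcl.bound hMD hd1 i
  have e01 : ∀ i, |(B i) 0 1| ≤ d := fun i => by
    have := hcl.entry i 0 1; rwa [(hD i).1, sub_zero] at this
  have e10 : ∀ i, |(B i) 1 0| ≤ d := fun i => by
    have := hcl.entry i 1 0; rwa [(hD i).2, sub_zero] at this
  obtain ⟨x, hx, hx0⟩ := quad_root (γ := (B i1) 1 0) (e := (B i1) 1 1 - (B i1) 0 0)
    (β := (B i1) 0 1) hc0 hd.le (by linarith) (e10 i1) (e01 i1) (by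
      have h1 := abs_le.1 (hcl.entry i1 0 0)
      have h2 := abs_le.1 (hcl.entry i1 1 1)
      rw [← ha] at h1
      rw [← ha'] at h2
      rcases abs_cases (a' - a) with ⟨h, _⟩ | ⟨h, _⟩ <;> rw [h] at hc2
      · exact le_trans (by linarith) (le_abs_self _)
      · exact le_trans (by linarith) (neg_le_abs _))
  have hxK : |x| ≤ K * d := by rw [hK]; convert hx using 1; ring
  have hx1 : |x| ≤ 1 := hx.trans (by rw [div_le_one hc0]; linarith)
  have hT : wd ![1, 0] ![x, 1] = 1 := by simp [wd]
  set T := colM ![1, 0] ![x, 1] hT with hTdef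
  have hcon := ly_conj hp T⁻¹ B
  rw [inv_inv] at hcon
  rw [← hcon]
  have hent := fun i => conj_entries _ _ hT (B i)
  simp only [wd, ac0, ac1, Matrix.cons_val_zero, Matrix.cons_val_one, mul_one, mul_zero, add_zero,
    one_mul, zero_mul, sub_zero] at hent
  have hfin := H (fun i => T⁻¹ * B i * T) (C' * d) (by positivity) hdε' (by
    intro i
    obtain ⟨h00, h10, h01, h11⟩ := hent i
    unfold nm
    simp only [Matrix.sub_apply]
    rw [h00, h10, h01, h11, (hD i).1, (hD i).2]
    have b00 := nm_entry (hBM i) 0 0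
    have b11 := nm_entry (hBM i) 1 1
    have c00 := hcl.entry i 0 0
    have c11 := hcl.entry i 1 1
    have gx : |(B i) 1 0 * x| ≤ d := by
      rw [abs_mul]
      have := mul_le_mul (e10 i) hx1 (abs_nonneg _) hd.le
      linarith
    have gx2 : |(B i) 1 0 * x * x| ≤ d := by
      rw [abs_mul]
      have := mul_le_mul gx hx1 (abs_nonneg _) hd.le
      linarith
    have ax : |(B i) 0 0 * x| ≤ (M + 1) * (K * d) := by
      rw [abs_mul]; exact mul_le_mul b00 hxK (abs_nonneg _) (by linarith)
    have dx : |(B i) 1 1 * x| ≤ (M + 1) * (K * d) := by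
      rw [abs_mul]; exact mul_le_mul b11 hxK (abs_nonneg _) (by linarith)
    have f1 := e01 i
    have f2 := e10 i
    rw [abs_le] at gx gx2 ax dx f1 f2 c00 c11
    have t1 : |(D i) 0 0 - ((B i) 0 0 - (B i) 1 0 * x)| ≤ 2 * d := by
      rw [abs_le]; constructor <;> linarith [gx.1, gx.2, c00.1, c00.2]
    have t2 : |0 - ((((B i) 0 0 * x + (B i) 0 1)) - ((B i) 1 0 * x + (B i) 1 1) * x)| ≤
        2 * d + 2 * ((M + 1) * (K * d)) := by
      rw [abs_le]; constructor <;> linarith [gx2.1, gx2.2, f1.1, f1.2, ax.1, ax.2, dx.1, dx.2]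
    have t3 : |0 - (B i) 1 0| ≤ d := by
      rw [abs_le]; constructor <;> linarith [f2.1, f2.2]
    have t4 : |(D i) 1 1 - ((B i) 1 0 * x + (B i) 1 1)| ≤ 2 * d := by
      rw [abs_le]; constructor <;> linarith [gx.1, gx.2, c11.1, c11.2]
    have : C' * d = 10 * d + 2 * ((M + 1) * (K * d)) := by rw [hC']; ring
    rw [this]
    linarith) (by
      rw [(hent i1).2.2.1]; linarith)
  refine hfin.trans_eq ?_
  rw [Real.mul_rpow hC'0.le hd.le]; ring

lemma DH.of_conj {m : ℝ} (hp : Pr p) (S : SL2) (h : DH p (fun i => S * D i * S⁻¹) m) : DH p D m := by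
  obtain ⟨ε, C, θ, hε, hC, hθ, H⟩ := h
  have hS : 0 < nm S := nm_pos S
  refine ⟨ε / nm S ^ 2, C * (nm S ^ 2) ^ θ, θ, by positivity, by positivity, hθ,
    fun B d hd hdε hcl => ?_⟩
  rw [lt_div_iff₀ (by positivity)] at hdε
  have := H _ (nm S ^ 2 * d) (by positivity) (by linarith) (hcl.conj S)
  rw [ly_conj hp] at this
  refine this.trans_eq ?_
  rw [Real.mul_rpow (by positivity) hd.le]; ring

lemma diag_inv {g : SL2} (h : g 0 1 = 0 ∧ g 1 0 = 0) :
    Real.log (|g 1 1|) = - Real.log (|g 0 0|) := by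
  have := det2 g
  rw [h.1, zero_mul, sub_zero] at this
  rw [← Real.log_inv, ← abs_inv, ← eq_inv_of_mul_eq_one_right this]

/-- Case III. -/
lemma case3 (hp : Pr p) (hD : ∀ i, (D i) 0 1 = 0 ∧ (D i) 1 0 = 0)
    (hm : ∑ i, p i * Real.log (|(D i) 0 0|) ≠ 0) : ∃ m, DH p D m := by
  rcases lt_or_gt_of_ne hm with h | h
  · have hT : wd ![0, 1] ![-1, 0] = 1 := by simp [wd]
    set T := colM ![0, 1] ![-1, 0] hT with hTdef
    have hent := fun i => conj_entries _ _ hT (D i)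
    simp only [wd, ac0, ac1, Matrix.cons_val_zero, Matrix.cons_val_one, mul_one, mul_zero, add_zero,
      one_mul, zero_mul, zero_add, mul_neg, neg_zero, zero_sub, neg_neg] at hent
    have hD' : ∀ i, (T⁻¹ * D i * T) 0 1 = 0 ∧ (T⁻¹ * D i * T) 1 0 = 0 := fun i => by
      constructor
      · rw [(hent i).2.2.1, (hD i).2]; try simp
      · rw [(hent i).2.1, (hD i).1]; try simp
    have hs : ∑ i, p i * Real.log (|(T⁻¹ * D i * T) 0 0|) = - ∑ i, p i * Real.log (|(D i) 0 0|) := by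
      rw [← sum_neg_distrib]
      refine sum_congr rfl fun i _ => ?_
      rw [(hent i).1, diag_inv (hD i)]; ring
    have := case3_pos hp (D := fun i => T⁻¹ * D i * T) hD' (by rw [hs]; linarith)
    exact ⟨_, DH.of_conj hp T⁻¹ (D := D) (by rw [inv_inv]; exact this)⟩
  · exact ⟨_, case3_pos hp hD h⟩
end case3
end TV

namespace TV
open Finset

section tri
variable {ι : Type*} [Fintype ι] {p : ι → ℝ} {A D B : ι → SL2}

lemma lhol_zero (hp : Pr p) (h : LHol p A) : Ly p A = 0 := by
  obtain ⟨ε, C, hε, hC, H⟩ := h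
  refine le_antisymm ?_ (ly_nonneg hp A)
  by_contra hL
  push Not at hL
  set L := Ly p A with hLdef
  set d := min (ε / 2) (Real.exp (-(2 * C / L) ^ 2)) with hd
  have hd0 : 0 < d := lt_min (by linarith) (Real.exp_pos _)
  have h1 := H A d hd0 ((min_le_left _ _).trans_lt (by linarith)) (fun i => by
    rw [sub_self]; simpa [nm] using hd0.le)
  have h2 : (2 * C / L) ^ 2 ≤ Real.log (1 / d) := by
    rw [one_div, Real.log_inv]
    have := Real.log_le_log hd0 (min_le_right (ε / 2) (Real.exp (-(2 * C / L) ^ 2)))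
    rw [Real.log_exp] at this
    linarith
  have hq : 0 < 2 * C / L := by positivity
  have h3 : 2 * C / L ≤ √(Real.log (1 / d)) := Real.le_sqrt_of_sq_le h2
  have h4 : C / √(Real.log (1 / d)) ≤ C / (2 * C / L) := div_le_div_of_nonneg_left hC.le hq h3
  have h5 : C / (2 * C / L) = L / 2 := by field_simp
  linarith

lemma hol_of_close {K m : ℝ} (hK : 1 ≤ K) (hH : DH p D m)
    (h : ∀ (B : ι → SL2) (d : ℝ), 0 < d → d ≤ 1 → Cl A B d →
      ∃ B' : ι → SL2, Ly p B' = Ly p B ∧ Cl D B' (K * √d)) : Hol p A := by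
  obtain ⟨ε, C, θ, hε, hC, hθ, H⟩ := hH
  refine ⟨min 1 ((ε / K) ^ 2), 2 * C * K ^ θ, θ / 2, by positivity, by positivity, by positivity,
    fun B d hd hdε hcl => ?_⟩
  have hd1 : d ≤ 1 := (hdε.trans_le (min_le_left _ _)).le
  have hsd : 0 < √d := Real.sqrt_pos.2 hd
  have hd2 : K * √d < ε := by
    have := hdε.trans_le (min_le_right _ _)
    rw [← Real.sqrt_lt' (by positivity), lt_div_iff₀ (by linarith)] at this
    linarith
  have key : ∀ B : ι → SL2, Cl A B d → |Ly p B - m| ≤ C * (K ^ θ * d ^ (θ / 2)) := by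
    intro B hcl
    obtain ⟨B', h1, h2⟩ := h B d hd hd1 hcl
    have := H B' (K * √d) (by positivity) hd2 h2
    rw [h1] at this
    refine this.trans_eq ?_
    rw [Real.mul_rpow (by linarith) hsd.le, Real.sqrt_eq_rpow, ← Real.rpow_mul hd.le]
    congr 3; ring
  have k1 := key A (fun i => by rw [sub_self]; simpa [nm] using hd.le)
  have k2 := key B hcl
  have e : Ly p A - Ly p B = (Ly p A - m) - (Ly p B - m) := by ring
  rw [e]
  refine (abs_sub _ _).trans ?_
  linarith

lemma lhol_of_close {K : ℝ} (hK : 1 ≤ K) (hH : LHol p D)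
    (h : ∀ (B : ι → SL2) (d : ℝ), 0 < d → d ≤ 1 → Cl A B d →
      ∃ B' : ι → SL2, Ly p B' = Ly p B ∧ Cl D B' (K * √d)) : LHol p A := by
  obtain ⟨ε, C, hε, hC, H⟩ := hH
  have hK0 : 0 < K := by linarith
  refine ⟨min (min (1/2) ((ε / K) ^ 2)) (1 / K ^ 4), 2 * C, by positivity, by positivity,
    fun B d hd hdε hcl => ?_⟩
  have hd1 : d < 1 := (hdε.trans_le ((min_le_left _ _).trans (min_le_left _ _))).trans (by norm_num)
  have hsd : 0 < √d := Real.sqrt_pos.2 hd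
  have hd2 : K * √d < ε := by
    have := hdε.trans_le ((min_le_left _ _).trans (min_le_right _ _))
    rw [← Real.sqrt_lt' (by positivity), lt_div_iff₀ (by linarith)] at this
    linarith
  have hd3 : Real.log d ≤ - (4 * Real.log K) := by
    have := Real.log_le_log hd (hdε.trans_le (min_le_right _ _)).le
    rw [one_div, Real.log_inv, Real.log_pow] at this
    exact_mod_cast this
  obtain ⟨B', h1, h2⟩ := h B d hd hd1.le hcl
  have h3 := H B' (K * √d) (by positivity) hd2 h2
  rw [h1] at h3
  refine h3.trans ?_
  have hl : 0 < Real.log (1 / d) := Real.log_pos (by rw [lt_div_iff₀ hd]; linarith)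
  have h4 : Real.log (1 / d) / 4 ≤ Real.log (1 / (K * √d)) := by
    rw [one_div, one_div, Real.log_inv, Real.log_inv, Real.log_mul hK0.ne' hsd.ne',
      Real.log_sqrt hd.le]
    linarith
  have h5 : √(Real.log (1 / d)) / 2 ≤ √(Real.log (1 / (K * √d))) := by
    apply Real.le_sqrt_of_sq_le
    rw [div_pow, Real.sq_sqrt hl.le]; linarith
  have h6 : 0 < √(Real.log (1 / d)) := Real.sqrt_pos.2 hl
  refine (div_le_div_of_nonneg_left hC.le (by positivity) h5).trans_eq ?_
  field_simp

/-- The dichotomy. -/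
def Core (p : ι → ℝ) (A : ι → SL2) : Prop := Hol p A ∨ (Ly p A = 0 ∧ LHol p A)

lemma Core.of_conj (hp : Pr p) (S : SL2) (h : Core p (fun i => S * A i * S⁻¹)) : Core p A := by
  have hK : 1 ≤ nm S ^ 2 := one_le_pow₀ (nm_ge_one S)
  have hcl : ∀ (B : ι → SL2) (d : ℝ), 0 < d → d ≤ 1 → Cl A B d →
      ∃ B' : ι → SL2, Ly p B' = Ly p B ∧ Cl (fun i => S * A i * S⁻¹) B' (nm S ^ 2 * √d) := by
    intro B d hd hd1 hcl
    refine ⟨_, ly_conj hp S B, fun i => (hcl.conj S i).trans ?_⟩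
    refine mul_le_mul_of_nonneg_left ?_ (by positivity)
    apply Real.le_sqrt_of_sq_le
    rw [sq]; exact mul_le_of_le_one_left hd.le hd1
  rcases h with h | ⟨-, h⟩
  · left
    obtain ⟨ε, C, θ, h1, h2, h3, H⟩ := h
    exact hol_of_close hK ⟨ε, C, θ, h1, h2, h3, fun B d a b c => by
      rw [abs_sub_comm]; exact H B d a b c⟩ hcl
  · right
    have := lhol_of_close hK h hcl
    exact ⟨lhol_zero hp this, this⟩

lemma core_tri (hp : Pr p) (hA : ∀ i, (A i) 1 0 = 0) : Core p A := by
  obtain ⟨M, hM, hMA⟩ := exists_nm_bound A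
  set D : ι → SL2 := fun i => ⟨!![(A i) 0 0, 0; 0, (A i) 1 1], by
    have := det2 (A i)
    rw [hA i, mul_zero, sub_zero] at this
    rw [Matrix.det_fin_two_of, mul_zero, sub_zero, this]⟩ with hDdef
  have D00 : ∀ i, (D i) 0 0 = (A i) 0 0 := fun i => rfl
  have D01 : ∀ i, (D i) 0 1 = 0 := fun i => rfl
  have D10 : ∀ i, (D i) 1 0 = 0 := fun i => rfl
  have D11 : ∀ i, (D i) 1 1 = (A i) 1 1 := fun i => rfl
  have hD : ∀ i, (D i) 0 1 = 0 ∧ (D i) 1 0 = 0 := fun i => ⟨D01 i, D10 i⟩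
  have hcl : ∀ (B : ι → SL2) (d : ℝ), 0 < d → d ≤ 1 → Cl A B d →
      ∃ B' : ι → SL2, Ly p B' = Ly p B ∧ Cl D B' ((M + 4) * √d) := by
    intro B d hd hd1 hcl
    set q := √d with hq
    have hq0 : 0 < q := Real.sqrt_pos.2 hd
    have hqq : q * q = d := Real.mul_self_sqrt hd.le
    have hdq : d ≤ q := by
      rw [hq]; apply Real.le_sqrt_of_sq_le
      rw [sq]; exact mul_le_of_le_one_left hd.le hd1
    set c := √q with hc
    have hc0 : 0 < c := Real.sqrt_pos.2 hq0
    have hcc : c * c = q := Real.mul_self_sqrt hq0.le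
    have hT : wd ![c⁻¹, 0] ![0, c] = 1 := by simp [wd, hc0.ne']
    set T := colM ![c⁻¹, 0] ![0, c] hT with hTdef
    have hcon := ly_conj hp T⁻¹ B
    rw [inv_inv] at hcon
    refine ⟨_, hcon, fun i => ?_⟩
    obtain ⟨h00, h10, h01, h11⟩ := conj_entries _ _ hT (B i)
    simp only [wd, ac0, ac1, Matrix.cons_val_zero, Matrix.cons_val_one, mul_zero, add_zero,
      zero_mul, sub_zero, zero_add] at h00 h10 h01 h11
    unfold nm
    simp only [Matrix.sub_apply]
    rw [h00, h10, h01, h11, D00, D01, D10, D11]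
    have t1 : |(A i) 0 0 - (B i) 0 0 * c⁻¹ * c| ≤ q := by
      rw [mul_assoc, inv_mul_cancel₀ hc0.ne', mul_one, abs_sub_comm]
      exact (hcl.entry i 0 0).trans hdq
    have t4 : |(A i) 1 1 - c⁻¹ * ((B i) 1 1 * c)| ≤ q := by
      rw [mul_comm ((B i) 1 1), ← mul_assoc, inv_mul_cancel₀ hc0.ne', one_mul, abs_sub_comm]
      exact (hcl.entry i 1 1).trans hdq
    have t2 : |0 - (B i) 0 1 * c * c| ≤ (M + 1) * q := by
      rw [zero_sub, abs_neg, mul_assoc, hcc, abs_mul, abs_of_pos hq0]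
      exact mul_le_mul_of_nonneg_right (nm_entry (hcl.bound hMA hd1 i) 0 1) hq0.le
    have t3 : |0 - c⁻¹ * ((B i) 1 0 * c⁻¹)| ≤ q := by
      have h := hcl.entry i 1 0
      rw [hA i, sub_zero] at h
      have e : c⁻¹ * ((B i) 1 0 * c⁻¹) = (B i) 1 0 / q := by rw [← hcc]; field_simp
      rw [zero_sub, abs_neg, e, abs_div, abs_of_pos hq0, div_le_iff₀ hq0, hqq]
      exact h
    linarith
  by_cases hm : ∑ i, p i * Real.log (|(D i) 0 0|) = 0
  · right
    obtain ⟨C, hC⟩ := diag_sqrt hp hD hm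
    have := lhol_of_close (by linarith : 1 ≤ M + 4) (lemU hp hC).2 hcl
    exact ⟨lhol_zero hp this, this⟩
  · left
    obtain ⟨m, h⟩ := case3 hp hD hm
    exact hol_of_close (by linarith : 1 ≤ M + 4) h hcl

lemma core_line (hp : Pr p) {z : V} (hz : z ≠ 0) (h : ∀ i, wd (ac (A i) z) z = 0) : Core p A := by
  have hn : 0 < z 0 ^ 2 + z 1 ^ 2 := by
    by_contra hcon
    push Not at hcon
    have h0 : z 0 = 0 := pow_eq_zero_iff two_ne_zero |>.1 (by linarith [sq_nonneg (z 0), sq_nonneg (z 1)])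
    have h1 : z 1 = 0 := pow_eq_zero_iff two_ne_zero |>.1 (by linarith [sq_nonneg (z 0), sq_nonneg (z 1)])
    exact hz (by ext i; fin_cases i <;> simp [h0, h1])
  have hT : wd z ![- (z 1) / (z 0 ^ 2 + z 1 ^ 2), z 0 / (z 0 ^ 2 + z 1 ^ 2)] = 1 := by
    simp only [wd, Matrix.cons_val_zero, Matrix.cons_val_one]
    field_simp; ring
  refine Core.of_conj hp (colM _ _ hT)⁻¹ ?_
  rw [inv_inv]
  refine core_tri hp fun i => ?_
  rw [(conj_entries _ _ hT (A i)).2.1, wd_swap, h i, neg_zero]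

lemma core_lazy (hp : Pr p) {o : ι} (ho : A o = 1) : Core p A := by
  by_cases hirr : ∃ z : V, z ≠ 0 ∧ ∀ i, wd (ac (A i) z) z = 0
  · obtain ⟨z, hz, h⟩ := hirr
    exact core_line hp hz h
  have hsq : (∃ m, Mean A m) → Ly p A = 0 ∧ LHol p A := by
    rintro ⟨m, hm⟩
    rcases hm.tri with ⟨R, hR⟩ | hb | ⟨z1, z2, h12, h⟩
    · obtain ⟨C, hC⟩ := bdd_sqrt hp hR
      exact lemU hp hC
    · exact absurd hb hirr
    · obtain ⟨C, hC⟩ := pair_sqrt hp h12 h hirr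
      exact lemU hp hC
  rcases (ly_nonneg hp A).eq_or_lt with hL | hL
  · exact Or.inr (hsq (mean_of_ly_zero hp ho hL.symm))
  · left
    by_contra hcon
    refine hL.ne' (hsq (mean_of_no_atoms hp ho fun k => ?_)).1
    by_contra hk
    push Not at hk
    exact hcon (hol_of_atoms hp hL (k := k) fun v z hv hz => hk v z hv hz)

theorem core (hp : Pr p) (A : ι → SL2) : Hol p A ∨ (Ly p A = 0 ∧ LHol p A) := by
  rcases core_lazy (A := lA A) (lp_pr hp) (o := none) rfl with h | ⟨h1, h2⟩
  · exact Or.inl (h.of_lazy hp)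
  · have h3 := h2.of_lazy hp
    exact Or.inr ⟨lhol_zero hp h3, h3⟩
end tri
end TV

/-- **Tall–Viana pointwise regularity theorem.**
(1) If `L(A) > 0`, then `L` is pointwise Hölder at `A`.
(2) At every `A`, `L` is pointwise log-Hölder. -/
theorem tall_viana_pointwise_regularity {κ : ℕ} (hκ : 2 ≤ κ) (p : Fin κ → ℝ)
    (hp : ∀ i, 0 < p i) (hp1 : ∑ i, p i = 1) :
    (∀ A : Fin κ → SL2, 0 < lyapLC p A →
      ∃ ε C θ : ℝ, 0 < ε ∧ 0 < C ∧ 0 < θ ∧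
        ∀ B : Fin κ → SL2, tdist A B < ε →
          |lyapLC p A - lyapLC p B| ≤ C * (tdist A B) ^ θ) ∧
    (∀ A : Fin κ → SL2,
      ∃ ε C θ : ℝ, 0 < ε ∧ 0 < C ∧ 0 < θ ∧
        ∀ B : Fin κ → SL2, tdist A B < ε → B ≠ A →
          |lyapLC p A - lyapLC p B| ≤ C * (Real.log (1 / tdist A B)) ^ (-θ)) := by
  exact TV.final_aux hκ p ⟨hp, hp1⟩ (TV.core ⟨hp, hp1⟩)
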